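/- Let k be an algebraically closed field of characteristic zero. A variety X over k is groupless (every morphism 𝔾_m → X and every morphism A → X from an abelian variety A is constant) if and only if for every finite type connected group scheme G over k, every morphism G → X is constant. -/

import Mathlib

/-!
Formalization of a statement from "The Lang–Vojta conjectures on projective
pseudo-hyperbolic varieties" (Javanpeykar).

Notions not available in Mathlib (analytifications, genus, ample degrees, Hom-schemes, ...)
are encoded by explicit definitions or structures below; see the docstrings for the
conventions used.
-/

open CategoryTheory AlgebraicGeometry Limits

noncomputable section

/-- `Spec R` as a scheme, for a commutative ring `R`. -/
abbrev SR (R : Type) [CommRing R] : Scheme := Spec (CommRingCat.of R)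

/-- The category of schemes over `Spec R`. -/
abbrev OverR (R : Type) [CommRing R] := Over (SR R)

/-- A morphism of schemes over `Spec R` is constant if it factors through the base `Spec R`. -/
def IsConstant {R : Type} [CommRing R] {X Y : OverR R} (f : X ⟶ Y) : Prop :=
  ∃ y : SR R ⟶ Y.left, f.left = X.hom ≫ y

/-- A morphism `g : V ⟶ W` of schemes, where `V` has structure morphism `sV` to `Spec R`,
is constant if it factors through `Spec R`. -/
def IsConstantHom {R : Type} [CommRing R] {V W : Scheme} (sV : V ⟶ SR R) (g : V ⟶ W) : Prop :=
  ∃ y : SR R ⟶ W, g = sV ≫ y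

/-- A variety over `R`: a finite type, separated scheme over `Spec R`. -/
def IsVarietyOver {R : Type} [CommRing R] (X : OverR R) : Prop :=
  LocallyOfFiniteType X.hom ∧ QuasiCompact X.hom ∧ IsSeparated X.hom

/-- The multiplicative group scheme `𝔾ₘ` over `R`, i.e. the spectrum of the Laurent
polynomial ring over `R` (only its underlying scheme over `Spec R` is needed). -/
def GmO (R : Type) [CommRing R] : OverR R :=
  Over.mk (Spec.map (CommRingCat.ofHom (algebraMap R (LaurentPolynomial R))))

/-- The affine line over `R`. -/
def A1O (R : Type) [CommRing R] : OverR R :=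
  Over.mk (Spec.map (CommRingCat.ofHom (algebraMap R (Polynomial R))))

/-- `Spec R` as the terminal object of the category of schemes over `Spec R`. -/
def ptO (R : Type) [CommRing R] : OverR R := Over.mk (𝟙 (SR R))

/-- A group scheme over `R`, presented via a group structure on its functor of points:
by the Yoneda lemma this is the same as a group object in the category of schemes
over `Spec R`. -/
structure GroupScheme (R : Type) [CommRing R] where
  G : OverR R
  mul : ∀ {T : OverR R}, (T ⟶ G) → (T ⟶ G) → (T ⟶ G)
  one : ∀ (T : OverR R), T ⟶ G
  inv : ∀ {T : OverR R}, (T ⟶ G) → (T ⟶ G)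
  mul_assoc : ∀ {T : OverR R} (a b c : T ⟶ G), mul (mul a b) c = mul a (mul b c)
  one_mul : ∀ {T : OverR R} (a : T ⟶ G), mul (one T) a = a
  inv_mul : ∀ {T : OverR R} (a : T ⟶ G), mul (inv a) a = one T
  mul_natural : ∀ {T T' : OverR R} (f : T ⟶ T') (a b : T' ⟶ G),
    f ≫ mul a b = mul (f ≫ a) (f ≫ b)
  one_natural : ∀ {T T' : OverR R} (f : T ⟶ T'), f ≫ one T' = one T

/-- A finite type, connected group scheme over `R`. -/
def GroupScheme.IsFiniteTypeConnected {R : Type} [CommRing R] (Γ : GroupScheme R) : Prop :=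
  LocallyOfFiniteType Γ.G.hom ∧ QuasiCompact Γ.G.hom ∧ ConnectedSpace Γ.G.left

/-- An abelian variety over `R`: a connected finite type proper group scheme. (Over an
algebraically closed field of characteristic zero this agrees with the usual definition,
since group schemes are then automatically smooth by Cartier's theorem.) -/
def GroupScheme.IsAbelianVariety {R : Type} [CommRing R] (Γ : GroupScheme R) : Prop :=
  Γ.IsFiniteTypeConnected ∧ IsProper Γ.G.hom

/-- A scheme over `R` is groupless if every morphism to it from `𝔾ₘ` and from any abelian
variety over `R` is constant. -/
def IsGroupless (R : Type) [CommRing R] (X : OverR R) : Prop :=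
  (∀ f : GmO R ⟶ X, IsConstant f) ∧
  (∀ Γ : GroupScheme R, Γ.IsAbelianVariety → ∀ f : Γ.G ⟶ X, IsConstant f)

/-- A subset `Z` of a topological space has codimension at least two: every point of
`Z` admits a chain of two strict generizations (this computes the codimension of the
closure of each point of `Z` via the specialization order). -/
def CodimAtLeastTwo {T : Type} [TopologicalSpace T] (Z : Set T) : Prop :=
  ∀ z ∈ Z, ∃ x y : T, x ⤳ y ∧ y ⤳ z ∧ ¬(y ⤳ x) ∧ ¬(z ⤳ y)

/-- `X` is groupless modulo the closed subset `Δ` if for every finite type connected group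
scheme `G` over `R` and every dense open `U ⊆ G` whose complement has codimension at least
two, every non-constant morphism `U ⟶ X` over `R` factors over `Δ`. -/
def GrouplessModulo (R : Type) [CommRing R] (X : OverR R) (Δ : Set X.left) : Prop :=
  ∀ (Γ : GroupScheme R), Γ.IsFiniteTypeConnected →
    ∀ (U : Γ.G.left.Opens), Dense (U : Set Γ.G.left) →
      CodimAtLeastTwo ((U : Set Γ.G.left)ᶜ) →
      ∀ g : U.toScheme ⟶ X.left, g ≫ X.hom = U.ι ≫ Γ.G.hom →
        ¬ IsConstantHom (U.ι ≫ Γ.G.hom) g → Set.range g.base ⊆ Δ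

/-- `X` is pseudo-groupless if it is groupless modulo some proper closed subset. -/
def PseudoGroupless (R : Type) [CommRing R] (X : OverR R) : Prop :=
  ∃ Δ : Set X.left, IsClosed Δ ∧ Δ ≠ Set.univ ∧ GrouplessModulo R X Δ

section
open CategoryTheory AlgebraicGeometry Limits

noncomputable section

section Points

instance GroupScheme.instGroupHom {R : Type} [CommRing R] (Γ : GroupScheme R) (T : OverR R) :
    Group (T ⟶ Γ.G) :=
  letI : Mul (T ⟶ Γ.G) := ⟨Γ.mul⟩
  letI : One (T ⟶ Γ.G) := ⟨Γ.one T⟩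
  letI : Inv (T ⟶ Γ.G) := ⟨Γ.inv⟩
  Group.ofLeftAxioms Γ.mul_assoc Γ.one_mul Γ.inv_mul

lemma GroupScheme.comp_mul {R : Type} [CommRing R] (Γ : GroupScheme R) {T T' : OverR R}
    (f : T ⟶ T') (a b : T' ⟶ Γ.G) : f ≫ (a * b) = (f ≫ a) * (f ≫ b) :=
  Γ.mul_natural f a b

lemma GroupScheme.comp_one {R : Type} [CommRing R] (Γ : GroupScheme R) {T T' : OverR R}
    (f : T ⟶ T') : f ≫ (1 : T' ⟶ Γ.G) = 1 :=
  Γ.one_natural f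

lemma GroupScheme.comp_inv {R : Type} [CommRing R] (Γ : GroupScheme R) {T T' : OverR R}
    (f : T ⟶ T') (a : T' ⟶ Γ.G) : f ≫ a⁻¹ = (f ≫ a)⁻¹ := by
  rw [eq_inv_iff_mul_eq_one, ← Γ.comp_mul, inv_mul_cancel, Γ.comp_one]

variable (k : Type) [Field k]

/-- `Spec A` as a `k`-scheme. -/
abbrev SpO (A : Type) [CommRing A] [Algebra k A] : OverR k :=
  Over.mk (Spec.map (CommRingCat.ofHom (algebraMap k A)))

variable {k}

/-- Functoriality of `SpO`. -/
def SpO.map {A A' : Type} [CommRing A] [Algebra k A] [CommRing A'] [Algebra k A']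
    (f : A →ₐ[k] A') : SpO k A' ⟶ SpO k A :=
  Over.homMk (Spec.map (CommRingCat.ofHom f.toRingHom)) (by
    change Spec.map _ ≫ Spec.map _ = Spec.map _
    rw [← Spec.map_comp, ← CommRingCat.ofHom_comp]
    congr 2
    exact f.comp_algebraMap)

section
variable {A A' A'' : Type} [CommRing A] [Algebra k A] [CommRing A'] [Algebra k A']
  [CommRing A''] [Algebra k A'']

lemma SpO.map_left (f : A →ₐ[k] A') :
    (SpO.map f).left = Spec.map (CommRingCat.ofHom f.toRingHom) := rfl

lemma SpO.map_comp (f : A →ₐ[k] A') (g : A' →ₐ[k] A'') :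
    SpO.map (g.comp f) = SpO.map g ≫ SpO.map f := by
  ext1
  change Spec.map _ = Spec.map _ ≫ Spec.map _
  rw [← Spec.map_comp]
  rfl

lemma SpO.map_id : SpO.map (AlgHom.id k A) = 𝟙 _ := by
  ext1
  change Spec.map _ = 𝟙 _
  rw [← Spec.map_id]
  rfl

lemma SpO.map_injective : Function.Injective (SpO.map (k := k) (A := A) (A' := A')) := by
  intro f g h
  have := congr(($h).left)
  rw [SpO.map_left, SpO.map_left] at this
  have := Spec.map_injective this
  ext x
  exact congr(($this).hom x)

lemma SpO.map_surjective (f : SpO k A' ⟶ SpO k A) : ∃ φ : A →ₐ[k] A', f = SpO.map φ := by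
  obtain ⟨φ, hφ⟩ := Spec.map_surjective f.left
  have hw := Over.w f
  rw [← hφ] at hw
  change Spec.map _ ≫ Spec.map _ = Spec.map _ at hw
  rw [← Spec.map_comp] at hw
  have := Spec.map_injective hw
  refine ⟨⟨φ.hom, fun r => congr(($this).hom r)⟩, ?_⟩
  ext1
  exact hφ.symm

lemma SpO.map_apply (f : A →ₐ[k] A') (x : PrimeSpectrum A') :
    (SpO.map f).left x = PrimeSpectrum.comap f.toRingHom x := rfl

/-- Factor a point through an affine chart. -/
lemma chart_factor {X : OverR k} (j : SpO k A ⟶ X) [IsOpenImmersion j.left]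
    (f : SpO k A' ⟶ X) (h : Set.range f.left ⊆ Set.range j.left) :
    ∃ φ : A →ₐ[k] A', f = SpO.map φ ≫ j := by
  let l := IsOpenImmersion.lift j.left f.left h
  have hl : l ≫ j.left = f.left := IsOpenImmersion.lift_fac _ _ _
  let l' : SpO k A' ⟶ SpO k A := Over.homMk l (by
    rw [← Over.w j, ← Category.assoc, hl, Over.w f])
  obtain ⟨φ, hφ⟩ := SpO.map_surjective l'
  refine ⟨φ, ?_⟩
  rw [← hφ]
  ext1
  exact hl.symm

lemma chart_cancel {X : OverR k} (j : SpO k A ⟶ X) [IsOpenImmersion j.left]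
    {φ ψ : A →ₐ[k] A'} (h : SpO.map φ ≫ j = SpO.map ψ ≫ j) : φ = ψ := by
  apply SpO.map_injective
  ext1
  rw [← cancel_mono j.left]
  exact congr(($h).left)

/-- If a point lands in a chart modulo an ideal in the Jacobson radical then it lands there. -/
lemma chart_range_of_jacobson {X : OverR k} (j : SpO k A ⟶ X) [IsOpenImmersion j.left]
    (f : SpO k A' ⟶ X) (π : A' →ₐ[k] A'') (hπ : Function.Surjective π)
    (hJ : RingHom.ker π ≤ Ideal.jacobson ⊥)
    (h : Set.range (SpO.map π ≫ f).left ⊆ Set.range j.left) :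
    Set.range f.left ⊆ Set.range j.left := by
  have key : ∀ x : PrimeSpectrum A', f.left x ∈ Set.range j.left := by
    intro x
    obtain ⟨m, hm, hxm⟩ := x.asIdeal.exists_le_maximal x.2.ne_top
    have hkm : RingHom.ker π ≤ m := hJ.trans (by
      rw [Ideal.jacobson]
      exact sInf_le ⟨bot_le, hm⟩)
    have hmr : (⟨m, hm.isPrime⟩ : PrimeSpectrum A') ∈
        Set.range (PrimeSpectrum.comap π.toRingHom) := by
      rw [range_comap_of_surjective _ _ hπ]
      exact hkm
    obtain ⟨y, hy⟩ := hmr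
    have h1 : f.left (⟨m, hm.isPrime⟩ : PrimeSpectrum A') ∈ Set.range j.left := by
      apply h
      refine ⟨y, ?_⟩
      rw [← hy]
      rfl
    have hsp : x ⤳ (⟨m, hm.isPrime⟩ : PrimeSpectrum A') :=
      (PrimeSpectrum.le_iff_specializes _ _).mp hxm
    have hsp' := hsp.map f.left.continuous
    exact hsp'.mem_open j.left.isOpenEmbedding.isOpen_range h1
  rintro _ ⟨x, rfl⟩
  exact key x

lemma chart_factor_of_jacobson {X : OverR k} (j : SpO k A ⟶ X) [IsOpenImmersion j.left]
    (f : SpO k A' ⟶ X) (π : A' →ₐ[k] A'') (hπ : Function.Surjective π)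
    (hJ : RingHom.ker π ≤ Ideal.jacobson ⊥) (ψ : A →ₐ[k] A'')
    (h : SpO.map π ≫ f = SpO.map ψ ≫ j) :
    ∃ φ : A →ₐ[k] A', f = SpO.map φ ≫ j ∧ π.comp φ = ψ := by
  have h1 : Set.range f.left ⊆ Set.range j.left := by
    apply chart_range_of_jacobson j f π hπ hJ
    rw [h]
    rintro _ ⟨x, rfl⟩
    exact ⟨(SpO.map ψ).left x, rfl⟩
  obtain ⟨φ, rfl⟩ := chart_factor j f h1
  refine ⟨φ, rfl, ?_⟩
  apply chart_cancel j
  rw [SpO.map_comp, Category.assoc, h]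

end

/-- Affine charts around points. -/
lemma exists_chart (X : OverR k) (x : X.left) :
    ∃ (B : Type) (_ : CommRing B) (_ : Algebra k B) (j : SpO k B ⟶ X),
      IsOpenImmersion j.left ∧ x ∈ Set.range j.left ∧
      (LocallyOfFiniteType X.hom → Algebra.FiniteType k B) := by
  obtain ⟨R, f, hf, hx, -⟩ := Scheme.exists_affine_mem_range_and_range_subset
    (X := X.left) (x := x) (U := ⊤) trivial
  obtain ⟨α, hα⟩ := Spec.map_surjective (f ≫ X.hom)
  letI : Algebra k R := α.hom.toAlgebra
  refine ⟨R, inferInstance, inferInstance, Over.homMk f ?_, hf, hx, ?_⟩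
  · exact hα.symm
  · intro h
    have h1 : LocallyOfFiniteType (f ≫ X.hom) := inferInstance
    rw [← hα] at h1
    rw [HasRingHomProperty.Spec_iff (P := @LocallyOfFiniteType)] at h1
    exact h1

end Points
end
end

section
open CategoryTheory AlgebraicGeometry Limits
open scoped TensorProduct

noncomputable section

section IdChart
variable {k : Type} [Field k]

/-- An affine chart around the identity of a group scheme. -/
structure IdChart (Γ : GroupScheme k) where
  B : Type
  [cr : CommRing B]
  [alg : Algebra k B]
  j : SpO k B ⟶ Γ.G
  oi : IsOpenImmersion j.left
  e : B →ₐ[k] k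
  he : SpO.map e ≫ j = 1

attribute [instance] IdChart.cr IdChart.alg IdChart.oi

lemma exists_idChart (Γ : GroupScheme k) (h : LocallyOfFiniteType Γ.G.hom) :
    ∃ c : IdChart Γ, Algebra.FiniteType k c.B := by
  let p : SpO k k ⟶ Γ.G := 1
  obtain ⟨B, _, _, j, hj, hx, hft⟩ := exists_chart Γ.G (p.left (⊥ : PrimeSpectrum k))
  have hr : Set.range p.left ⊆ Set.range j.left := by
    rintro _ ⟨x, rfl⟩
    have : x = (⊥ : PrimeSpectrum k) := Subsingleton.elim (α := PrimeSpectrum k) _ _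
    rw [this]; exact hx
  obtain ⟨e, he⟩ := chart_factor j p hr
  exact ⟨⟨B, j, hj, e, he.symm⟩, hft h⟩

namespace IdChart
variable {Γ : GroupScheme k} (c : IdChart Γ)

/-- The augmentation ideal. -/
abbrev m : Ideal c.B := RingHom.ker c.e

/-- The first infinitesimal neighbourhood. -/
abbrev N : Type := c.B ⧸ (c.m ^ 2)

/-- The quotient map. -/
abbrev mkN : c.B →ₐ[k] c.N := Ideal.Quotient.mkₐ k (c.m ^ 2)

/-- augmentation of `N`. -/
def eN : c.N →ₐ[k] k := Ideal.Quotient.liftₐ (c.m ^ 2) c.e (fun a ha => by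
  have : a ∈ c.m := Ideal.pow_le_self (by norm_num) ha
  exact this)

lemma eN_mkN : c.eN.comp c.mkN = c.e := by
  ext b; rfl

lemma eN_surj : Function.Surjective c.eN := fun a => ⟨algebraMap k _ a, by simp⟩

lemma ker_eN : (RingHom.ker c.eN) ^ 2 = ⊥ := by
  have : RingHom.ker c.eN = (c.m).map (Ideal.Quotient.mk (c.m ^ 2)) := by
    ext x
    obtain ⟨b, rfl⟩ := Ideal.Quotient.mk_surjective x
    rw [Ideal.mem_map_iff_of_surjective _ Ideal.Quotient.mk_surjective]
    constructor
    · intro h; exact ⟨b, h, rfl⟩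
    · rintro ⟨b', h, h'⟩
      rw [← h']; exact h
  rw [this, ← Ideal.map_pow, Ideal.map_quotient_self]

/-- the projection `B ⊗ N → B`. -/
def prB : c.B ⊗[k] c.N →ₐ[k] c.B :=
  Algebra.TensorProduct.productMap (AlgHom.id k c.B) ((Algebra.ofId k c.B).comp c.eN)

lemma prB_surj : Function.Surjective c.prB := fun b => ⟨b ⊗ₜ 1, by simp [prB]⟩

lemma ker_prB : RingHom.ker c.prB ≤ Ideal.jacobson ⊥ := by
  have h1 : c.prB = ((Algebra.TensorProduct.rid k k c.B).toAlgHom).comp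
      (Algebra.TensorProduct.map (AlgHom.id k c.B) c.eN) := by
    ext x
    · simp [prB]
    · simp [prB, Algebra.ofId_apply, Algebra.algebraMap_eq_smul_one]
  have h2 : RingHom.ker c.prB = RingHom.ker
      (Algebra.TensorProduct.map (AlgHom.id k c.B) c.eN) := by
    ext x
    rw [h1, RingHom.mem_ker, RingHom.mem_ker]
    change (Algebra.TensorProduct.rid k k c.B) _ = 0 ↔ _
    rw [EmbeddingLike.map_eq_zero_iff]; rfl
  rw [h2, Algebra.TensorProduct.lTensor_ker _ c.eN_surj]
  have h3 : ((RingHom.ker c.eN).map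
      (Algebra.TensorProduct.includeRight : c.N →ₐ[k] c.B ⊗[k] c.N)) ^ 2 = ⊥ := by
    rw [← Ideal.map_pow, c.ker_eN, Ideal.map_bot]
  intro x hx
  apply Ideal.radical_le_jacobson
  refine ⟨2, ?_⟩
  rw [← h3]
  exact Ideal.pow_mem_pow hx 2

lemma exists_rho : ∃ ρ : c.B →ₐ[k] c.B ⊗[k] c.N,
    (SpO.map (Algebra.TensorProduct.includeLeft : c.B →ₐ[k] c.B ⊗[k] c.N) ≫ c.j) *
    (SpO.map ((Algebra.TensorProduct.includeRight : c.N →ₐ[k] c.B ⊗[k] c.N).comp c.mkN) ≫ c.j)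
      = SpO.map ρ ≫ c.j := by
  obtain ⟨ρ, h, -⟩ := chart_factor_of_jacobson c.j
    ((SpO.map (Algebra.TensorProduct.includeLeft : c.B →ₐ[k] c.B ⊗[k] c.N) ≫ c.j) *
    (SpO.map ((Algebra.TensorProduct.includeRight : c.N →ₐ[k] c.B ⊗[k] c.N).comp c.mkN) ≫ c.j))
    c.prB c.prB_surj c.ker_prB (AlgHom.id k c.B) (by
      rw [Γ.comp_mul, ← Category.assoc, ← SpO.map_comp, ← Category.assoc, ← SpO.map_comp]
      have e1 : c.prB.comp Algebra.TensorProduct.includeLeft = AlgHom.id k c.B := by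
        ext; simp [prB]
      have e2 : c.prB.comp ((Algebra.TensorProduct.includeRight).comp c.mkN) =
          (Algebra.ofId k c.B).comp c.e := by
        rw [← c.eN_mkN]
        ext; simp [prB]
      rw [e1, e2, SpO.map_comp (c.e), Category.assoc, c.he, Γ.comp_one, mul_one])
  exact ⟨ρ, h⟩

/-- the coaction. -/
def rho : c.B →ₐ[k] c.B ⊗[k] c.N := c.exists_rho.choose

variable {A : Type} [CommRing A] [Algebra k A]

/-- The `A`-point with coordinates `Y`. -/
def pt (Y : c.B →ₐ[k] A) : SpO k A ⟶ Γ.G := SpO.map Y ≫ c.j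

variable {A' : Type} [CommRing A'] [Algebra k A']

lemma map_pt (Y : c.B →ₐ[k] A) (f : A →ₐ[k] A') : SpO.map f ≫ c.pt Y = c.pt (f.comp Y) := by
  rw [pt, pt, SpO.map_comp, Category.assoc]

lemma pt_inj {Y Y' : c.B →ₐ[k] A} (h : c.pt Y = c.pt Y') : Y = Y' := chart_cancel c.j h

lemma pt_e : c.pt ((Algebra.ofId k A).comp c.e) = 1 := by
  rw [← map_pt, pt, c.he, Γ.comp_one]

lemma pt_mul (Y : c.B →ₐ[k] A) (θ : c.N →ₐ[k] A) :
    c.pt Y * c.pt (θ.comp c.mkN) = c.pt ((Algebra.TensorProduct.productMap Y θ).comp c.rho) := by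
  have h := c.exists_rho.choose_spec
  have h2 := congr(SpO.map (Algebra.TensorProduct.productMap Y θ) ≫ $h)
  rw [Γ.comp_mul, ← Category.assoc, ← SpO.map_comp, ← Category.assoc, ← SpO.map_comp,
    ← Category.assoc, ← SpO.map_comp, ← AlgHom.comp_assoc] at h2
  simp only [Algebra.TensorProduct.productMap_left, Algebra.TensorProduct.productMap_right] at h2
  exact h2

lemma counit : (Algebra.TensorProduct.productMap ((Algebra.ofId k c.N).comp c.e)
    (AlgHom.id k c.N)).comp c.rho = c.mkN := by
  apply c.pt_inj
  rw [← pt_mul, pt_e, one_mul]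
  rfl

lemma right_counit : c.prB.comp c.rho = AlgHom.id k c.B := by
  apply c.pt_inj
  rw [prB, ← pt_mul, AlgHom.comp_assoc, eN_mkN, pt_e, mul_one]

/-- `Y ⊗ w` applied to the coaction. -/
def act (Y : c.B →ₐ[k] A) (w : c.N →ₗ[k] A) : c.B →ₗ[k] A :=
  (LinearMap.mul' k A).comp ((TensorProduct.map Y.toLinearMap w).comp c.rho.toLinearMap)

lemma act_apply (Y : c.B →ₐ[k] A) (w : c.N →ₗ[k] A) (b : c.B) :
    c.act Y w b = LinearMap.mul' k A (TensorProduct.map Y.toLinearMap w (c.rho b)) := rfl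

lemma exists_rho_sum (b : c.B) : ∃ (ι : Type) (s : Finset ι) (f : ι → c.B) (g : ι → c.N),
    c.rho b = ∑ i ∈ s, f i ⊗ₜ g i := by
  obtain ⟨S, hS⟩ := TensorProduct.exists_finset (c.rho b)
  exact ⟨_, S, fun i => i.1, fun i => i.2, hS⟩

lemma act_sum {ι : Type} {s : Finset ι} {f : ι → c.B} {g : ι → c.N} {b : c.B}
    (h : c.rho b = ∑ i ∈ s, f i ⊗ₜ g i) (Y : c.B →ₐ[k] A) (w : c.N →ₗ[k] A) :
    c.act Y w b = ∑ i ∈ s, Y (f i) * w (g i) := by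
  rw [act_apply, h]; simp

lemma map_act (Y : c.B →ₐ[k] A) (w : c.N →ₗ[k] A) (f : A →ₐ[k] A') (b : c.B) :
    f (c.act Y w b) = c.act (f.comp Y) (f.toLinearMap.comp w) b := by
  obtain ⟨ι, s, x, y, h⟩ := c.exists_rho_sum b
  rw [c.act_sum h, c.act_sum h]; simp

lemma act_e (w : c.N →ₗ[k] A) (b : c.B) :
    c.act ((Algebra.ofId k A).comp c.e) w b = w (c.mkN b) := by
  obtain ⟨ι, s, x, y, h⟩ := c.exists_rho_sum b
  rw [c.act_sum h, ← c.counit, AlgHom.comp_apply, h]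
  simp [Algebra.ofId_apply, ← Algebra.smul_def]

end IdChart
end IdChart
end
end

section
open CategoryTheory AlgebraicGeometry Limits
open scoped TensorProduct

noncomputable section

section LogDer
variable {k : Type} [Field k]

section dual
variable {A : Type} [CommRing A] [Algebra k A] {A' : Type} [CommRing A'] [Algebra k A']

def dualHom (D : Derivation k A A) : A →ₐ[k] TrivSqZeroExt A A where
  toFun a := (a, D a)
  map_one' := by
    ext
    · rfl
    · change D 1 = 0
      simp
  map_zero' := by
    ext
    · rfl
    · change D 0 = 0
      simp
  map_add' a b := by
    ext
    · rfl
    · exact map_add D a b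
  map_mul' a b := by
    ext
    · rfl
    · change D (a * b) = a • D b + MulOpposite.op b • D a
      rw [D.leibniz, op_smul_eq_smul]
  commutes' r := by
    ext
    · rfl
    · change D (algebraMap k A r) = 0
      simp

lemma dualHom_fst (D : Derivation k A A) (a : A) : (dualHom D a).fst = a := rfl
lemma dualHom_snd (D : Derivation k A A) (a : A) : (dualHom D a).snd = D a := rfl

/-- `a + ε b ↦ f a + ε y f b`. -/
def dualMap (f : A →ₐ[k] A') (y : A') : TrivSqZeroExt A A →ₐ[k] TrivSqZeroExt A' A' where
  toFun a := (f a.fst, y * f a.snd)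
  map_one' := by
    ext
    · change f 1 = 1
      simp
    · change y * f 0 = 0
      simp
  map_zero' := by
    ext
    · change f 0 = 0
      simp
    · change y * f 0 = 0
      simp
  map_add' a b := by
    ext
    · exact map_add f _ _
    · change y * f (a.snd + b.snd) = y * f a.snd + y * f b.snd
      rw [map_add, mul_add]
  map_mul' a b := by
    ext
    · exact map_mul f _ _
    · change y * f (a.fst • b.snd + MulOpposite.op b.fst • a.snd) =
        f a.fst • (y * f b.snd) + MulOpposite.op (f b.fst) • (y * f a.snd)
      simp only [op_smul_eq_smul, smul_eq_mul, map_add, map_mul]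
      ring
  commutes' r := by
    ext
    · exact f.commutes r
    · change y * f 0 = 0
      simp

lemma dualMap_fst (f : A →ₐ[k] A') (y : A') (a) : (dualMap f y a).fst = f a.fst := rfl
lemma dualMap_snd (f : A →ₐ[k] A') (y : A') (a) : (dualMap f y a).snd = y * f a.snd := rfl

/-- constants. -/
def dualInl (k A : Type) [Field k] [CommRing A] [Algebra k A] : A →ₐ[k] TrivSqZeroExt A A :=
  TrivSqZeroExt.inlAlgHom k A A

lemma dualInl_fst (a : A) : (dualInl k A a).fst = a := rfl
lemma dualInl_snd (a : A) : (dualInl k A a).snd = 0 := rfl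

/-- first projection. -/
def dualFst (k A : Type) [Field k] [CommRing A] [Algebra k A] : TrivSqZeroExt A A →ₐ[k] A :=
  TrivSqZeroExt.fstHom k A A

lemma dualFst_apply (a : TrivSqZeroExt A A) : dualFst k A a = a.fst := rfl

lemma dualFst_surj : Function.Surjective (dualFst k A) := fun a => ⟨dualInl k A a, rfl⟩

lemma ker_dualFst : RingHom.ker (dualFst k A) ≤ Ideal.jacobson ⊥ := by
  intro x hx
  apply Ideal.radical_le_jacobson
  refine ⟨2, ?_⟩
  have hx' : x.fst = 0 := hx
  rw [Ideal.mem_bot, pow_two]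
  ext
  · change x.fst * x.fst = 0
    simp [hx']
  · change x.fst • x.snd + MulOpposite.op x.fst • x.snd = 0
    simp [hx']

end dual

namespace IdChart
variable {Γ : GroupScheme k} (c : IdChart Γ)
variable {A : Type} [CommRing A] [Algebra k A] {A' : Type} [CommRing A'] [Algebra k A']

lemma N_mul (n n' : c.N) : n * n' = algebraMap k c.N (c.eN n) * n' +
    algebraMap k c.N (c.eN n') * n - algebraMap k c.N (c.eN n * c.eN n') := by
  have h1 : n - algebraMap k c.N (c.eN n) ∈ RingHom.ker c.eN := by
    rw [RingHom.mem_ker]; simp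
  have h2 : n' - algebraMap k c.N (c.eN n') ∈ RingHom.ker c.eN := by
    rw [RingHom.mem_ker]; simp
  have h3 := Ideal.mul_mem_mul h1 h2
  rw [← pow_two, c.ker_eN, Ideal.mem_bot] at h3
  rw [map_mul]
  linear_combination h3

/-- tangent vectors. -/
def theta (w : c.N →ₗ[k] A) (hw : w 1 = 0) : c.N →ₐ[k] TrivSqZeroExt A A where
  toFun n := (algebraMap k A (c.eN n), w n)
  map_one' := by
    ext
    · change algebraMap k A (c.eN 1) = 1
      simp
    · exact hw
  map_zero' := by
    ext
    · change algebraMap k A (c.eN 0) = 0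
      simp
    · exact map_zero w
  map_add' a b := by
    ext
    · change algebraMap k A (c.eN (a + b)) = algebraMap k A (c.eN a) + algebraMap k A (c.eN b)
      simp
    · exact map_add w _ _
  map_mul' a b := by
    ext
    · change algebraMap k A (c.eN (a * b)) = algebraMap k A (c.eN a) * algebraMap k A (c.eN b)
      simp
    · change w (a * b) = algebraMap k A (c.eN a) • w b +
        MulOpposite.op (algebraMap k A (c.eN b)) • w a
      rw [c.N_mul a b, op_smul_eq_smul, map_sub, map_add, ← Algebra.smul_def, ← Algebra.smul_def,
        Algebra.algebraMap_eq_smul_one (c.eN a * c.eN b), map_smul, map_smul, map_smul, hw]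
      simp [Algebra.smul_def]
  commutes' r := by
    ext
    · change algebraMap k A (c.eN (algebraMap k _ r)) = algebraMap k A r
      simp
    · change w (algebraMap k _ r) = 0
      rw [Algebra.algebraMap_eq_smul_one, map_smul, hw, smul_zero]

lemma theta_fst (w : c.N →ₗ[k] A) (hw : w 1 = 0) (n : c.N) :
    (c.theta w hw n).fst = algebraMap k A (c.eN n) := rfl
lemma theta_snd (w : c.N →ₗ[k] A) (hw : w 1 = 0) (n : c.N) :
    (c.theta w hw n).snd = w n := rfl

/-- `w` is the logarithmic derivative of `g`. -/
def IsLogDer (D : Derivation k A A) (g : SpO k A ⟶ Γ.G) (w : c.N →ₗ[k] A) : Prop :=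
  ∃ hw : w 1 = 0, SpO.map (dualHom D) ≫ g =
    (SpO.map (dualInl k A) ≫ g) * c.pt ((c.theta w hw).comp c.mkN)

lemma exists_logDer (D : Derivation k A A) (g : SpO k A ⟶ Γ.G) : ∃ w, c.IsLogDer D g w := by
  let t := (SpO.map (dualInl k A) ≫ g)⁻¹ * (SpO.map (dualHom D) ≫ g)
  have ht : SpO.map (dualFst k A) ≫ t = SpO.map ((Algebra.ofId k A).comp c.e) ≫ c.j := by
    change _ = c.pt _
    rw [pt_e, Γ.comp_mul, Γ.comp_inv, ← Category.assoc, ← Category.assoc, ← SpO.map_comp,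
      ← SpO.map_comp]
    have h1 : (dualFst k A).comp (dualInl k A) = AlgHom.id k A := by ext; rfl
    have h2 : (dualFst k A).comp (dualHom D) = AlgHom.id k A := by ext; rfl
    rw [h1, h2, inv_mul_cancel]
  obtain ⟨φ, hφ, hφe⟩ := chart_factor_of_jacobson c.j t (dualFst k A) dualFst_surj ker_dualFst _ ht
  have hφe' : ∀ b, (φ b).fst = algebraMap k A (c.e b) := fun b => congr($hφe b)
  have hker : ∀ b ∈ c.m ^ 2, φ b = 0 := by
    have hm : ∀ b ∈ c.m, φ b ∈ RingHom.ker (dualFst k A) := by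
      intro b hb
      rw [RingHom.mem_ker, dualFst_apply, hφe', (hb : c.e b = 0), map_zero]
    have h2 : c.m ^ 2 ≤ RingHom.ker φ := by
      rw [pow_two, Ideal.mul_le]
      intro r hr s hs
      rw [RingHom.mem_ker, map_mul]
      have h1 : (φ r).fst = 0 := hm r hr
      have h2 : (φ s).fst = 0 := hm s hs
      ext
      · change (φ r).fst * (φ s).fst = 0
        simp [h1]
      · change (φ r).fst • (φ s).snd + MulOpposite.op (φ s).fst • (φ r).snd = 0
        simp [h1, h2]
    intro b hb
    exact h2 hb
  let φN : c.N →ₐ[k] TrivSqZeroExt A A := Ideal.Quotient.liftₐ _ φ hker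
  let w : c.N →ₗ[k] A :=
    { toFun := fun n => (φN n).snd
      map_add' := fun a b => by rw [map_add]; rfl
      map_smul' := fun a b => by rw [map_smul]; rfl }
  have hw : w 1 = 0 := by
    change (φN 1).snd = 0
    rw [map_one]; rfl
  refine ⟨w, hw, ?_⟩
  have : (c.theta w hw).comp c.mkN = φ := by
    ext b
    · change algebraMap k A (c.e b) = _
      rw [hφe']
    · rfl
  rw [this, pt, ← hφ, mul_inv_cancel_left]

lemma isLogDer_pt (D : Derivation k A A) (Y : c.B →ₐ[k] A) (w : c.N →ₗ[k] A) (hw : w 1 = 0) :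
    c.IsLogDer D (c.pt Y) w ↔ ∀ b, D (Y b) = c.act Y w b := by
  have key : ∀ b, Algebra.TensorProduct.productMap ((dualInl k A).comp Y) (c.theta w hw) (c.rho b)
      = (Y b, c.act Y w b) := by
    intro b
    obtain ⟨ι, s, x, y, h⟩ := c.exists_rho_sum b
    have h0 := congr($(c.right_counit) b)
    rw [AlgHom.comp_apply, h] at h0
    simp only [prB, map_sum, Algebra.TensorProduct.productMap_apply_tmul, AlgHom.id_apply,
      AlgHom.comp_apply] at h0
    rw [h, c.act_sum h, map_sum]
    have hfst : ∀ (f : ι → TrivSqZeroExt A A), (∑ i ∈ s, f i).fst = ∑ i ∈ s, (f i).fst :=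
      fun f => map_sum (dualFst k A) f s
    have hsnd : ∀ (f : ι → TrivSqZeroExt A A), (∑ i ∈ s, f i).snd = ∑ i ∈ s, (f i).snd :=
      fun f => map_sum (TrivSqZeroExt.sndHom A A) f s
    ext
    · rw [hfst]
      change _ = Y b
      rw [← h0, map_sum]
      refine Finset.sum_congr rfl fun i _ => ?_
      rw [Algebra.TensorProduct.productMap_apply_tmul]
      change Y (x i) * algebraMap k A (c.eN (y i)) = _
      rw [map_mul]
      congr 1
      exact (Y.commutes _).symm
    · rw [hsnd]
      change _ = ∑ i ∈ s, Y (x i) * w (y i)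
      refine Finset.sum_congr rfl fun i _ => ?_
      rw [Algebra.TensorProduct.productMap_apply_tmul]
      change Y (x i) • w (y i) + MulOpposite.op _ • (0 : A) = _
      simp
  constructor
  · rintro ⟨_, h⟩ b
    rw [map_pt, map_pt, pt_mul] at h
    have h := c.pt_inj h
    have := congr(($h b).snd)
    rw [AlgHom.comp_apply, AlgHom.comp_apply, key] at this
    exact this
  · intro h
    refine ⟨hw, ?_⟩
    rw [map_pt, map_pt, pt_mul]
    congr 1
    ext b
    · rw [AlgHom.comp_apply, AlgHom.comp_apply, key]; rfl
    · rw [AlgHom.comp_apply, AlgHom.comp_apply, key]; exact h b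

lemma IsLogDer.transport {D : Derivation k A A} {g : SpO k A ⟶ Γ.G} {w : c.N →ₗ[k] A}
    (h : c.IsLogDer D g w) (D' : Derivation k A' A') (f : A →ₐ[k] A') (y : A')
    (hf : ∀ a, D' (f a) = y * f (D a)) :
    c.IsLogDer D' (SpO.map f ≫ g) ((LinearMap.mulLeft k y).comp (f.toLinearMap.comp w)) := by
  obtain ⟨hw, h⟩ := h
  refine ⟨by simp [hw], ?_⟩
  have h2 := congr(SpO.map (dualMap f y) ≫ $h)
  rw [Γ.comp_mul, map_pt, ← Category.assoc, ← Category.assoc, ← SpO.map_comp, ← SpO.map_comp] at h2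
  have e1 : (dualMap f y).comp (dualHom D) = (dualHom D').comp f := by
    ext a
    · rfl
    · exact (hf a).symm
  have e2 : (dualMap f y).comp (dualInl k A) = (dualInl k A').comp f := by
    ext a
    · rfl
    · change y * f 0 = 0
      simp
  rw [e1, e2, SpO.map_comp, SpO.map_comp, Category.assoc, Category.assoc] at h2
  rw [h2]
  congr 2
  ext b
  · exact f.commutes _
  · rfl

lemma IsLogDer.mul_left {D : Derivation k A A} {g : SpO k A ⟶ Γ.G} {w : c.N →ₗ[k] A}
    (h : c.IsLogDer D g w) {d : SpO k A ⟶ Γ.G}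
    (hd : SpO.map (dualHom D) ≫ d = SpO.map (dualInl k A) ≫ d) :
    c.IsLogDer D (d * g) w := by
  obtain ⟨hw, h⟩ := h
  refine ⟨hw, ?_⟩
  rw [Γ.comp_mul, Γ.comp_mul, hd, h, mul_assoc]

lemma IsLogDer.mul_inv {D : Derivation k A A} {g g' : SpO k A ⟶ Γ.G} {w : c.N →ₗ[k] A}
    (h : c.IsLogDer D g w) (h' : c.IsLogDer D g' w) :
    SpO.map (dualHom D) ≫ (g * g'⁻¹) = SpO.map (dualInl k A) ≫ (g * g'⁻¹) := by
  obtain ⟨hw, h⟩ := h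
  obtain ⟨hw', h'⟩ := h'
  rw [Γ.comp_mul, Γ.comp_mul, Γ.comp_inv, Γ.comp_inv, h, h']
  group

end IdChart

/-- A horizontal point over a field is constant. -/
lemma horizontal_const {X : OverR k} {K : Type} [Field K] [Algebra k K] (D : Derivation k K K)
    (hD : ∀ a, D a = 0 → ∃ r : k, a = algebraMap k K r) (d : SpO k K ⟶ X)
    (hd : SpO.map (dualHom D) ≫ d = SpO.map (dualInl k K) ≫ d) :
    ∃ d0 : SpO k k ⟶ X, d = SpO.map (Algebra.ofId k K) ≫ d0 := by
  obtain ⟨B, _, _, j, hj, hx, -⟩ := exists_chart X (d.left (⊥ : PrimeSpectrum K))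
  have hr : Set.range d.left ⊆ Set.range j.left := by
    rintro _ ⟨x, rfl⟩
    have : x = (⊥ : PrimeSpectrum K) := Subsingleton.elim (α := PrimeSpectrum K) _ _
    rw [this]; exact hx
  obtain ⟨φ, rfl⟩ := chart_factor j d hr
  rw [← Category.assoc, ← Category.assoc, ← SpO.map_comp, ← SpO.map_comp] at hd
  have h1 := chart_cancel j hd
  have h2 : ∀ b, D (φ b) = 0 := fun b => congr(($h1 b).snd)
  have h3 : φ.range ≤ (Algebra.ofId k K).range := by
    rintro _ ⟨b, rfl⟩
    obtain ⟨r, hr⟩ := hD _ (h2 b)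
    exact ⟨r, hr.symm⟩
  let eq := AlgEquiv.ofInjective (Algebra.ofId k K) (algebraMap k K).injective
  let ψ : B →ₐ[k] k := eq.symm.toAlgHom.comp
    (φ.codRestrict (Algebra.ofId k K).range (fun b => h3 ⟨b, rfl⟩))
  refine ⟨SpO.map ψ ≫ j, ?_⟩
  rw [← Category.assoc, ← SpO.map_comp]
  congr 2
  ext b
  have : eq (ψ b) = _ := eq.apply_symm_apply _
  exact congr(($this).1).symm

end LogDer
end
end

section
open CategoryTheory AlgebraicGeometry Limits
open scoped TensorProduct
noncomputable section

set_option linter.unusedSectionVars false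
section Taylor
open PowerSeries

variable {k : Type} [Field k] [CharZero k]
variable {A : Type} [CommRing A] [Algebra k A]

/-- Divide by a natural number. -/
lemma nat_cancel (n : ℕ) {a b : A} (h : a * ((n : A) + 1) = b * ((n : A) + 1))
    (k : Type) [Field k] [CharZero k] [Algebra k A] : a = b := by
  have hu : IsUnit ((n : A) + 1) := by
    have h0 : ((n : k) + 1) ≠ 0 := Nat.cast_add_one_ne_zero n
    have := (IsUnit.mk0 _ h0).map (algebraMap k A)
    simpa using this
  exact hu.mul_right_cancel h

/-- Derivation on power series as a `k`-derivation. -/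
def dk (k A : Type) [Field k] [CommRing A] [Algebra k A] : Derivation k A⟦X⟧ A⟦X⟧ :=
  (PowerSeries.derivative A).restrictScalars k

lemma dk_coeff (F : A⟦X⟧) (n : ℕ) :
    coeff n (dk k A F) = coeff (n + 1) F * ((n : A) + 1) := by
  exact PowerSeries.coeff_derivative F n

/-- two power series with the same derivative and constant coefficients. -/
lemma dk_ext {F G : A⟦X⟧} (h0 : constantCoeff F = constantCoeff G) (h : dk k A F = dk k A G) :
    F = G := by
  ext n
  cases n with
  | zero => simpa using h0
  | succ n =>
    apply nat_cancel n _ k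
    rw [← dk_coeff (k := k), h, dk_coeff]

/-- Taylor expansion function. -/
def tayFun (D : Derivation k A A) (y : A) (a : A) : A⟦X⟧ :=
  PowerSeries.mk fun n => algebraMap k A ((n.factorial : k)⁻¹) * (D^[n] a) * y ^ n

lemma tayFun_coeff (D : Derivation k A A) (y : A) (a : A) (n : ℕ) :
    coeff n (tayFun D y a) = algebraMap k A ((n.factorial : k)⁻¹) * (D^[n] a) * y ^ n := by
  simp [tayFun]

lemma tayFun_zero (D : Derivation k A A) (y : A) (a : A) :
    constantCoeff (tayFun D y a) = a := by
  rw [← coeff_zero_eq_constantCoeff_apply, tayFun_coeff]; simp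

lemma tayFun_d (D : Derivation k A A) (y : A) (a : A) :
    dk k A (tayFun D y a) = C y * tayFun D y (D a) := by
  ext n
  rw [dk_coeff, coeff_C_mul, tayFun_coeff, tayFun_coeff, Function.iterate_succ_apply]
  have : algebraMap k A (((n+1).factorial : k)⁻¹) * ((n : A) + 1)
      = algebraMap k A ((n.factorial : k)⁻¹) := by
    have h0 : ((n : k) + 1) ≠ 0 := Nat.cast_add_one_ne_zero n
    have : ((n : A) + 1) = algebraMap k A ((n : k) + 1) := by simp
    rw [this, ← map_mul]
    congr 1
    rw [Nat.factorial_succ]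
    push_cast
    have := Nat.factorial_ne_zero n
    field_simp
  rw [← this]; ring

lemma iter_add (D : Derivation k A A) (n : ℕ) (a b : A) : D^[n] (a + b) = D^[n] a + D^[n] b := by
  induction n generalizing a b with
  | zero => rfl
  | succ n ih => simp [Function.iterate_succ_apply, ih]

lemma tayFun_add (D : Derivation k A A) (y : A) (a b : A) :
    tayFun D y (a + b) = tayFun D y a + tayFun D y b := by
  ext n
  rw [map_add, tayFun_coeff, tayFun_coeff, tayFun_coeff, iter_add]; ring

lemma tayFun_mul_coeff (D : Derivation k A A) (y : A) (n : ℕ) : ∀ a b : A,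
    coeff n (tayFun D y (a * b)) = coeff n (tayFun D y a * tayFun D y b) := by
  induction n with
  | zero =>
    intro a b
    simp only [coeff_zero_eq_constantCoeff_apply, map_mul, tayFun_zero]
  | succ n ih =>
    intro a b
    apply nat_cancel n _ k
    rw [← dk_coeff (k := k), ← dk_coeff (k := k), tayFun_d, Derivation.leibniz, tayFun_add,
      Derivation.leibniz, tayFun_d, tayFun_d, coeff_C_mul, map_add, smul_eq_mul, smul_eq_mul,
      smul_eq_mul, smul_eq_mul, map_add, mul_left_comm _ (C y), mul_left_comm _ (C y),
      coeff_C_mul, coeff_C_mul, ih, ih]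
    ring

/-- Taylor expansion `a ↦ a(x + y s)`. -/
def tay (D : Derivation k A A) (y : A) : A →ₐ[k] A⟦X⟧ where
  toFun := tayFun D y
  map_one' := by
    apply dk_ext (k := k)
    · simp [tayFun_zero]
    · rw [tayFun_d]
      ext n
      simp [tayFun_coeff, iterate_map_zero]
  map_zero' := by
    ext n; simp [tayFun_coeff, iterate_map_zero]
  map_add' := tayFun_add D y
  map_mul' a b := by ext n; exact tayFun_mul_coeff D y n a b
  commutes' r := by
    apply dk_ext (k := k)
    · rw [tayFun_zero]
      simp [PowerSeries.algebraMap_apply]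
    · rw [tayFun_d]
      ext n
      simp [tayFun_coeff, iterate_map_zero]

lemma tay_d (D : Derivation k A A) (y : A) (a : A) :
    dk k A (tay D y a) = C y * tay D y (D a) := tayFun_d D y a

lemma tay_zero (D : Derivation k A A) (y : A) (a : A) :
    constantCoeff (tay D y a) = a := tayFun_zero D y a

lemma tay_coeff (D : Derivation k A A) (y : A) (a : A) (n : ℕ) :
    coeff n (tay D y a) = algebraMap k A ((n.factorial : k)⁻¹) * (D^[n] a) * y ^ n :=
  tayFun_coeff D y a n

/-- constant coefficient as an algebra map. -/
def ccA (k A : Type) [Field k] [CommRing A] [Algebra k A] : A⟦X⟧ →ₐ[k] A :=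
  { (constantCoeff : A⟦X⟧ →+* A) with
    commutes' := fun r => by simp [PowerSeries.algebraMap_apply] }

lemma ccA_apply (F : A⟦X⟧) : ccA k A F = constantCoeff F := rfl

/-- constants as an algebra map. -/
def CA (k A : Type) [Field k] [CommRing A] [Algebra k A] : A →ₐ[k] A⟦X⟧ :=
  { (C : A →+* A⟦X⟧) with
    commutes' := fun r => by simp [PowerSeries.algebraMap_apply] }

lemma CA_apply (a : A) : CA k A a = C a := rfl

lemma ccA_surj : Function.Surjective (ccA k A) := fun a => ⟨C a, by simp [ccA_apply]⟩

lemma ker_ccA : RingHom.ker (ccA k A) ≤ Ideal.jacobson ⊥ := by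
  intro F hF
  have hF' : constantCoeff F = 0 := hF
  rw [Ideal.mem_jacobson_bot]
  intro G
  rw [PowerSeries.isUnit_iff_constantCoeff]
  simp [hF']

end Taylor

section Flow
open PowerSeries
variable {k : Type} [Field k] [CharZero k] {Γ : GroupScheme k} (c : IdChart Γ)
variable {A : Type} [CommRing A] [Algebra k A]

lemma ccA_CA : (ccA k A).comp (CA k A) = AlgHom.id k A := by ext; simp [ccA_apply, CA_apply]

lemma ccA_tay (D : Derivation k A A) (y : A) : (ccA k A).comp (tay D y) = AlgHom.id k A := by
  ext; simp [ccA_apply, tay_zero]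

lemma CA_horizontal : (dualHom (dk k A)).comp (CA k A) = (dualInl k A⟦X⟧).comp (CA k A) := by
  ext a n
  · rfl
  · change coeff n (dk k A (C a)) = coeff n 0
    simp [dk_coeff, coeff_C]

/-- The flow of a point along a derivation. -/
lemma IdChart.flow {D : Derivation k A A} {g : SpO k A ⟶ Γ.G} {w : c.N →ₗ[k] A}
    (h : c.IsLogDer D g w) (y : A) :
    ∃ H : c.B →ₐ[k] A⟦X⟧, (SpO.map (tay D y) ≫ g) = (SpO.map (CA k A) ≫ g) * c.pt H ∧
      (∀ b, constantCoeff (H b) = algebraMap k A (c.e b)) ∧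
      ∀ b, dk k A (H b) = c.act H ((LinearMap.mulLeft k (C y)).comp
        ((tay D y).toLinearMap.comp w)) b := by
  let t := (SpO.map (CA k A) ≫ g)⁻¹ * (SpO.map (tay D y) ≫ g)
  have ht : SpO.map (ccA k A) ≫ t = SpO.map ((Algebra.ofId k A).comp c.e) ≫ c.j := by
    change _ = c.pt _
    rw [c.pt_e, Γ.comp_mul, Γ.comp_inv, ← Category.assoc, ← Category.assoc, ← SpO.map_comp,
      ← SpO.map_comp, ccA_CA, ccA_tay, inv_mul_cancel]
  have := c.oi
  obtain ⟨H, hH, hH0⟩ := chart_factor_of_jacobson c.j t (ccA k A) ccA_surj ker_ccA _ ht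
  refine ⟨H, ?_, ?_, ?_⟩
  · have : t = c.pt H := hH
    rw [← this]
    simp [t]
  · intro b; exact congr($hH0 b)
  · have h1 := h.transport c (dk k A) (tay D y) (C y) (tay_d D y)
    have h2 : c.IsLogDer (dk k A) t ((LinearMap.mulLeft k (C y)).comp
        ((tay D y).toLinearMap.comp w)) := by
      apply h1.mul_left
      rw [Γ.comp_inv, Γ.comp_inv, ← Category.assoc, ← Category.assoc, ← SpO.map_comp,
        ← SpO.map_comp, CA_horizontal]
    obtain ⟨hw, -⟩ := id h2
    have hH' : t = c.pt H := hH
    rw [hH'] at h2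
    exact (c.isLogDer_pt _ H _ hw).1 h2

/-- integrality of solutions. -/
lemma IdChart.integral (H : c.B →ₐ[k] A⟦X⟧) (w : c.N →ₗ[k] A⟦X⟧) (O : Subalgebra k A)
    (h0 : ∀ b, constantCoeff (H b) ∈ O) (hw : ∀ n i, coeff i (w n) ∈ O)
    (h : ∀ b, dk k A (H b) = c.act H w b) (i : ℕ) : ∀ b, coeff i (H b) ∈ O := by
  induction i using Nat.strong_induction_on with
  | _ i ih =>
    intro b
    cases i with
    | zero => simpa using h0 b
    | succ i =>
      have h1 := dk_coeff (k := k) (H b) i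
      have h2 : coeff i (c.act H w b) ∈ O := by
        obtain ⟨ι, s, x, y, hs⟩ := c.exists_rho_sum b
        rw [c.act_sum hs, map_sum]
        refine Subalgebra.sum_mem _ fun l _ => ?_
        rw [coeff_mul]
        refine Subalgebra.sum_mem _ fun p hp => Subalgebra.mul_mem _ (ih _ ?_ _) (hw _ _)
        have := Finset.HasAntidiagonal.mem_antidiagonal.1 hp
        omega
      rw [← h, h1] at h2
      have h3 : coeff (i+1) (H b) = ((i : k) + 1)⁻¹ • (coeff (i+1) (H b) * ((i : A) + 1)) := by
        have h0 : ((i : k) + 1) ≠ 0 := Nat.cast_add_one_ne_zero i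
        have : ((i : A) + 1) = algebraMap k A ((i : k) + 1) := by simp
        rw [this, Algebra.smul_def, mul_left_comm, ← map_mul, inv_mul_cancel₀ h0]; simp
      rw [h3]
      exact O.smul_mem h2 _

end Flow

/-- factoring an algebra map through an injective one. -/
lemma algHom_factor {k A B C : Type} [Field k] [CommRing A] [CommRing B] [CommRing C] [Algebra k A]
    [Algebra k B] [Algebra k C] (ι : A →ₐ[k] B) (hι : Function.Injective ι) (φ : C →ₐ[k] B)
    (h : ∀ c, ∃ a, ι a = φ c) : ∃ φ' : C →ₐ[k] A, ι.comp φ' = φ := by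
  let e := AlgEquiv.ofInjective ι hι
  let φ1 : C →ₐ[k] ι.range := φ.codRestrict ι.range (fun x => by
    obtain ⟨a, ha⟩ := h x; exact ⟨a, ha⟩)
  refine ⟨e.symm.toAlgHom.comp φ1, ?_⟩
  ext x
  have : (e (e.symm (φ1 x))) = φ1 x := e.apply_symm_apply _
  exact congr(($this : B))

lemma linMap_factor {k A B C : Type} [Field k] [CommRing A] [CommRing B] [AddCommGroup C]
    [Algebra k A]
    [Algebra k B] [Module k C] (ι : A →ₐ[k] B) (hι : Function.Injective ι) (φ : C →ₗ[k] B)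
    (h : ∀ c, ∃ a, ι a = φ c) : ∃ φ' : C →ₗ[k] A, ι.toLinearMap.comp φ' = φ := by
  choose f hf using h
  refine ⟨⟨⟨f, fun x y => hι ?_⟩, fun r x => hι ?_⟩, ?_⟩
  · simp [hf]
  · simp [hf]
  · ext x; exact hf x
end
end

section
open CategoryTheory AlgebraicGeometry Limits
open scoped TensorProduct
noncomputable section
set_option linter.unusedSectionVars false

section DerExt
variable {k R F : Type} [Field k] [CommRing R] [IsDomain R] [Algebra k R] [Field F] [Algebra k F]
  [Algebra R F] [IsScalarTower k R F] [IsFractionRing R F]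

/-- Extension of derivations to the fraction field. -/
lemma exists_derExt (D : Derivation k R R) :
    ∃ D' : Derivation k F F, ∀ r, D' (algebraMap R F r) = algebraMap R F (D r) := by
  let φ : R →+* TrivSqZeroExt F F :=
    ((dualMap (IsScalarTower.toAlgHom k R F) 1).comp (dualHom D)).toRingHom
  have hφ1 (r : R) : (φ r).fst = algebraMap R F r := rfl
  have hφ2 (r : R) : (φ r).snd = algebraMap R F (D r) := one_mul _
  have hφ : ∀ y : nonZeroDivisors R, IsUnit (φ y) := by
    intro y
    rw [TrivSqZeroExt.isUnit_iff_isUnit_fst, hφ1]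
    exact IsLocalization.map_units F y
  let L : F →+* TrivSqZeroExt F F := IsLocalization.lift hφ
  have hL (r : R) : L (algebraMap R F r) = φ r := IsLocalization.lift_eq hφ r
  have hfst : ∀ f, (L f).fst = f := by
    have : ((TrivSqZeroExt.fstHom F F F).toRingHom.comp L) = RingHom.id F := by
      apply IsLocalization.ringHom_ext (nonZeroDivisors R)
      ext r
      change (L (algebraMap R F r)).fst = _
      rw [hL, hφ1]; rfl
    intro f
    exact congr($this f)
  have hsm : ∀ (r : k), (L (algebraMap k F r)) = TrivSqZeroExt.inl (algebraMap k F r) := by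
    intro r
    rw [IsScalarTower.algebraMap_apply k R F, hL]
    ext
    · rw [hφ1]; rfl
    · rw [hφ2]; simp
  let l : F →ₗ[k] F :=
    { toFun := fun f => (L f).snd
      map_add' := fun a b => by simp
      map_smul' := fun r a => by
        rw [Algebra.smul_def, map_mul, hsm]
        simp [Algebra.smul_def] }
  refine ⟨Derivation.mk' l ?_, ?_⟩
  · intro a b
    change (L (a * b)).snd = a • (L b).snd + b • (L a).snd
    rw [map_mul, TrivSqZeroExt.snd_mul, hfst, hfst]
    simp [mul_comm b]
  · intro r
    change (L _).snd = _
    rw [hL, hφ2]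

/-- The extended derivation. -/
def derExt (F : Type) [Field F] [Algebra k F]
  [Algebra R F] [IsScalarTower k R F] [IsFractionRing R F] (D : Derivation k R R) :
  Derivation k F F := (exists_derExt (F := F) D).choose

lemma derExt_apply (D : Derivation k R R) (r : R) :
    derExt F D (algebraMap R F r) = algebraMap R F (D r) := (exists_derExt (F := F) D).choose_spec r

end DerExt

section Laurent
open PowerSeries
variable (k : Type) [Field k] [CharZero k]

variable (K : Type) [Field K] [Algebra k K]
  [Algebra k⟦X⟧ K] [IsScalarTower k k⟦X⟧ K] [IsFractionRing k⟦X⟧ K]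

/-- inclusion of power series in Laurent series. -/
abbrev iK : k⟦X⟧ →ₐ[k] K := IsScalarTower.toAlgHom k k⟦X⟧ K

lemma iK_inj : Function.Injective (iK k K) := IsFractionRing.injective k⟦X⟧ K

/-- The derivation on Laurent series. -/
abbrev dLK : Derivation k K K := derExt K (dk k k)

variable {k K}

lemma dLK_iK (f : k⟦X⟧) : dLK k K (iK k K f) = iK k K (dk k k f) := derExt_apply _ _

lemma iK_X_ne : iK k K X ≠ 0 := by
  intro h
  have : iK k K X = iK k K 0 := by simpa using h
  exact PowerSeries.X_ne_zero (iK_inj k K this)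

lemma LK_form (f : K) : ∃ (n : ℕ) (u : k⟦X⟧), (iK k K X) ^ n * f = iK k K u := by
  obtain ⟨a, b, hb, rfl⟩ := IsFractionRing.div_surjective (A := k⟦X⟧) f
  have hb0 : b ≠ 0 := nonZeroDivisors.ne_zero hb
  have h1 := PowerSeries.X_pow_order_mul_divXPowOrder (f := b)
  obtain ⟨v, hv⟩ : IsUnit (divXPowOrder b) :=
    ⟨_, Unit_of_divided_by_X_pow_order_nonzero hb0⟩
  rw [← hv] at h1
  refine ⟨b.order.toNat, a * v.inv, ?_⟩
  change (algebraMap _ K X) ^ _ * (_ / _) = algebraMap _ _ _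
  have hbK : algebraMap k⟦X⟧ K b ≠ 0 := by
    rw [ne_eq, FaithfulSMul.algebraMap_eq_zero_iff]; exact hb0
  field_simp
  rw [← map_pow, ← map_mul, ← map_mul]
  congr 1
  have : b * v.inv = X ^ b.order.toNat := by
    conv_lhs => rw [← h1]
    rw [mul_assoc, v.val_inv, mul_one]
  rw [← this]; ring

lemma dLK_ker (f : K) (h : dLK k K f = 0) : ∃ r : k, f = algebraMap k K r := by
  obtain ⟨n, u, hu⟩ := LK_form (k := k) f
  have h1 : dLK k K ((iK k K X) ^ n * f) = (n : K) * (iK k K X) ^ (n - 1) * f := by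
    rw [Derivation.leibniz, h, Derivation.leibniz_pow, dLK_iK]
    have : dk k k X = 1 := by
      ext i; rw [dk_coeff, coeff_X, coeff_one]
      by_cases hi : i = 0 <;> simp [hi]
    rw [this]
    simp only [map_one, smul_eq_mul, mul_one, nsmul_eq_mul, mul_zero, zero_add]
    ring
  have h2 : iK k K (X * dk k k u) = iK k K (n * u) := by
    rw [map_mul, ← dLK_iK, ← hu, h1, map_mul, ← hu, map_natCast]
    cases n with
    | zero => simp
    | succ n => simp only [Nat.add_sub_cancel]; ring
  have h3 := iK_inj k K h2
  have h4 : ∀ i, i ≠ n → coeff i u = 0 := by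
    intro i hi
    have h5 := congr(coeff i $h3)
    have h6 : coeff i (X * dk k k u) = coeff i u * i := by
      cases i with
      | zero => simp
      | succ i => rw [coeff_succ_X_mul, dk_coeff]; simp
    rw [h6] at h5
    have h7 : coeff i ((n : k⟦X⟧) * u) = n * coeff i u := by
      rw [← nsmul_eq_mul, map_nsmul, nsmul_eq_mul]
    rw [h7, mul_comm, ← sub_eq_zero, ← sub_mul] at h5
    rcases mul_eq_zero.1 h5 with h8 | h8
    · rw [sub_eq_zero] at h8
      exact absurd (by exact_mod_cast h8) hi
    · exact h8
  have h5 : u = X ^ n * C (coeff n u) := by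
    ext i
    rw [coeff_mul_C, coeff_X_pow]
    by_cases hi : i = n
    · simp [hi]
    · simp [hi, h4 i hi]
  refine ⟨coeff n u, ?_⟩
  have h6 : (iK k K X) ^ n ≠ 0 := pow_ne_zero _ iK_X_ne
  apply mul_left_cancel₀ h6
  rw [hu, h5, map_mul, map_pow]
  congr 1
  have : C (coeff n u) = algebraMap k k⟦X⟧ (coeff n u) := by simp [PowerSeries.algebraMap_apply]
  rw [← h5, this, AlgHom.commutes]

end Laurent

section LemmaA
open PowerSeries
variable {k : Type} [Field k] [CharZero k]
variable {K : Type} [Field K] [Algebra k K]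
  [Algebra k⟦X⟧ K] [IsScalarTower k k⟦X⟧ K] [IsFractionRing k⟦X⟧ K]
variable {A A' : Type} [CommRing A] [Algebra k A] [CommRing A'] [Algebra k A']

abbrev mapP (f : A →ₐ[k] A') : A⟦X⟧ →ₐ[k] A'⟦X⟧ := PowerSeries.mapAlgHom f

lemma mapP_coeff (f : A →ₐ[k] A') (F : A⟦X⟧) (n : ℕ) : coeff n (mapP f F) = f (coeff n F) := by
  rfl

lemma mapP_inj (f : A →ₐ[k] A') (hf : Function.Injective f) : Function.Injective (mapP f) := by
  intro F G h
  ext n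
  apply hf
  rw [← mapP_coeff, h, mapP_coeff]

lemma mapP_range (f : A →ₐ[k] A') (F : A'⟦X⟧) (h : ∀ n, ∃ a, f a = coeff n F) :
    ∃ G, mapP f G = F := by
  choose g hg using h
  refine ⟨PowerSeries.mk g, ?_⟩
  ext n
  rw [mapP_coeff, coeff_mk, hg]

lemma mapP_dk (f : A →ₐ[k] A') (F : A⟦X⟧) : dk k A' (mapP f F) = mapP f (dk k A F) := by
  ext n
  rw [dk_coeff, mapP_coeff, mapP_coeff, dk_coeff]; simp

lemma tay_map (D : Derivation k A A) (D' : Derivation k A' A') (f : A →ₐ[k] A')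
    (h : ∀ a, D' (f a) = f (D a)) (y : A) (a : A) :
    tay D' (f y) (f a) = mapP f (tay D y a) := by
  have h2 : ∀ n, D'^[n] (f a) = f (D^[n] a) := by
    intro n
    induction n with
    | zero => rfl
    | succ n ih => rw [Function.iterate_succ_apply', ih, h, Function.iterate_succ_apply']
  ext n
  rw [mapP_coeff, tay_coeff, tay_coeff, h2]; simp

lemma mapP_cc_tay (f : k⟦X⟧) : mapP (ccA k k) (tay (dk k k) 1 f) = f := by
  have : ∀ n, ∀ f : k⟦X⟧, coeff n (mapP (ccA k k) (tay (dk k k) 1 f)) = coeff n f := by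
    intro n
    induction n with
    | zero =>
      intro f
      rw [mapP_coeff, coeff_zero_eq_constantCoeff_apply, tay_zero]
      simp [ccA_apply]
    | succ n ih =>
      intro f
      apply nat_cancel n _ k
      rw [← dk_coeff (k := k), ← dk_coeff (k := k), mapP_dk, tay_d, map_one, one_mul, ih]
  ext n
  exact this n f

variable {Γ : GroupScheme k} (c : IdChart Γ)

lemma IdChart.lemmaA {g : SpO k K ⟶ Γ.G} {w : c.N →ₗ[k] K}
    (h : c.IsLogDer (dLK k K) g w) (hw : ∀ n, ∃ u, iK k K u = w n) :
    ∃ g0 : SpO k k⟦X⟧ ⟶ Γ.G, g = SpO.map (iK k K) ≫ g0 := by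
  obtain ⟨w0, hw0⟩ := linMap_factor (iK k K) (iK_inj k K) w hw
  obtain ⟨H, -, hH0, hH⟩ := c.flow h 1
  have htay (u : k⟦X⟧) : tay (dLK k K) 1 (iK k K u) = mapP (iK k K) (tay (dk k k) 1 u) := by
    have := tay_map (dk k k) (dLK k K) (iK k K) dLK_iK 1 u
    rwa [map_one] at this
  have hW : (LinearMap.mulLeft k (C (1 : K))).comp ((tay (dLK k K) 1).toLinearMap.comp w) =
      (mapP (iK k K)).toLinearMap.comp ((tay (dk k k) 1).toLinearMap.comp w0) := by
    refine LinearMap.ext fun n => ?_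
    have : w n = iK k K (w0 n) := congr($hw0.symm n)
    change C 1 * tay (dLK k K) 1 (w n) = mapP (iK k K) (tay (dk k k) 1 (w0 n))
    rw [this, htay, map_one, one_mul]
  rw [hW] at hH
  have hIntg := c.integral H _ (iK k K).range (fun b => by
    rw [hH0]; exact Subalgebra.algebraMap_mem _ _) (fun n i => by
      change coeff i (mapP (iK k K) _) ∈ _
      rw [mapP_coeff]; exact ⟨_, rfl⟩) hH
  obtain ⟨H', hH'⟩ := algHom_factor (mapP (iK k K)) (mapP_inj _ (iK_inj k K)) H (fun b =>
    mapP_range _ _ (fun n => by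
      obtain ⟨a, ha⟩ := hIntg n b
      exact ⟨a, ha⟩))
  have hH1 : ∀ b, dk k _ (H' b) = c.act H' ((tay (dk k k) 1).toLinearMap.comp w0) b := by
    intro b
    apply mapP_inj _ (iK_inj k K)
    rw [← mapP_dk, c.map_act, hH', ← hH]
    exact congr(dk k _ ($hH' b))
  let γ := (mapP (ccA k k)).comp H'
  have hγ : ∀ b, dk k k (γ b) = c.act γ w0 b := by
    intro b
    have h1 := congr(mapP (ccA k k) $(hH1 b))
    rw [← mapP_dk, c.map_act] at h1
    have h2 : (mapP (ccA k k)).toLinearMap.comp ((tay (dk k k) 1).toLinearMap.comp w0) = w0 := by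
      refine LinearMap.ext fun n => ?_
      exact mapP_cc_tay (w0 n)
    rw [h2] at h1
    exact h1
  have hw1 : w0 1 = 0 := by
    apply iK_inj k K
    have := congr($hw0 1)
    rw [map_zero]
    exact this.trans h.1
  have hl := (c.isLogDer_pt (dk k k) γ w0 hw1).2 hγ
  have hl2 := hl.transport c (dLK k K) (iK k K) 1 (fun a => by rw [dLK_iK, one_mul])
  have hw2 : (LinearMap.mulLeft k (1 : K)).comp ((iK k K).toLinearMap.comp w0) = w := by
    rw [hw0]; exact LinearMap.ext fun n => one_mul _
  rw [hw2] at hl2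
  obtain ⟨d0, hd0⟩ := horizontal_const (dLK k K) dLK_ker _ (h.mul_inv c hl2)
  refine ⟨(SpO.map (Algebra.ofId k k⟦X⟧) ≫ d0) * c.pt γ, ?_⟩
  rw [Γ.comp_mul, ← Category.assoc, ← SpO.map_comp]
  have : (iK k K).comp (Algebra.ofId k k⟦X⟧) = Algebra.ofId k K := Subsingleton.elim _ _
  rw [this, ← hd0]
  simp

end LemmaA
end

section
open CategoryTheory AlgebraicGeometry Limits
open scoped TensorProduct
noncomputable section
set_option linter.unusedSectionVars false

section Swap
open PowerSeries
variable (k : Type) [Field k] [CharZero k]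

/-- Exchange the two variables. -/
def sw : k⟦X⟧⟦X⟧ →ₐ[k] k⟦X⟧⟦X⟧ where
  toFun F := PowerSeries.mk fun j => PowerSeries.mk fun i => coeff j (coeff i F)
  map_one' := by
    ext j i
    simp only [coeff_mk, coeff_one]
    by_cases hi : i = 0 <;> by_cases hj : j = 0 <;> simp [hi, hj, coeff_one]
  map_zero' := by ext; simp
  map_add' F G := by ext; simp
  map_mul' F G := by
    ext j i
    simp only [coeff_mk, coeff_mul, map_sum]
    rw [Finset.sum_comm]
  commutes' r := by
    ext j i
    simp only [coeff_mk]
    rw [PowerSeries.algebraMap_apply, PowerSeries.algebraMap_apply]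
    simp only [coeff_C]
    by_cases hi : i = 0 <;> by_cases hj : j = 0 <;> simp [hi, hj, coeff_C]

variable {k}

lemma sw_coeff (F : k⟦X⟧⟦X⟧) (i j : ℕ) : coeff i (coeff j (sw k F)) = coeff j (coeff i F) := by
  simp [sw]

lemma sw_sw (F : k⟦X⟧⟦X⟧) : sw k (sw k F) = F := by
  ext i j
  rw [sw_coeff, sw_coeff]

lemma sw_inj : Function.Injective (sw k) := fun F G h => by rw [← sw_sw F, h, sw_sw]

lemma cc_sw (F : k⟦X⟧⟦X⟧) : constantCoeff (sw k F) = PowerSeries.mapAlgHom (ccA k k) F := by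
  ext i
  rw [← coeff_zero_eq_constantCoeff_apply, sw_coeff]
  change _ = ccA k k (coeff i F)
  rw [ccA_apply, coeff_zero_eq_constantCoeff_apply]
end Swap

section B1
open PowerSeries
variable {k : Type} [Field k] [CharZero k]
variable {K : Type} [Field K] [Algebra k K]
  [Algebra k⟦X⟧ K] [IsScalarTower k k⟦X⟧ K] [IsFractionRing k⟦X⟧ K]

lemma exists_pole {N : Type} [AddCommGroup N] [Module k N] [Module.Finite k N] (w : N →ₗ[k] K)
    (hw : ¬ ∀ n, ∃ u, iK k K u = w n) :
    ∃ (m : ℕ) (u : N →ₗ[k] k⟦X⟧), 1 ≤ m ∧ (∀ n, iK k K (u n) = (iK k K X) ^ m * w n) ∧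
      ∃ n, constantCoeff (u n) ≠ 0 := by
  classical
  let P : ℕ → Prop := fun m => ∀ n, ∃ u, iK k K u = (iK k K X) ^ m * w n
  have hP : ∃ m, P m := by
    obtain ⟨s, hs⟩ := Module.Finite.fg_top (R := k) (M := N)
    choose f g hfg using fun n => LK_form (k := k) (w n)
    refine ⟨s.sup f, fun n => ?_⟩
    have hn : n ∈ Submodule.span k (s : Set N) := by rw [hs]; trivial
    induction hn using Submodule.span_induction with
    | mem x hx =>
      have h1 : f x ≤ s.sup f := Finset.le_sup hx
      refine ⟨X ^ (s.sup f - f x) * g x, ?_⟩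
      rw [map_mul, ← hfg, map_pow, ← mul_assoc, ← pow_add, Nat.sub_add_cancel h1]
    | zero => exact ⟨0, by simp⟩
    | add x y _ _ hx hy =>
      obtain ⟨a, ha⟩ := hx
      obtain ⟨b, hb⟩ := hy
      exact ⟨a + b, by rw [map_add, map_add, ha, hb, mul_add]⟩
    | smul r x _ hx =>
      obtain ⟨a, ha⟩ := hx
      exact ⟨r • a, by rw [map_smul, map_smul, ha, mul_smul_comm]⟩
  have hm := Nat.find_spec hP
  set m := Nat.find hP with hmdef
  have hm1 : 1 ≤ m := by
    rw [Nat.one_le_iff_ne_zero]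
    intro h0
    rw [h0] at hm
    exact hw (fun n => by simpa [P] using hm n)
  obtain ⟨u, hu⟩ := linMap_factor (iK k K) (iK_inj k K)
    ((LinearMap.mulLeft k ((iK k K X) ^ m)).comp w) hm
  refine ⟨m, u, hm1, fun n => congr($hu n), ?_⟩
  by_contra! hcon
  apply Nat.find_min hP (m := m - 1) (by omega)
  intro n
  obtain ⟨v, hv⟩ := PowerSeries.X_dvd_iff.2 (hcon n)
  refine ⟨v, mul_left_cancel₀ (iK_X_ne (k := k) (K := K)) ?_⟩
  rw [← map_mul, ← hv, ← mul_assoc, ← pow_succ', Nat.sub_add_cancel hm1]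
  exact congr($hu n)

/-- The factor `1 + s x^(m-1)`. -/
abbrev pfac (k : Type) [Field k] (m : ℕ) : k⟦X⟧⟦X⟧ := 1 + C (X ^ (m - 1)) * X

lemma tay_X (m : ℕ) (hm : 1 ≤ m) : tay (dk k k) (X ^ m) X = C X * pfac k m := by
  have hX : dk k k X = 1 := by
      ext i; rw [dk_coeff, coeff_X, coeff_one]
      by_cases hi : i = 0 <;> simp [hi]
  apply dk_ext (k := k)
  · rw [tay_zero]; simp [pfac]
  · rw [tay_d, hX, map_one, mul_one]
    have h1 : ∀ a : k⟦X⟧, dk k k⟦X⟧ (C a) = 0 := by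
      intro a
      ext1 n
      simp [dk_coeff]
    have h2 : dk k k⟦X⟧ X = 1 := by
      ext1 i; rw [dk_coeff, coeff_X, coeff_one]
      by_cases hi : i = 0 <;> simp [hi]
    rw [Derivation.leibniz, h1, pfac, map_add, Derivation.leibniz, h1, h2, Derivation.map_one_eq_zero]
    simp only [smul_eq_mul, mul_one, mul_zero, add_zero, zero_add]
    rw [← map_mul, ← pow_succ', Nat.sub_add_cancel hm]

lemma pfac_unit (m : ℕ) : ∃ q, pfac k m * q = 1 := by
  have : IsUnit (pfac k m) := by
    rw [PowerSeries.isUnit_iff_constantCoeff]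
    simp [pfac]
  exact this.exists_right_inv

lemma mapP_cc_tay_pow (m : ℕ) (hm : 1 ≤ m) (f : k⟦X⟧) :
    mapP (ccA k k) (tay (dk k k) (X ^ m) f) = C (constantCoeff f) := by
  ext n
  rw [mapP_coeff, tay_coeff, ccA_apply, coeff_C, map_mul, map_pow, map_pow]
  by_cases hn : n = 0
  · simp [hn]
  · simp [hn, show m ≠ 0 by omega]

lemma pow_mul_tay (m : ℕ) (hm : 1 ≤ m) (q : k⟦X⟧⟦X⟧) (hq : pfac k m * q = 1) (u : k⟦X⟧) (f : K)
    (hf : iK k K u = (iK k K X) ^ m * f) :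
    C ((iK k K X) ^ m) * tay (dLK k K) ((iK k K X) ^ m) f =
      mapP (iK k K) (q ^ m * tay (dk k k) (X ^ m) u) := by
  have ht (u : k⟦X⟧) : tay (dLK k K) ((iK k K X) ^ m) (iK k K u) =
      mapP (iK k K) (tay (dk k k) (X ^ m) u) := by
    rw [← map_pow]
    exact tay_map (dk k k) (dLK k K) (iK k K) dLK_iK _ u
  have h1 := congr(tay (dLK k K) ((iK k K X) ^ m) $hf)
  rw [ht, map_mul, map_pow, ht, tay_X m hm] at h1
  rw [map_mul, h1, ← mul_assoc, ← map_pow (mapP (iK k K)), ← map_mul]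
  congr 1
  rw [mul_pow, mul_left_comm, ← mul_pow, mul_comm q, hq, one_pow, mul_one, ← map_pow]
  ext n
  rw [mapP_coeff, ← map_pow C, coeff_C, coeff_C]
  split_ifs <;> simp

end B1

section FieldPts
variable {k : Type} [Field k] {X : OverR k}
variable {L L' : Type} [Field L] [Field L'] [Algebra k L] [Algebra k L']

lemma field_chart {B : Type} [CommRing B] [Algebra k B] (j : SpO k B ⟶ X) [IsOpenImmersion j.left]
    (f : L →ₐ[k] L') (p : SpO k L ⟶ X) (ψ : B →ₐ[k] L') (h : SpO.map f ≫ p = SpO.map ψ ≫ j) :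
    ∃ χ : B →ₐ[k] L, p = SpO.map χ ≫ j ∧ f.comp χ = ψ := by
  have hr : Set.range p.left ⊆ Set.range j.left := by
    rintro _ ⟨x, rfl⟩
    have h1 : x = (SpO.map f).left (⊥ : PrimeSpectrum L') :=
      Subsingleton.elim (α := PrimeSpectrum L) _ _
    have h2 : (SpO.map f ≫ p).left (⊥ : PrimeSpectrum L') ∈ Set.range j.left := by
      rw [h]
      exact ⟨(SpO.map ψ).left _, rfl⟩
    rw [h1]
    exact h2
  obtain ⟨χ, hχ⟩ := chart_factor j p hr
  refine ⟨χ, hχ, ?_⟩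
  apply chart_cancel j
  rw [SpO.map_comp, Category.assoc, ← hχ, h]

lemma field_inj (f : L →ₐ[k] L') {p q : SpO k L ⟶ X} (h : SpO.map f ≫ p = SpO.map f ≫ q) :
    p = q := by
  obtain ⟨B, _, _, j, hj, hx, -⟩ := exists_chart X (p.left (⊥ : PrimeSpectrum L))
  have hr : Set.range p.left ⊆ Set.range j.left := by
    rintro _ ⟨x, rfl⟩
    have : x = (⊥ : PrimeSpectrum L) := Subsingleton.elim (α := PrimeSpectrum L) _ _
    rw [this]
    exact hx
  obtain ⟨χ, hχ⟩ := chart_factor j p hr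
  obtain ⟨χ', hχ', h2⟩ := field_chart j f q (f.comp χ) (by
    rw [← h, hχ, SpO.map_comp, Category.assoc])
  have : χ' = χ := by
    ext b
    exact f.injective congr($h2 b)
  rw [hχ, hχ', this]

end FieldPts

section B2
open PowerSeries
variable {k : Type} [Field k] [CharZero k]
variable {K : Type} [Field K] [Algebra k K]
  [Algebra k⟦X⟧ K] [IsScalarTower k k⟦X⟧ K] [IsFractionRing k⟦X⟧ K]
variable {Γ : GroupScheme k} (c : IdChart Γ)

lemma IdChart.lemmaB2 {g : SpO k K ⟶ Γ.G} {w : c.N →ₗ[k] K}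
    (h : c.IsLogDer (dLK k K) g w) (m : ℕ) (hm : 1 ≤ m) (u : c.N →ₗ[k] k⟦X⟧)
    (hu : ∀ n, iK k K (u n) = (iK k K X) ^ m * w n) :
    ∃ H : c.B →ₐ[k] k⟦X⟧⟦X⟧,
      SpO.map (tay (dLK k K) ((iK k K X) ^ m)) ≫ g =
        (SpO.map (CA k K) ≫ g) * c.pt ((mapP (iK k K)).comp H) ∧
      (∀ b, constantCoeff (mapP (ccA k k) (H b)) = c.e b) ∧
      ∀ b, (1 + C (constantCoeff (X ^ (m - 1) : k⟦X⟧)) * X) * dk k k (mapP (ccA k k) (H b)) =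
        c.act ((mapP (ccA k k)).comp H)
          ((Algebra.linearMap k k⟦X⟧).comp ((ccA k k).toLinearMap.comp u)) b := by
  obtain ⟨q, hq⟩ := pfac_unit (k := k) m
  let W : c.N →ₗ[k] k⟦X⟧⟦X⟧ := (LinearMap.mulLeft k (q ^ m)).comp
    ((tay (dk k k) (X ^ m)).toLinearMap.comp u)
  obtain ⟨H, hH1, hH0, hH⟩ := c.flow h ((iK k K X) ^ m)
  have hW : (LinearMap.mulLeft k (C ((iK k K X) ^ m))).comp
      ((tay (dLK k K) ((iK k K X) ^ m)).toLinearMap.comp w) =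
      (mapP (iK k K)).toLinearMap.comp W := by
    refine LinearMap.ext fun n => ?_
    exact pow_mul_tay m hm q hq (u n) (w n) (hu n)
  rw [hW] at hH
  have hIntg := c.integral H _ (iK k K).range (fun b => by
    rw [hH0]; exact Subalgebra.algebraMap_mem _ _) (fun n i => by
      change coeff i (mapP (iK k K) _) ∈ _
      rw [mapP_coeff]; exact ⟨_, rfl⟩) hH
  obtain ⟨H', hH'⟩ := algHom_factor (mapP (iK k K)) (mapP_inj _ (iK_inj k K)) H (fun b =>
    mapP_range _ _ (fun n => by
      obtain ⟨a, ha⟩ := hIntg n b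
      exact ⟨a, ha⟩))
  have hH2 : ∀ b, dk k _ (H' b) = c.act H' W b := by
    intro b
    apply mapP_inj _ (iK_inj k K)
    rw [← mapP_dk, c.map_act, hH', ← hH]
    exact congr(dk k _ ($hH' b))
  refine ⟨H', by rw [hH', hH1], ?_, ?_⟩
  · intro b
    have h1 : iK k K (constantCoeff (H' b)) = iK k K (algebraMap k _ (c.e b)) := by
      rw [AlgHom.commutes, ← hH0, ← hH']
      rw [← coeff_zero_eq_constantCoeff_apply, ← coeff_zero_eq_constantCoeff_apply]
      rfl
    have h2 := iK_inj k K h1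
    rw [← coeff_zero_eq_constantCoeff_apply, mapP_coeff, coeff_zero_eq_constantCoeff_apply, h2,
      AlgHom.commutes]
    rfl
  · intro b
    have h1 := congr(mapP (ccA k k) $(hH2 b))
    rw [← mapP_dk, c.map_act] at h1
    rw [h1]
    obtain ⟨ι, s, x, y, hs⟩ := c.exists_rho_sum b
    rw [c.act_sum hs, c.act_sum hs, Finset.mul_sum]
    refine Finset.sum_congr rfl fun i _ => ?_
    rw [mul_left_comm]
    congr 1
    change _ * mapP (ccA k k) (q ^ m * tay (dk k k) (X ^ m) (u (y i))) =
      algebraMap k k⟦X⟧ (constantCoeff (u (y i)))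
    rw [map_mul, mapP_cc_tay_pow m hm, PowerSeries.algebraMap_apply, Algebra.algebraMap_self,
      RingHom.id_apply, ← mul_assoc]
    have h3 : mapP (ccA k k) (pfac k m) = 1 + C (constantCoeff (X ^ (m - 1) : k⟦X⟧)) * X := by
      ext i
      rw [mapP_coeff, ccA_apply]
      cases i with
      | zero => simp
      | succ i =>
        simp only [map_add, coeff_succ_mul_X, coeff_C, coeff_one]
        by_cases hi : i = 0 <;> simp [hi]
    have h4 : (1 + C (constantCoeff (X ^ (m - 1) : k⟦X⟧)) * X) * mapP (ccA k k) (q ^ m) = 1 := by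
      have h5 := congr(mapP (ccA k k) $hq)
      rw [map_mul, h3, map_one] at h5
      rw [map_pow (mapP (ccA k k))]
      by_cases hm1 : m = 1
      · subst hm1
        rw [pow_one]; exact h5
      · have h6 : constantCoeff (X ^ (m - 1) : k⟦X⟧) = 0 := by
          rw [map_pow, constantCoeff_X, zero_pow (by omega)]
        rw [h6, map_zero, zero_mul, add_zero, one_mul] at h5 ⊢
        rw [h5, one_pow]
    rw [h4, one_mul]

end B2
end

section
open CategoryTheory AlgebraicGeometry Limits
open scoped TensorProduct
noncomputable section
set_option linter.unusedSectionVars false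

section FracLift
variable {k : Type} [Field k] {R F F' : Type} [CommRing R] [IsDomain R] [Algebra k R] [Field F]
  [Algebra k F] [Algebra R F] [IsScalarTower k R F] [IsFractionRing R F] [Field F'] [Algebra k F']

def fLift (f : R →ₐ[k] F') (hf : Function.Injective f) : F →ₐ[k] F' :=
  IsFractionRing.liftAlgHom (K := F) (g := f) hf

lemma fLift_apply (f : R →ₐ[k] F') (hf : Function.Injective f) (r : R) :
    fLift (F := F) f hf (algebraMap R F r) = f r := by
  simp [fLift, IsFractionRing.liftAlgHom_apply, IsFractionRing.lift_algebraMap]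

lemma fLift_ext {C : Type} [CommRing C] [Algebra k C] (R : Type) [CommRing R] [IsDomain R]
    [Algebra k R] [Algebra R F] [IsScalarTower k R F] [IsFractionRing R F]
    {f g : F →ₐ[k] C} (h : ∀ r : R, f (algebraMap R F r) = g (algebraMap R F r)) : f = g := by
  have : f.toRingHom = g.toRingHom := by
    apply IsLocalization.ringHom_ext (nonZeroDivisors R)
    ext r
    exact h r
  ext x
  exact congr($this x)
end FracLift

section B3
open PowerSeries
open scoped Polynomial
variable {k : Type} [Field k] [CharZero k]
variable {K : Type} [Field K] [Algebra k K]
  [Algebra k⟦X⟧ K] [IsScalarTower k k⟦X⟧ K] [IsFractionRing k⟦X⟧ K]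
variable {Γ : GroupScheme k} (c : IdChart Γ)

/-- polynomials into power series. -/
def polP (k : Type) [Field k] : k[X] →ₐ[k] k⟦X⟧ := Polynomial.coeToPowerSeries.algHom k

lemma polP_coeff (p : k[X]) (n : ℕ) : coeff n (polP k p) = p.coeff n := by
  simp [polP, Polynomial.coeToPowerSeries.algHom_apply]

lemma polP_inj : Function.Injective (polP k) := by
  intro p q h
  ext n
  rw [← polP_coeff, h, polP_coeff]

lemma polP_range (F : k⟦X⟧) (N : ℕ) (h : ∀ n, N < n → coeff n F = 0) : ∃ p, polP k p = F := by
  refine ⟨PowerSeries.trunc (N + 1) F, ?_⟩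
  ext n
  rw [polP_coeff, PowerSeries.coeff_trunc]
  split_ifs with hn
  · rfl
  · rw [h n (by omega)]

lemma tay_poly (m : ℕ) (hm : 1 ≤ m) : ∃ σ : k⟦X⟧ →ₐ[k] k[X]⟦X⟧,
    (mapP (polP k)).comp σ = (sw k).comp (tay (dk k k) (X ^ m)) := by
  apply algHom_factor _ (mapP_inj _ polP_inj)
  intro f
  apply mapP_range
  intro j
  apply polP_range _ j
  intro n hn
  rw [AlgHom.comp_apply, sw_coeff, tay_coeff, ← pow_mul, coeff_mul_X_pow', if_neg]
  have : n ≤ m * n := Nat.le_mul_of_pos_left n hm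
  omega

lemma CA_poly : ∃ σ : k⟦X⟧ →ₐ[k] k[X]⟦X⟧,
    (mapP (polP k)).comp σ = (sw k).comp (CA k k⟦X⟧) := by
  apply algHom_factor _ (mapP_inj _ polP_inj)
  intro f
  apply mapP_range
  intro j
  apply polP_range _ 0
  intro n hn
  rw [AlgHom.comp_apply, sw_coeff, CA_apply, coeff_C, if_neg (by omega), map_zero]

lemma tay_inj {A : Type} [CommRing A] [Algebra k A] (D : Derivation k A A) (y : A) :
    Function.Injective (tay D y) :=
  fun a b h => by rw [← tay_zero D y a, h, tay_zero]

lemma CA_inj {A : Type} [CommRing A] [Algebra k A] : Function.Injective (CA k A) :=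
  fun _ _ h => PowerSeries.C_injective h

lemma rational_aux (P Q : k[X]⟦X⟧) (hQ : Q ≠ 0) (F : k⟦X⟧⟦X⟧)
    (h : mapP (polP k) Q * F = mapP (polP k) P) :
    ∃ p q : k[X], q ≠ 0 ∧ polP k q * constantCoeff F = polP k p := by
  have hQ1 := PowerSeries.X_pow_order_mul_divXPowOrder (f := Q)
  refine ⟨coeff Q.order.toNat P, coeff Q.order.toNat Q, PowerSeries.coeff_order hQ, ?_⟩
  have h1 := congr(coeff Q.order.toNat $h)
  rw [mapP_coeff] at h1
  rw [← h1, coeff_mul, Finset.sum_eq_single (Q.order.toNat, 0)]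
  · rw [mapP_coeff, coeff_zero_eq_constantCoeff_apply]
  · intro x hx hne
    rw [mapP_coeff, PowerSeries.coeff_of_lt_order_toNat, map_zero, zero_mul]
    have := Finset.HasAntidiagonal.mem_antidiagonal.1 hx
    by_contra hlt
    apply hne
    ext <;> simp <;> omega
  · intro hx
    exact absurd (Finset.HasAntidiagonal.mem_antidiagonal.2 (by simp)) hx

lemma IdChart.lemmaB3 {E M' F1 : Type} [Field E] [Field M'] [Field F1] [Algebra k E] [Algebra k M']
    [Algebra k F1]
    [Algebra k⟦X⟧⟦X⟧ E] [IsScalarTower k k⟦X⟧⟦X⟧ E] [IsFractionRing k⟦X⟧⟦X⟧ E]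
    [Algebra K⟦X⟧ M'] [IsScalarTower k K⟦X⟧ M'] [IsFractionRing K⟦X⟧ M']
    [Algebra k[X]⟦X⟧ F1] [IsScalarTower k k[X]⟦X⟧ F1] [IsFractionRing k[X]⟦X⟧ F1]
    {g : SpO k K ⟶ Γ.G} (m : ℕ) (hm : 1 ≤ m)
    (H : c.B →ₐ[k] k⟦X⟧⟦X⟧)
    (h : SpO.map (tay (dLK k K) ((iK k K X) ^ m)) ≫ g =
        (SpO.map (CA k K) ≫ g) * c.pt ((mapP (iK k K)).comp H)) (b : c.B) :
    ∃ p q : k[X], q ≠ 0 ∧ polP k q * (mapP (ccA k k) (H b)) = polP k p := by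
  let iE : k⟦X⟧⟦X⟧ →ₐ[k] E := IsScalarTower.toAlgHom k _ E
  have iE_def (r) : iE r = algebraMap _ E r := rfl
  have iE_inj : Function.Injective iE := IsFractionRing.injective k⟦X⟧⟦X⟧ E
  let iM : K⟦X⟧ →ₐ[k] M' := IsScalarTower.toAlgHom k _ M'
  have iM_inj : Function.Injective iM := IsFractionRing.injective K⟦X⟧ M'
  let iF : k[X]⟦X⟧ →ₐ[k] F1 := IsScalarTower.toAlgHom k _ F1
  have iF_def (r) : iF r = algebraMap _ F1 r := rfl
  have iF_inj : Function.Injective iF := IsFractionRing.injective k[X]⟦X⟧ F1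
  obtain ⟨σ', hσ'⟩ := tay_poly (k := k) m hm
  obtain ⟨C', hC'⟩ := CA_poly (k := k)
  have hσ'i : Function.Injective σ' := by
    have : Function.Injective ((mapP (polP k)).comp σ') := by
      rw [hσ']; exact sw_inj.comp (tay_inj _ _)
    exact Function.Injective.of_comp (f := mapP (polP k)) this
  have hC'i : Function.Injective C' := by
    have : Function.Injective ((mapP (polP k)).comp C') := by
      rw [hC']; exact sw_inj.comp (CA_inj (k := k))
    exact Function.Injective.of_comp (f := mapP (polP k)) this
  let σ1 : K →ₐ[k] F1 := fLift (iF.comp σ') (iF_inj.comp hσ'i)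
  let C1 : K →ₐ[k] F1 := fLift (iF.comp C') (iF_inj.comp hC'i)
  let i1 : F1 →ₐ[k] E := fLift (iE.comp (mapP (polP k))) (iE_inj.comp (mapP_inj (polP k) polP_inj))
  let jE : E →ₐ[k] M' := fLift (iM.comp ((mapP (iK k K)).comp (sw k)))
    (iM_inj.comp ((mapP_inj _ (iK_inj k K)).comp sw_inj))
  have aσ (r : k⟦X⟧) : σ1 (iK k K r) = iF (σ' r) := fLift_apply _ _ r
  have aC (r : k⟦X⟧) : C1 (iK k K r) = iF (C' r) := fLift_apply _ _ r
  have ai (r : k[X]⟦X⟧) : i1 (iF r) = iE (mapP (polP k) r) := fLift_apply _ _ r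
  have aj (r : k⟦X⟧⟦X⟧) : jE (iE r) = iM (mapP (iK k K) (sw k r)) := fLift_apply _ _ r
  clear_value σ1 C1 i1 jE iE iM iF
  have e1 : (jE.comp i1).comp σ1 = iM.comp (tay (dLK k K) ((iK k K X) ^ m)) := by
    apply fLift_ext k⟦X⟧
    intro r
    change jE (i1 (σ1 (iK k K r))) = iM (tay _ _ (iK k K r))
    have := congr($hσ' r)
    simp only [AlgHom.comp_apply] at this
    rw [← map_pow, tay_map (dk k k) (dLK k K) (iK k K) dLK_iK, aσ, ai, this, aj, sw_sw]
  have e2 : (jE.comp i1).comp C1 = iM.comp (CA k K) := by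
    apply fLift_ext k⟦X⟧
    intro r
    change jE (i1 (C1 (iK k K r))) = iM (CA k K (iK k K r))
    have := congr($hC' r)
    simp only [AlgHom.comp_apply] at this
    rw [aC, ai, this, aj, sw_sw]
    congr 1
    ext n
    rw [mapP_coeff, CA_apply (k := k) (A := k⟦X⟧), CA_apply (k := k) (A := K), coeff_C, coeff_C]
    split_ifs <;> simp
  let t := (SpO.map C1 ≫ g)⁻¹ * (SpO.map σ1 ≫ g)
  let Hs : c.B →ₐ[k] E := (iE.comp (sw k)).comp H
  have hjH : jE.comp Hs = iM.comp ((mapP (iK k K)).comp H) := by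
    ext b
    change jE (iE (sw k (H b))) = _
    rw [aj]
    simp only [AlgHom.comp_apply, sw_sw]
  have ht : SpO.map i1 ≫ t = SpO.map Hs ≫ c.j := by
    apply field_inj jE
    rw [← Category.assoc, ← SpO.map_comp, ← Category.assoc, ← SpO.map_comp, hjH]
    change _ = c.pt _
    rw [Γ.comp_mul, Γ.comp_inv, ← Category.assoc, ← Category.assoc, ← SpO.map_comp, ← SpO.map_comp,
      e1, e2, SpO.map_comp, SpO.map_comp, Category.assoc, Category.assoc, ← Γ.comp_inv, ← Γ.comp_mul,
      h, inv_mul_cancel_left, c.map_pt]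
  have := c.oi
  obtain ⟨χ, -, hχ⟩ := field_chart c.j i1 t Hs ht
  obtain ⟨P, Q, hQ, hPQ⟩ := IsFractionRing.div_surjective (A := k[X]⟦X⟧) (χ b)
  have hQ0 : Q ≠ 0 := nonZeroDivisors.ne_zero hQ
  have hQF : iF Q ≠ 0 := by
    intro h0
    exact hQ0 (iF_inj (by rw [h0, map_zero]))
  have h1 : iF Q * χ b = iF P := by
    rw [← hPQ, ← iF_def, ← iF_def]
    field_simp
  have h2 := congr(i1 $h1)
  have h3 : i1 (χ b) = Hs b := congr($hχ b)
  rw [map_mul, h3, ai, ai] at h2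
  change iE _ * iE _ = iE _ at h2
  rw [← map_mul] at h2
  have h4 := iE_inj h2
  obtain ⟨p, q, hq, hpq⟩ := rational_aux P Q hQ0 _ h4
  refine ⟨p, q, hq, ?_⟩
  have hpq' : polP k q * constantCoeff (sw k (H b)) = polP k p := hpq
  rw [cc_sw] at hpq'
  exact hpq'

end B3
end

section
open CategoryTheory AlgebraicGeometry Limits
open scoped TensorProduct
noncomputable section
set_option linter.unusedSectionVars false

section Glue
variable {k : Type} [Field k]

lemma dominant_of_openImm {W P Y : Scheme.{0}} (i : W ⟶ P) (o : P ⟶ Y) [IsOpenImmersion o] (w : W)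
    (hw : ∀ y, (i ≫ o) w ⤳ y) : IsDominant i := by
  constructor
  rw [DenseRange, dense_iff_inter_open]
  intro V hV ⟨v, hv⟩
  refine ⟨i w, ?_, w, rfl⟩
  have h1 : IsOpen (o '' V) := o.isOpenEmbedding.isOpenMap _ hV
  obtain ⟨v', hv', e⟩ := (hw (o v)).mem_open h1 ⟨v, hv, rfl⟩
  rw [Scheme.Hom.comp_apply] at e
  rwa [← o.isOpenEmbedding.injective e]

lemma glue_lemma {X : OverR k} [IsSeparated X.hom] {R F : Type} [CommRing R] [IsDomain R]
    [Algebra k R] [Field F] [Algebra k F] [Algebra R F] [IsScalarTower k R F] [IsFractionRing R F]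
    (p : SpO k F ⟶ X)
    (h : ∀ x : PrimeSpectrum R, ∃ q ∉ x.asIdeal, ∃ (f : SpO k (Localization.Away q) ⟶ X)
      (a : Localization.Away q →ₐ[k] F), (∀ r, a (algebraMap R _ r) = algebraMap R F r) ∧
      SpO.map a ≫ f = p) :
    ∃ P : SpO k R ⟶ X, SpO.map (IsScalarTower.toAlgHom k R F) ≫ P = p := by
  choose q hq f a ha hf using h
  let ι (x : PrimeSpectrum R) : SpO k (Localization.Away (q x)) ⟶ SpO k R :=
    SpO.map (IsScalarTower.toAlgHom k R (Localization.Away (q x)))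
  have hι (x) : IsOpenImmersion (ι x).left := by
    change IsOpenImmersion (Spec.map (CommRingCat.ofHom (algebraMap R (Localization.Away (q x)))))
    infer_instance
  have hm (x : (SpO k R).left) : x ∈ Set.range (ι x).left := by
    change (x : PrimeSpectrum R) ∈ Set.range (PrimeSpectrum.comap (algebraMap R (Localization.Away (q x))))
    rw [PrimeSpectrum.localization_away_comap_range _ (q x)]
    exact hq x
  have hai (x) : SpO.map (a x) ≫ ι x = SpO.map (IsScalarTower.toAlgHom k R F) := by
    rw [← SpO.map_comp]
    congr 1
    ext r
    exact ha x r
  clear_value ι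
  let 𝒰 : (SpO k R).left.OpenCover := 
    { I₀ := PrimeSpectrum R
      X := fun x => (SpO k (Localization.Away (q x))).left
      f := fun x => (ι x).left
      mem₀ := by
        rw [Scheme.presieve₀_mem_precoverage_iff]
        refine ⟨fun x => ⟨x, hm x⟩, hι⟩ }
  have hIntg : IsIntegral (SpO k R).left := by
    change IsIntegral (Spec (CommRingCat.of R))
    infer_instance
  have hcompat : ∀ x y, pullback.fst (𝒰.f x) (𝒰.f y) ≫ (f x).left =
      pullback.snd (𝒰.f x) (𝒰.f y) ≫ (f y).left := by
    intro x y
    have : IsOpenImmersion (𝒰.f x) := hι x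
    have : IsOpenImmersion (𝒰.f y) := hι y
    have hR : IsReduced (pullback (𝒰.f x) (𝒰.f y)) :=
      isReduced_of_isOpenImmersion (pullback.fst (𝒰.f x) (𝒰.f y) ≫ 𝒰.f x)
    let i : (SpO k F).left ⟶ pullback (𝒰.f x) (𝒰.f y) :=
      pullback.lift (SpO.map (a x)).left (SpO.map (a y)).left (by
        exact congr(($((hai x).trans (hai y).symm)).left))
    have hi : i ≫ pullback.fst (𝒰.f x) (𝒰.f y) ≫ 𝒰.f x = (SpO.map (IsScalarTower.toAlgHom k R F)).left := by
      rw [← Category.assoc, pullback.lift_fst]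
      exact congr(($(hai x)).left)
    have hdom : IsDominant i := by
      apply dominant_of_openImm i (pullback.fst (𝒰.f x) (𝒰.f y) ≫ 𝒰.f x) (⊥ : PrimeSpectrum F)
      rw [hi]
      intro y
      rw [SpO.map_apply]
      refine (PrimeSpectrum.le_iff_specializes _ (y : PrimeSpectrum R)).mp ?_
      intro r hr
      have : algebraMap R F r = 0 := hr
      rw [(IsFractionRing.injective R F) (this.trans (map_zero _).symm)]
      exact zero_mem _
    refine ext_of_isDominant_of_isSeparated X.hom ?_ i ?_
    · have h1 := Over.w (f x)
      have h2 := Over.w (f y)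
      have h3 := Over.w (ι x)
      have h4 := Over.w (ι y)
      rw [Category.assoc, Category.assoc, h1, h2, ← h3, ← h4]
      exact pullback.condition_assoc _
    · rw [← Category.assoc, ← Category.assoc, pullback.lift_fst, pullback.lift_snd]
      exact congr(($((hf x).trans (hf y).symm)).left)
  let P0 := 𝒰.glueMorphisms (fun x => (f x).left) hcompat
  have hP0 (x) : (ι x).left ≫ P0 = (f x).left := 𝒰.ι_glueMorphisms (fun x => (f x).left) hcompat x
  refine ⟨Over.homMk P0 ?_, ?_⟩
  · apply 𝒰.hom_ext
    intro x
    change (ι x).left ≫ P0 ≫ X.hom = (ι x).left ≫ _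
    rw [← Category.assoc, hP0, Over.w (f x), Over.w (ι x)]
  · rw [← hai ⊥, Category.assoc, ← hf ⊥]
    congr 1
    ext1
    exact hP0 ⊥
end Glue
end

section
open CategoryTheory AlgebraicGeometry Limits
open scoped TensorProduct
noncomputable section
set_option linter.unusedSectionVars false

section Ext
open PowerSeries
open scoped Polynomial
variable {k : Type} [Field k] [CharZero k]

lemma der_map {R F F' : Type} [CommRing R] [IsDomain R] [Algebra k R] [Field F]
    [Algebra k F] [Algebra R F] [IsScalarTower k R F] [IsFractionRing R F] [Field F'] [Algebra k F']
    (D : Derivation k F F) (D' : Derivation k F' F') (f : F →ₐ[k] F')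
    (h : ∀ r, D' (f (algebraMap R F r)) = f (D (algebraMap R F r))) (x : F) :
    D' (f x) = f (D x) := by
  obtain ⟨a, b, hb, rfl⟩ := IsFractionRing.div_surjective (A := R) x
  have hb0 : algebraMap R F b ≠ 0 := by
    intro h0
    exact nonZeroDivisors.ne_zero hb (IsFractionRing.injective R F (h0.trans (map_zero _).symm))
  set A := algebraMap R F a with hA
  set B := algebraMap R F b with hB
  have h1 : A / B * B = A := by field_simp
  have h2 := congr(D' (f $h1))
  have h3 := congr(f (D $h1))
  have hfB : f B ≠ 0 := by
    intro h0; exact hb0 (f.injective (h0.trans (map_zero _).symm))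
  rw [map_mul, Derivation.leibniz, h, h, ← h3, Derivation.leibniz, map_add] at h2
  simp only [smul_eq_mul, map_mul] at h2
  have h4 := add_left_cancel h2
  exact mul_left_cancel₀ hfB h4

/-- shifted expansion of polynomials. -/
def tauc (a : k) : k[X] →ₐ[k] k⟦X⟧ :=
  (polP k).comp (Polynomial.aeval (Polynomial.X + Polynomial.C a))

lemma tauc_apply (a : k) (p : k[X]) : tauc a p = polP k (p.comp (Polynomial.X + Polynomial.C a)) := rfl

lemma tauc_inj (a : k) : Function.Injective (tauc a) := by
  intro p q h
  have h1 : p.comp (Polynomial.X + Polynomial.C a) = q.comp (Polynomial.X + Polynomial.C a) :=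
    polP_inj h
  have h2 := congr(Polynomial.comp $h1 (Polynomial.X - Polynomial.C a))
  rw [Polynomial.comp_assoc, Polynomial.comp_assoc] at h2
  simpa using h2

lemma dk_polP (p : k[X]) : dk k k (polP k p) = polP k (Polynomial.derivative p) := by
  ext n
  rw [dk_coeff, polP_coeff, polP_coeff, Polynomial.coeff_derivative]

lemma dk_tauc (a : k) (p : k[X]) : dk k k (tauc a p) = tauc a (Polynomial.derivative p) := by
  rw [tauc_apply, tauc_apply, dk_polP, Polynomial.derivative_comp]
  simp

lemma tauc_cc (a : k) (p : k[X]) : constantCoeff (tauc a p) = p.eval a := by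
  rw [← coeff_zero_eq_constantCoeff_apply, tauc_apply, polP_coeff, Polynomial.coeff_zero_eq_eval_zero,
    Polynomial.eval_comp]
  simp

lemma tauc_one_comp (p : k[X]) : tauc 1 (p.comp (Polynomial.X - Polynomial.C 1)) = polP k p := by
  rw [tauc_apply, Polynomial.comp_assoc]
  simp

lemma IdChart.act_mulLeft {Γ : GroupScheme k} (c : IdChart Γ) {A : Type} [CommRing A] [Algebra k A]
    (Y : c.B →ₐ[k] A) (w : c.N →ₗ[k] A) (y : A) (b : c.B) :
    c.act Y ((LinearMap.mulLeft k y).comp w) b = y * c.act Y w b := by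
  obtain ⟨ι, s, f, g, h⟩ := c.exists_rho_sum b
  rw [c.act_sum h, c.act_sum h, Finset.mul_sum]
  refine Finset.sum_congr rfl fun i _ => ?_
  simp only [LinearMap.comp_apply, LinearMap.mulLeft_apply]
  ring

/-- Spreading out. -/
lemma spread {R F B : Type} [CommRing R] [IsDomain R] [Algebra k R] [Field F]
    [Algebra k F] [Algebra R F] [IsScalarTower k R F] [IsFractionRing R F] [CommRing B] [Algebra k B]
    [Algebra.FiniteType k B] (χ : B →ₐ[k] F) (x : Ideal R) [x.IsPrime]
    (h : ∀ b, ∃ q ∉ x, ∃ p, χ b * algebraMap R F q = algebraMap R F p) :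
    ∃ q ∉ x, ∃ (a : Localization.Away q →ₐ[k] F) (χ' : B →ₐ[k] Localization.Away q),
      (∀ r, a (algebraMap R _ r) = algebraMap R F r) ∧ a.comp χ' = χ := by
  classical
  obtain ⟨s, hs⟩ := Algebra.FiniteType.out (R := k) (A := B)
  choose q hq p hp using h
  let Q := ∏ b ∈ s, q b
  have hQ : Q ∉ x := by
    rw [Ideal.IsPrime.prod_mem_iff]
    rintro ⟨b, -, hb⟩
    exact hq b hb
  have hinj := IsFractionRing.injective R F
  have hunit : ∀ y : Submonoid.powers Q, IsUnit (IsScalarTower.toAlgHom k R F (y : R)) := by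
    rintro ⟨_, n, rfl⟩
    have : algebraMap R F Q ≠ 0 := by
      intro h0
      have : Q = 0 := hinj (h0.trans (map_zero _).symm)
      exact hQ (this ▸ zero_mem _)
    simp only [map_pow]
    exact (IsUnit.mk0 _ this).pow n
  let a : Localization.Away Q →ₐ[k] F := IsLocalization.liftAlgHom (M := Submonoid.powers Q)
    (f := IsScalarTower.toAlgHom k R F) hunit
  have ha (r) : a (algebraMap R _ r) = algebraMap R F r := by
    simp [a, IsLocalization.liftAlgHom_apply]
  have hai : Function.Injective a := by
    intro y z hyz
    obtain ⟨⟨y1, y2⟩, hy⟩ := IsLocalization.surj (Submonoid.powers Q) (y - z)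
    have h0 : a (y - z) = 0 := by rw [map_sub, hyz, sub_self]
    have h1 := congr(a $hy)
    rw [map_mul, h0, zero_mul, ha] at h1
    have : y1 = 0 := hinj (h1.symm.trans (map_zero _).symm)
    subst this
    rw [map_zero] at hy
    have hu := IsLocalization.map_units (Localization.Away Q) y2
    rw [← sub_eq_zero]
    exact (hu.mul_left_eq_zero).1 hy
  clear_value a
  refine ⟨Q, hQ, a, ?_⟩
  have hr : ∀ b, χ b ∈ a.range := by
    intro b
    have hb : b ∈ Algebra.adjoin k (s : Set B) := by rw [hs]; trivial
    have : Algebra.adjoin k (s : Set B) ≤ a.range.comap χ := by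
      rw [Algebra.adjoin_le_iff]
      intro b hb
      refine ⟨IsLocalization.mk' _ (p b * ∏ b' ∈ s.erase b, q b') (⟨Q, Submonoid.mem_powers _⟩ : Submonoid.powers Q), ?_⟩
      have hne : algebraMap R F Q ≠ 0 := by
        have := hunit ⟨Q, Submonoid.mem_powers _⟩
        exact this.ne_zero
      apply mul_right_cancel₀ hne
      change a _ * _ = _
      have e : IsLocalization.mk' (Localization.Away Q) (p b * ∏ b' ∈ s.erase b, q b')
        (⟨Q, Submonoid.mem_powers _⟩ : Submonoid.powers Q) * algebraMap R _ Q =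
        algebraMap R _ (p b * ∏ b' ∈ s.erase b, q b') := IsLocalization.mk'_spec _ _ _
      rw [← ha Q, ← map_mul, e, ha, ha]
      change _ = χ b * algebraMap R F (∏ b ∈ s, q b)
      rw [← Finset.mul_prod_erase s q hb, map_mul, map_mul, ← mul_assoc, hp]
    exact this hb
  obtain ⟨χ', hχ'⟩ := algHom_factor a hai χ hr
  exact ⟨χ', ha, hχ'⟩

end Ext
end

section
open CategoryTheory AlgebraicGeometry Limits
open scoped TensorProduct
noncomputable section
set_option linter.unusedSectionVars false

section Ext2
open PowerSeries
open scoped Polynomial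
variable {k : Type} [Field k] [CharZero k]
variable {K : Type} [Field K] [Algebra k K]
  [Algebra k⟦X⟧ K] [IsScalarTower k k⟦X⟧ K] [IsFractionRing k⟦X⟧ K]
variable {F : Type} [Field F] [Algebra k F]
  [Algebra k[X] F] [IsScalarTower k k[X] F] [IsFractionRing k[X] F]
variable {Γ : GroupScheme k} (c : IdChart Γ)

/-- extension of the shifted expansion to fraction fields. -/
def tauF (K F : Type) [Field K] [Algebra k K]
  [Algebra k⟦X⟧ K] [IsScalarTower k k⟦X⟧ K] [IsFractionRing k⟦X⟧ K] [Field F] [Algebra k F]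
  [Algebra k[X] F] [IsScalarTower k k[X] F] [IsFractionRing k[X] F] (a : k) : F →ₐ[k] K :=
  fLift (R := k[X]) ((iK k K).comp (tauc a)) ((iK_inj k K).comp (tauc_inj a))

lemma tauF_apply (a : k) (p : k[X]) : tauF K F a (algebraMap k[X] F p) = iK k K (tauc a p) :=
  fLift_apply _ _ p

/-- derivation of the rational function field. -/
def dF (k F : Type) [Field k] [Field F] [Algebra k F]
  [Algebra k[X] F] [IsScalarTower k k[X] F] [IsFractionRing k[X] F] : Derivation k F F :=
  derExt F (Polynomial.derivative' : Derivation k k[X] k[X])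

lemma dF_apply (p : k[X]) : dF k F (algebraMap k[X] F p) = algebraMap k[X] F (Polynomial.derivative p) :=
  derExt_apply _ _

lemma tauF_dF (a : k) (x : F) : dLK k K (tauF K F a x) = tauF K F a (dF k F x) := by
  apply der_map (R := k[X])
  intro r
  rw [tauF_apply, dF_apply, tauF_apply, dLK_iK, dk_tauc]

lemma exists_phiF {B : Type} [CommRing B] [Algebra k B] (φ : B →ₐ[k] k⟦X⟧)
    (hrat : ∀ b, ∃ p q : k[X], q ≠ 0 ∧ polP k q * φ b = polP k p) :
    ∃ φF : B →ₐ[k] F, (tauF K F 1).comp φF = (iK k K).comp φ := by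
  apply algHom_factor _ (tauF K F (1 : k)).injective
  intro b
  obtain ⟨p, q, hq, h⟩ := hrat b
  refine ⟨algebraMap k[X] F (p.comp (Polynomial.X - Polynomial.C 1)) /
    algebraMap k[X] F (q.comp (Polynomial.X - Polynomial.C 1)), ?_⟩
  rw [map_div₀, tauF_apply, tauF_apply, tauc_one_comp, tauc_one_comp, ← h, map_mul, AlgHom.comp_apply]
  have : iK k K (polP k q) ≠ 0 := by
    intro h0
    exact hq (polP_inj (iK_inj k K (h0.trans (by simp))))
  field_simp

lemma IdChart.logder_phiF (lam : k) (v : c.N →ₗ[k] k) (hv : v 1 = 0) (φ : c.B →ₐ[k] k⟦X⟧)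
    (hφ : ∀ b, (1 + C lam * X) * dk k k (φ b) =
        c.act φ ((Algebra.linearMap k k⟦X⟧).comp v) b)
    (φF : c.B →ₐ[k] F) (hF : (tauF K F 1).comp φF = (iK k K).comp φ) (θ : k[X])
    (hθ : θ = 1 + Polynomial.C lam * (Polynomial.X - 1)) :
    c.IsLogDer (dF k F) (c.pt φF) ((LinearMap.mulLeft k (algebraMap k[X] F θ)⁻¹).comp
      ((Algebra.linearMap k F).comp v)) := by
  have hθ' : tauc 1 θ = 1 + C lam * X := by
    have e1 : polP k (Polynomial.C lam) = C lam := Polynomial.coe_C lam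
    have e2 : polP k Polynomial.X = X := Polynomial.coe_X
    rw [hθ, tauc_apply]
    simp [e1, e2]
  have hθ0 : algebraMap k[X] F θ ≠ 0 := by
    intro h0
    have h1 : tauF K F (1 : k) (algebraMap k[X] F θ) = 0 := by rw [h0, map_zero]
    rw [tauF_apply, hθ'] at h1
    have h2 := iK_inj k K (h1.trans (map_zero _).symm)
    have := congr(constantCoeff $h2)
    simp at this
  rw [c.isLogDer_pt _ _ _ (by simp [hv])]
  intro b
  apply mul_left_cancel₀ hθ0
  rw [c.act_mulLeft, mul_inv_cancel_left₀ hθ0]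
  apply (tauF K F (1 : k)).injective
  change tauF K F (1 : k) _ = tauF K F (1 : k) _
  rw [map_mul, ← tauF_dF, tauF_apply, hθ', c.map_act]
  have h1 : tauF K F (1 : k) (φF b) = iK k K (φ b) := congr($hF b)
  rw [h1, dLK_iK, ← map_mul, hφ, c.map_act, hF]
  congr 2
  refine LinearMap.ext fun n => ?_
  simp
  exact (iK k K).commutes (v n)

lemma IdChart.local_ext (v : c.N →ₗ[k] k) 
    (φF : c.B →ₐ[k] F) (θ : k[X])
    (h : c.IsLogDer (dF k F) (c.pt φF) ((LinearMap.mulLeft k (algebraMap k[X] F θ)⁻¹).comp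
      ((Algebra.linearMap k F).comp v))) (a : k) (ha : θ.eval a ≠ 0) :
    ∃ g0 : SpO k k⟦X⟧ ⟶ Γ.G, SpO.map (tauF K F a) ≫ c.pt φF = SpO.map (iK k K) ≫ g0 := by
  have h2 := h.transport c (dLK k K) (tauF K F a) 1 (fun x => by rw [one_mul, tauF_dF])
  apply c.lemmaA h2
  intro n
  refine ⟨(tauc a θ)⁻¹ * C (v n), ?_⟩
  have h0 : constantCoeff (tauc a θ) ≠ 0 := by rwa [tauc_cc]
  have h1 : iK k K (tauc a θ) ≠ 0 := by
    intro h3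
    rw [iK_inj k K (h3.trans (map_zero _).symm)] at h0
    simp at h0
  have h3 : iK k K ((tauc a θ)⁻¹) * iK k K (tauc a θ) = 1 := by
    rw [← map_mul, PowerSeries.inv_mul_cancel _ h0, map_one]
  have h4 : iK k K ((tauc a θ)⁻¹) = (iK k K (tauc a θ))⁻¹ := eq_inv_of_mul_eq_one_left h3
  have h5 : iK k K (C (v n)) = algebraMap k K (v n) := (iK k K).commutes (v n)
  rw [map_mul, h4, h5]
  simp [tauF_apply]

lemma local_den {X : OverR k} (hX : LocallyOfFiniteType X.hom) (p : SpO k F ⟶ X) (a : k)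
    (g0 : SpO k k⟦X⟧ ⟶ X) (h : SpO.map (tauF K F a) ≫ p = SpO.map (iK k K) ≫ g0) :
    ∃ (B : Type) (_ : CommRing B) (_ : Algebra k B) (j : SpO k B ⟶ X) (χ : B →ₐ[k] F),
      Algebra.FiniteType k B ∧ p = SpO.map χ ≫ j ∧
      ∀ b, ∃ q s : k[X], q.eval a ≠ 0 ∧ χ b * algebraMap k[X] F q = algebraMap k[X] F s := by
  obtain ⟨B, _, _, j, hj, hx, hft⟩ := exists_chart X ((SpO.map (ccA k k) ≫ g0).left (⊥ : PrimeSpectrum k))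
  have hr : Set.range (SpO.map (ccA k k) ≫ g0).left ⊆ Set.range j.left := by
    rintro _ ⟨x, rfl⟩
    have : x = (⊥ : PrimeSpectrum k) := Subsingleton.elim (α := PrimeSpectrum k) _ _
    rw [this]
    exact hx
  obtain ⟨ψ0, hψ0⟩ := chart_factor j _ hr
  obtain ⟨ψ, hψ, -⟩ := chart_factor_of_jacobson j g0 (ccA k k) ccA_surj ker_ccA ψ0 hψ0
  obtain ⟨χ, hχ, hχ'⟩ := field_chart j (tauF K F a) p ((iK k K).comp ψ) (by
    rw [h, hψ, SpO.map_comp, Category.assoc])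
  refine ⟨B, _, _, j, χ, hft hX, hχ, fun b => ?_⟩
  have hb : χ b * algebraMap k[X] F (IsFractionRing.den k[X] (χ b)) =
      algebraMap k[X] F (IsFractionRing.num k[X] (χ b)) :=
    IsFractionRing.num_mul_den_eq_num_iff_eq'.2 rfl
  refine ⟨IsFractionRing.den k[X] (χ b), IsFractionRing.num k[X] (χ b), ?_, hb⟩
  intro h0
  have hrel := IsFractionRing.num_den_reduced k[X] (χ b)
  have h1 := congr(tauF K F a $hb)
  have h2 : tauF K F a (χ b) = iK k K (ψ b) := congr($hχ' b)
  rw [map_mul, h2, tauF_apply, tauF_apply, ← map_mul] at h1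
  have h3 := congr(constantCoeff $(iK_inj k K h1))
  rw [map_mul, tauc_cc, tauc_cc, h0, mul_zero] at h3
  have d1 := Polynomial.dvd_iff_isRoot.2 h0
  have d2 := Polynomial.dvd_iff_isRoot.2 h3.symm
  exact Polynomial.not_isUnit_X_sub_C a (hrel d2 d1)

end Ext2
end

section
open CategoryTheory AlgebraicGeometry Limits
open scoped TensorProduct
noncomputable section
set_option linter.unusedSectionVars false

section Gm
open PowerSeries
open scoped Polynomial LaurentPolynomial
variable {k : Type} [Field k] [CharZero k]
variable {K : Type} [Field K] [Algebra k K]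
  [Algebra k⟦X⟧ K] [IsScalarTower k k⟦X⟧ K] [IsFractionRing k⟦X⟧ K]
variable {Γ : GroupScheme k} (c : IdChart Γ)

lemma IdChart.finite_N [Algebra.FiniteType k c.B] : Module.Finite k c.N := by
  rw [Module.finite_iff_krullDimLE_zero, Ring.krullDimLE_zero_iff]
  intro I hI
  have h1 : RingHom.ker c.eN ≤ I := by
    intro x hx
    apply hI.mem_of_pow_mem 2
    have : x ^ 2 ∈ (RingHom.ker c.eN) ^ 2 := Ideal.pow_mem_pow hx 2
    rw [c.ker_eN] at this
    rw [(Ideal.mem_bot).1 this]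
    exact zero_mem _
  have h2 : (RingHom.ker c.eN).IsMaximal := RingHom.ker_isMaximal_of_surjective _ c.eN_surj
  rwa [← h2.eq_of_le hI.ne_top h1]

lemma IdChart.lemmaB [Algebra.FiniteType k c.B] (g : SpO k K ⟶ Γ.G)
    (hg : ¬ ∃ g0, g = SpO.map (iK k K) ≫ g0) :
    ∃ (lam : k) (v : c.N →ₗ[k] k) (φ : c.B →ₐ[k] k⟦X⟧), (lam = 0 ∨ lam = 1) ∧ v 1 = 0 ∧ v ≠ 0 ∧
      (∀ b, constantCoeff (φ b) = c.e b) ∧ (∀ b, (1 + C lam * X) * dk k k (φ b) =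
        c.act φ ((Algebra.linearMap k k⟦X⟧).comp v) b) ∧
      (∀ b, ∃ p q : k[X], q ≠ 0 ∧ polP k q * φ b = polP k p) := by
  have := c.finite_N
  obtain ⟨w, hw⟩ := c.exists_logDer (dLK k K) g
  have hn : ¬ ∀ n, ∃ u, iK k K u = w n := fun h => hg (c.lemmaA hw h)
  obtain ⟨m, u, hm, hu, n, hun⟩ := exists_pole w hn
  obtain ⟨H, h1, h2, h3⟩ := c.lemmaB2 hw m hm u hu
  refine ⟨constantCoeff (X ^ (m - 1) : k⟦X⟧), (ccA k k).toLinearMap.comp u, (mapP (ccA k k)).comp H,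
    ?_, ?_, ?_, h2, h3, ?_⟩
  · rw [map_pow]
    rcases Nat.eq_zero_or_pos (m - 1) with h | h
    · right; rw [h, pow_zero]
    · left; simp; omega
  · obtain ⟨hw1, -⟩ := hw
    have : iK k K (u 1) = iK k K 0 := by rw [hu, hw1, mul_zero, map_zero]
    rw [LinearMap.comp_apply, iK_inj k K this, map_zero]
  · intro h0
    apply hun
    exact congr($h0 n)
  · intro b
    exact c.lemmaB3 (E := FractionRing k⟦X⟧⟦X⟧) (M' := FractionRing K⟦X⟧) (F1 := FractionRing k[X]⟦X⟧)
      m hm H h1 b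

lemma GmO_eq : GmO k = SpO k k[T;T⁻¹] := rfl

lemma isConstant_spO {A : Type} [CommRing A] [Algebra k A] {X : OverR k} (f : SpO k A ⟶ X)
    (e : A →ₐ[k] k) (h : IsConstant f) : ∃ y : SpO k k ⟶ X, f = SpO.map (Algebra.ofId k A) ≫ y := by
  obtain ⟨y, hy⟩ := h
  have he : (SpO.map e).left ≫ (SpO k A).hom = (SpO k k).hom := Over.w _
  have hk : (SpO k k).hom = 𝟙 _ := Spec.map_id _
  refine ⟨Over.homMk y ?_, ?_⟩
  · have h1 := Over.w f
    rw [hy, Category.assoc] at h1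
    have h2 := congr((SpO.map e).left ≫ $h1)
    rw [← Category.assoc, he, hk] at h2
    rw [Category.id_comp] at h2
    rw [hk]
    exact h2
  · ext1
    exact hy

lemma exists_ev {k A : Type} [Field k] [IsAlgClosed k] [CommRing A] [Algebra k A] [Algebra.FiniteType k A]
    (m : Ideal A) [hm : m.IsMaximal] : ∃ ev : A →ₐ[k] k, RingHom.ker ev = m := by
  let _ := Ideal.Quotient.field m
  have := finite_of_finite_type_of_isJacobsonRing k (A ⧸ m)
  have hb := IsAlgClosed.algebraMap_bijective_of_isIntegral (k := k) (K := A ⧸ m)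
  let e : k ≃ₐ[k] (A ⧸ m) := AlgEquiv.ofBijective (Algebra.ofId k _) hb
  refine ⟨e.symm.toAlgHom.comp (Ideal.Quotient.mkₐ k m), ?_⟩
  ext x
  rw [RingHom.mem_ker]
  change e.symm (Ideal.Quotient.mk m x) = 0 ↔ _
  rw [EmbeddingLike.map_eq_zero_iff, Ideal.Quotient.eq_zero_iff_mem]

lemma laurent_frac : IsFractionRing k[X] (FractionRing k[T;T⁻¹]) := by
  have hinj : Function.Injective (algebraMap k[X] (FractionRing k[T;T⁻¹])) := by
    rw [IsScalarTower.algebraMap_eq k[X] k[T;T⁻¹] (FractionRing k[T;T⁻¹])]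
    exact (IsFractionRing.injective k[T;T⁻¹] _).comp Polynomial.toLaurent_injective
  have : FaithfulSMul k[X] (FractionRing k[T;T⁻¹]) := (faithfulSMul_iff_algebraMap_injective _ _).2 hinj
  apply IsFractionRing.of_field
  intro z
  obtain ⟨a, b, hb, rfl⟩ := IsFractionRing.div_surjective (A := k[T;T⁻¹]) z
  obtain ⟨⟨a1, a2⟩, ha⟩ := IsLocalization.surj (Submonoid.powers (Polynomial.X : k[X])) a
  obtain ⟨⟨b1, b2⟩, hb'⟩ := IsLocalization.surj (Submonoid.powers (Polynomial.X : k[X])) b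
  have ha2 : algebraMap k[X] (FractionRing k[T;T⁻¹]) a2 ≠ 0 := by
    obtain ⟨_, n, rfl⟩ := a2
    rw [Ne, FaithfulSMul.algebraMap_eq_zero_iff]
    simp
  have hb2 : algebraMap k[X] (FractionRing k[T;T⁻¹]) b2 ≠ 0 := by
    obtain ⟨_, n, rfl⟩ := b2
    rw [Ne, FaithfulSMul.algebraMap_eq_zero_iff]
    simp
  have hb0 : algebraMap k[T;T⁻¹] (FractionRing k[T;T⁻¹]) b ≠ 0 := by
    rw [Ne, FaithfulSMul.algebraMap_eq_zero_iff]
    exact nonZeroDivisors.ne_zero hb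
  have h1 := congr(algebraMap _ (FractionRing k[T;T⁻¹]) $ha)
  have h2 := congr(algebraMap _ (FractionRing k[T;T⁻¹]) $hb')
  rw [map_mul, ← IsScalarTower.algebraMap_apply, ← IsScalarTower.algebraMap_apply] at h1 h2
  refine ⟨a1 * b2, b1 * a2, ?_⟩
  rw [map_mul, map_mul, ← h1, ← h2]
  field_simp

lemma exists_Gm_aux [IsAlgClosed k] {F : Type} [Field F] [Algebra k F]
    [Algebra k[X] F] [IsScalarTower k k[X] F] [IsFractionRing k[X] F]
    [Algebra k[T;T⁻¹] F] [IsScalarTower k k[T;T⁻¹] F] [IsFractionRing k[T;T⁻¹] F]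
    [IsScalarTower k[X] k[T;T⁻¹] F] (hft : LocallyOfFiniteType Γ.G.hom)
    [IsSeparated Γ.G.hom] (lam : k) (v : c.N →ₗ[k] k) (φ : c.B →ₐ[k] k⟦X⟧) (hlam : lam = 0 ∨ lam = 1)
    (hv1 : v 1 = 0) (hv : v ≠ 0) (hφe : ∀ b, constantCoeff (φ b) = c.e b)
    (hφ : ∀ b, (1 + C lam * X) * dk k k (φ b) = c.act φ ((Algebra.linearMap k k⟦X⟧).comp v) b)
    (hrat : ∀ b, ∃ p q : k[X], q ≠ 0 ∧ polP k q * φ b = polP k p)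
    (φF : c.B →ₐ[k] F) (hφF : (tauF K F 1).comp φF = (iK k K).comp φ) :
    ∃ f : GmO k ⟶ Γ.G, ¬ IsConstant f := by
  have hlog := c.logder_phiF lam v hv1 φ hφ φF hφF _ rfl
  set θ : k[X] := 1 + Polynomial.C lam * (Polynomial.X - 1) with hθ
  have hθe (a : k) (ha : a ≠ 0) : θ.eval a ≠ 0 := by
    rcases hlam with rfl | rfl <;> simp [hθ, ha]
  obtain ⟨P, hP⟩ := glue_lemma (R := k[T;T⁻¹]) (F := F) (c.pt φF) (by
    intro x
    obtain ⟨mx, hmx, hle⟩ := x.asIdeal.exists_le_maximal x.2.ne_top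
    obtain ⟨ev, hev⟩ : ∃ ev : k[T;T⁻¹] →ₐ[k] k, RingHom.ker ev = mx := exists_ev mx
    let a := ev (LaurentPolynomial.T 1)
    have ha : a ≠ 0 := by
      intro h0
      have h1 : ev (LaurentPolynomial.T 1 * LaurentPolynomial.T (-1)) = 0 := by
        rw [map_mul]
        change a * _ = 0
        rw [h0, zero_mul]
      rw [← LaurentPolynomial.T_add] at h1
      simp at h1
    have hpe (q : k[X]) : ev (algebraMap k[X] k[T;T⁻¹] q) = q.eval a := by
      have : IsScalarTower k k[X] k[T;T⁻¹] := IsScalarTower.of_algebraMap_eq (fun r => by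
        simp [LaurentPolynomial.algebraMap_eq_toLaurent])
      have h1 : ev.comp (IsScalarTower.toAlgHom k k[X] k[T;T⁻¹]) = Polynomial.aeval a := by
        apply Polynomial.algHom_ext
        simp [LaurentPolynomial.algebraMap_eq_toLaurent, a]
      have h2 := congr($h1 q)
      rwa [Polynomial.coe_aeval_eq_eval] at h2
    obtain ⟨g0, hg0⟩ := c.local_ext (K := K) v φF θ hlog a (hθe a ha)
    obtain ⟨B, _, _, j, χ, hBft, hχ, hden⟩ := local_den hft _ a g0 hg0
    obtain ⟨q, hq, α, χ', hα, hχ'⟩ := spread (R := k[T;T⁻¹]) χ mx (by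
      intro b
      obtain ⟨q, s, hq, hs⟩ := hden b
      refine ⟨algebraMap _ _ q, ?_, algebraMap _ _ s, ?_⟩
      · rw [← hev, RingHom.mem_ker, hpe]
        exact hq
      · rw [← IsScalarTower.algebraMap_apply, ← IsScalarTower.algebraMap_apply, hs])
    refine ⟨q, fun h => hq (hle h), SpO.map χ' ≫ j, α, hα, ?_⟩
    rw [hχ, ← hχ', SpO.map_comp, Category.assoc])
  refine ⟨P, fun hconst => ?_⟩
  obtain ⟨ev⟩ : Nonempty (k[T;T⁻¹] →ₐ[k] k) := by
    obtain ⟨m, hm⟩ := Ideal.exists_maximal k[T;T⁻¹]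
    obtain ⟨ev, -⟩ := exists_ev (k := k) m
    exact ⟨ev⟩
  obtain ⟨y, hy⟩ := isConstant_spO (A := k[T;T⁻¹]) P ev hconst
  have := c.oi
  obtain ⟨χ, -, hχ⟩ := field_chart c.j (Algebra.ofId k K) y ((iK k K).comp φ) (by
    rw [← hφF, SpO.map_comp, Category.assoc]
    change _ = _ ≫ c.pt φF
    rw [← hP, hy, ← Category.assoc, ← Category.assoc, ← SpO.map_comp, ← SpO.map_comp]
    congr 2
    ext)
  have hφc : φ = (Algebra.ofId k k⟦X⟧).comp c.e := by
    have h1 : φ = (Algebra.ofId k k⟦X⟧).comp χ := by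
      ext1 b
      apply iK_inj k K
      have := congr($hχ b)
      refine this.symm.trans ?_
      exact ((iK k K).commutes (χ b)).symm
    have h2 : χ = c.e := by
      ext1 b
      rw [← hφe, h1]
      simp [Algebra.ofId_apply]
    rw [h1, h2]
  apply hv
  refine LinearMap.ext fun n => ?_
  obtain ⟨b, rfl⟩ := Ideal.Quotient.mk_surjective n
  have h1 := hφ b
  rw [hφc, c.act_e] at h1
  have h2 := congr(constantCoeff $h1)
  simp [Algebra.ofId_apply] at h2
  rw [← h2, ← coeff_zero_eq_constantCoeff_apply, dk_coeff, coeff_C]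
  simp

theorem exists_Gm [IsAlgClosed k] (Γ : GroupScheme k) (hft : LocallyOfFiniteType Γ.G.hom)
    [IsSeparated Γ.G.hom] (g : SpO k K ⟶ Γ.G)
    (hg : ¬ ∃ g0, g = SpO.map (iK k K) ≫ g0) : ∃ f : GmO k ⟶ Γ.G, ¬ IsConstant f := by
  obtain ⟨c, hc⟩ := exists_idChart Γ hft
  obtain ⟨lam, v, φ, hlam, hv1, hv, hφe, hφ, hrat⟩ := c.lemmaB g hg
  have := laurent_frac (k := k)
  have : IsScalarTower k k[X] k[T;T⁻¹] := IsScalarTower.of_algebraMap_eq (fun r => by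
    simp [LaurentPolynomial.algebraMap_eq_toLaurent])
  have : IsScalarTower k k[X] (FractionRing k[T;T⁻¹]) := IsScalarTower.to₁₂₄ k k[X] k[T;T⁻¹] _
  obtain ⟨φF, hφF⟩ := exists_phiF (K := K) (F := FractionRing k[T;T⁻¹]) φ hrat
  exact exists_Gm_aux c (K := K) (F := FractionRing k[T;T⁻¹]) hft lam v φ hlam hv1 hv hφe hφ hrat φF hφF
end Gm
end

section
open CategoryTheory AlgebraicGeometry Limits
open scoped TensorProduct
noncomputable section
set_option linter.unusedSectionVars false

section dvrExpand
variable {k R : Type} [Field k] [CommRing R] [IsDomain R] [Algebra k R]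

theorem dvr_expand (p : R) (hp : p ≠ 0) (ev : R →ₐ[k] k) (hev : RingHom.ker ev = Ideal.span {p})
    (hI : ∀ r : R, (∀ n : ℕ, p ^ n ∣ r) → r = 0) :
    ∃ T : R →ₐ[k] PowerSeries k, Function.Injective T ∧
      ∀ r, PowerSeries.constantCoeff (T r) = ev r := by
  have h1 : ∀ r : R, ∃ q, r - algebraMap k R (ev r) = p * q := by
    intro r
    have : r - algebraMap k R (ev r) ∈ RingHom.ker ev := by
      rw [RingHom.mem_ker]; simp
    rw [hev, Ideal.mem_span_singleton] at this
    exact this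
  choose q hq using h1
  have hqa : ∀ r s, q (r + s) = q r + q s := by
    intro r s
    apply mul_left_cancel₀ hp
    rw [mul_add, ← hq, ← hq, ← hq, map_add, map_add]; ring
  have hqm : ∀ r s, q (r * s) = q r * s + algebraMap k R (ev r) * q s := by
    intro r s
    apply mul_left_cancel₀ hp
    have e : p * (q r * s + algebraMap k R (ev r) * q s) =
      (p * q r) * s + algebraMap k R (ev r) * (p * q s) := by ring
    rw [e, ← hq, ← hq, ← hq, map_mul, map_mul]; ring
  have hqc : ∀ c, q (algebraMap k R c) = 0 := by
    intro c
    apply mul_left_cancel₀ hp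
    rw [← hq]; simp
  have hq0 : q 0 = 0 := by simpa using hqc 0
  have hit0 : ∀ n, q^[n] 0 = 0 := fun n => Function.iterate_fixed hq0 n
  have hita : ∀ n r s, q^[n] (r + s) = q^[n] r + q^[n] s := by
    intro n
    induction n with
    | zero => intro r s; rfl
    | succ n ih => intro r s; simp only [Function.iterate_succ, Function.comp, hqa, ih]
  let T0 : R → PowerSeries k := fun r => PowerSeries.mk fun n => ev (q^[n] r)
  have hT0 : ∀ r n, PowerSeries.coeff n (T0 r) = ev (q^[n] r) := fun r n =>
    PowerSeries.coeff_mk _ _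
  clear_value T0
  have hTs : ∀ r n, PowerSeries.coeff (n + 1) (T0 r) = PowerSeries.coeff n (T0 (q r)) := by
    intro r n; rw [hT0, hT0]; rfl
  have hTa : ∀ r s, T0 (r + s) = T0 r + T0 s := by
    intro r s; ext n; simp [hT0, hita]
  have hTc : ∀ c, T0 (algebraMap k R c) = algebraMap k (PowerSeries k) c := by
    intro c; ext n
    rw [PowerSeries.algebraMap_apply, PowerSeries.coeff_C]
    cases n with
    | zero => simp [hT0]
    | succ n => rw [hTs, hqc, hT0, hit0]; simp
  have hTd : ∀ r, T0 r = PowerSeries.C (ev r) + PowerSeries.X * T0 (q r) := by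
    intro r; ext n
    cases n with
    | zero => simp [hT0]
    | succ n => rw [hTs]; simp [PowerSeries.coeff_succ_X_mul, PowerSeries.coeff_C]
  have hTcm : ∀ c s, T0 (algebraMap k R c * s) = PowerSeries.C c * T0 s := by
    intro c s; ext n
    rw [PowerSeries.coeff_C_mul]
    induction n generalizing s with
    | zero => simp [hT0]
    | succ n ih =>
      rw [hTs, hqm, hqc, zero_mul, zero_add, hTs]
      simpa using ih (q s)
  have hTm : ∀ r s, T0 (r * s) = T0 r * T0 s := by
    intro r s; ext n
    induction n generalizing r s with
    | zero => simp [hT0, PowerSeries.coeff_mul]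
    | succ n ih =>
      rw [hTs, hqm, hTa, map_add, ih, hTcm, hTd r, add_mul, map_add, mul_assoc,
        PowerSeries.coeff_succ_X_mul, PowerSeries.coeff_C_mul, PowerSeries.coeff_C_mul, hTs s]
      ring
  refine ⟨{ toFun := T0, map_one' := ?_, map_mul' := hTm, map_zero' := ?_, map_add' := hTa,
            commutes' := hTc }, ?_, ?_⟩
  · simpa using hTc 1
  · simpa using hTc 0
  · rw [injective_iff_map_eq_zero]
    intro r hr
    change T0 r = 0 at hr
    apply hI
    intro n
    induction n generalizing r with
    | zero => simp
    | succ n ih =>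
      have h0 : ev r = 0 := by
        have := hT0 r 0; rw [hr] at this; simpa using this.symm
      have h1 : T0 (q r) = 0 := by
        ext m; rw [← hTs, hr]; simp
      obtain ⟨t, ht⟩ := ih (q r) h1
      have := hq r
      rw [h0, map_zero, sub_zero, ht] at this
      exact ⟨t, by rw [this]; ring⟩
  · intro r
    change PowerSeries.constantCoeff (T0 r) = ev r
    rw [← PowerSeries.coeff_zero_eq_constantCoeff_apply, hT0]; rfl
end dvrExpand
end

section
open CategoryTheory AlgebraicGeometry Limits
open scoped TensorProduct
noncomputable section
set_option linter.unusedSectionVars false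

section curveDvr
variable {k A : Type} [Field k] [CharZero k] [IsAlgClosed k] [CommRing A] [IsDomain A] [Algebra k A]
  [Algebra.FiniteType k A]

theorem fin_intClosure (L : Type) [Field L] [Algebra A L] [IsFractionRing A L] [Algebra k L]
    [IsScalarTower k A L] : Algebra.FiniteType k (integralClosure A L) ∧
    IsNoetherianRing (integralClosure A L) := by
  obtain ⟨s, g, hg, hfin⟩ := exists_finite_inj_algHom_of_fg k A
  let M := MvPolynomial (Fin s) k
  let _ : Algebra M A := g.toRingHom.toAlgebra
  have hMA : Module.Finite M A := hfin
  let _ : Algebra M L := ((algebraMap A L).comp g.toRingHom).toAlgebra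
  have : IsScalarTower M A L := IsScalarTower.of_algebraMap_eq fun _ => rfl
  have hinj : Function.Injective (algebraMap M L) :=
    (IsFractionRing.injective A L).comp hg
  have : FaithfulSMul M A := (faithfulSMul_iff_algebraMap_injective M A).mpr hg
  have : FaithfulSMul M L := (faithfulSMul_iff_algebraMap_injective M L).mpr hinj
  let K := FractionRing M
  let _ : Algebra K L := FractionRing.liftAlgebra M L
  have : IsScalarTower M K L := FractionRing.isScalarTower_liftAlgebra M L
  have : Algebra.IsIntegral M A := inferInstance
  have : FiniteDimensional K L := by
    exact Module.Finite.of_isLocalization M A (nonZeroDivisors M)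
  have : CharZero M := inferInstance
  have : CharZero K := inferInstance
  have : Algebra.IsSeparable K L := inferInstance
  let C := integralClosure A L
  have : IsScalarTower M C L := IsScalarTower.of_algebraMap_eq fun _ => rfl
  have : IsIntegralClosure C M L := by
    refine ⟨Subtype.val_injective, fun {x} => ⟨fun h => ⟨⟨x, h.tower_top⟩, rfl⟩, ?_⟩⟩
    rintro ⟨y, rfl⟩
    exact isIntegral_trans (R := M) _ y.2
  have h1 : Module.Finite M C := IsIntegralClosure.finite M K L C
  have h2 : IsNoetherianRing C := IsIntegralClosure.isNoetherianRing M K L C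
  refine ⟨?_, h2⟩
  have : IsScalarTower k M C := IsScalarTower.of_algebraMap_eq fun x => by
    apply Subtype.ext
    change algebraMap k L x = algebraMap A L (g (algebraMap k M x))
    rw [g.commutes, ← IsScalarTower.algebraMap_apply]
  exact Algebra.FiniteType.trans (S := M) inferInstance inferInstance

theorem exists_intClosure_aux (L : Type) [Field L] [Algebra A L] [IsFractionRing A L] [Algebra k L]
    [IsScalarTower k A L] : ∃ (C : Type) (_ : CommRing C) (_ : IsDomain C) (_ : Algebra k C)
    (i : A →ₐ[k] C), Function.Injective i ∧ i.IsIntegral ∧ IsIntegrallyClosed C ∧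
    Algebra.FiniteType k C ∧ IsNoetherianRing C := by
  have hA := fin_intClosure (k := k) (A := A) L
  have hic : IsIntegrallyClosed (integralClosure A L) :=
    integralClosure.isIntegrallyClosedOfFiniteExtension L
  have hi := IsFractionRing.injective A L
  let C := integralClosure A L
  refine ⟨C, inferInstance, inferInstance, inferInstance, IsScalarTower.toAlgHom k A C, ?_, ?_,
    hic, hA.1, hA.2⟩
  · intro a b hab
    exact hi (congrArg Subtype.val hab)
  · exact (inferInstance : Algebra.IsIntegral A C).isIntegral

theorem exists_intClosure : ∃ (C : Type) (_ : CommRing C) (_ : IsDomain C) (_ : Algebra k C)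
    (i : A →ₐ[k] C), Function.Injective i ∧ i.IsIntegral ∧ IsIntegrallyClosed C ∧
    Algebra.FiniteType k C ∧ IsNoetherianRing C :=
  exists_intClosure_aux (FractionRing A)

theorem curve_dvr (n : Ideal A) [n.IsMaximal] (hn : n ≠ ⊥)
    (h1 : ∀ q : Ideal A, q.IsPrime → q ≠ ⊥ → q ≤ n → q = n) :
    ∃ T : A →ₐ[k] PowerSeries k, Function.Injective T ∧
      ∀ a ∈ n, PowerSeries.constantCoeff (T a) = 0 := by
  obtain ⟨C, _, _, _, ι, hCi, hIntg, hicl, hC1, hC2⟩ := exists_intClosure (k := k) (A := A)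
  let _ : Algebra A C := ι.toRingHom.toAlgebra
  have : IsScalarTower k A C := IsScalarTower.of_algebraMap_eq fun x => (ι.commutes x).symm
  have : FaithfulSMul A C := (faithfulSMul_iff_algebraMap_injective A C).mpr hCi
  have hIntg : Algebra.IsIntegral A C := ⟨hIntg⟩
  change Function.Injective (algebraMap A C) at hCi
  obtain ⟨N, hN1, hN2⟩ := Ideal.exists_ideal_over_maximal_of_isIntegral (S := C) n
    (by rw [(RingHom.injective_iff_ker_eq_bot _).mp hCi]; exact bot_le)
  obtain ⟨ev, hev⟩ := exists_ev (k := k) N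
  let R := Localization.AtPrime N
  have : IsNoetherianRing R := IsLocalization.isNoetherianRing N.primeCompl R inferInstance
  have : IsDomain R := IsLocalization.isDomain_localization N.primeCompl_le_nonZeroDivisors
  have : IsIntegrallyClosed R :=
    isIntegrallyClosed_of_isLocalization R N.primeCompl N.primeCompl_le_nonZeroDivisors
  have hRi : Function.Injective (algebraMap C R) :=
    IsLocalization.injective R N.primeCompl_le_nonZeroDivisors
  have hP : ∀ P : Ideal R, P ≠ ⊥ → P.IsPrime → P = IsLocalRing.maximalIdeal R := by
    intro P hPb hPp
    have hq : (P.comap (algebraMap C R)) ≤ N := by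
      refine le_trans ?_ (IsLocalization.AtPrime.under_maximalIdeal R N).le
      exact Ideal.comap_mono (IsLocalRing.le_maximalIdeal hPp.ne_top)
    have hq0 : (P.comap (algebraMap C R)) ≠ ⊥ := by
      intro h
      apply hPb
      rw [← IsLocalization.map_under N.primeCompl R P]
      change Ideal.map _ (P.comap (algebraMap C R)) = _
      rw [h, Ideal.map_bot]
    have hpr : (P.comap (algebraMap C R)).IsPrime := inferInstance
    set Q := P.comap (algebraMap C R) with hQ
    have h2 : Q.comap (algebraMap A C) = n := by
      apply h1 _ inferInstance
      · exact fun h => hq0 (Ideal.eq_bot_of_comap_eq_bot h)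
      · rw [← hN2]; exact Ideal.comap_mono hq
    have h3 : Q.IsMaximal := by
      apply Ideal.isMaximal_of_isIntegral_of_isMaximal_comap (R := A) Q
      rw [h2]; infer_instance
    have h4 : Q = N := h3.eq_of_le hN1.ne_top hq
    rw [← IsLocalization.map_under N.primeCompl R P]
    change Ideal.map _ Q = _
    rw [h4]
    exact Localization.AtPrime.map_eq_maximalIdeal
  have hpr : (IsLocalRing.maximalIdeal R).IsPrincipal :=
by
    have h34 := (tfae_of_isNoetherianRing_of_isLocalRing_of_isDomain R).out 3 4
    exact h34.mp ⟨inferInstance, hP⟩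
  obtain ⟨p, hp⟩ := hpr
  rw [Ideal.submodule_span_eq] at hp
  have hunit : ∀ y : N.primeCompl, IsUnit (ev y) := by
    intro y
    rw [isUnit_iff_ne_zero]
    intro h
    exact y.2 ((SetLike.ext_iff.mp hev _).mp (RingHom.mem_ker.mpr h))
  let ev' : R →ₐ[k] k := IsLocalization.liftAlgHom (M := N.primeCompl) (f := ev) hunit
  have hev' : ∀ c, ev' (algebraMap C R c) = ev c := fun c => IsLocalization.lift_eq _ _
  clear_value ev'
  have hker : RingHom.ker ev' = IsLocalRing.maximalIdeal R := by
    apply IsLocalRing.eq_maximalIdeal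
    apply RingHom.ker_isMaximal_of_surjective
    intro c; exact ⟨algebraMap k R c, by simp⟩
  obtain ⟨a, han, ha0⟩ := Submodule.exists_mem_ne_zero_of_ne_bot hn
  have hevn : ∀ a ∈ n, ev' (algebraMap C R (algebraMap A C a)) = 0 := by
    intro a ha
    rw [hev']
    have : algebraMap A C a ∈ N := by rw [← hN2] at ha; exact ha
    exact (SetLike.ext_iff.mp hev _).mpr this
  have hp0 : p ≠ 0 := by
    rintro rfl
    have : algebraMap C R (algebraMap A C a) ∈ RingHom.ker ev' := hevn a han
    rw [hker, hp] at this
    simp only [Ideal.span_singleton_zero, Ideal.mem_bot] at this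
    exact ha0 (hCi (hRi (by rw [this, map_zero, map_zero])))
  obtain ⟨T, hT, hTc⟩ := dvr_expand p hp0 ev' (hker.trans hp) (by
    intro r hr
    have : r ∈ (⨅ i : ℕ, (Ideal.span {p}) ^ i : Ideal R) := by
      rw [Submodule.mem_iInf]
      intro i
      rw [Ideal.span_singleton_pow, Ideal.mem_span_singleton]; exact hr i
    rw [Ideal.iInf_pow_eq_bot_of_isLocalRing] at this
    · exact this
    · rw [← hp]; exact Ideal.IsPrime.ne_top')
  have : IsScalarTower k C R := inferInstance
  refine ⟨(T.comp (IsScalarTower.toAlgHom k C R)).comp (IsScalarTower.toAlgHom k A C), ?_, ?_⟩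
  · exact (hT.comp hRi).comp hCi
  · intro a ha
    change PowerSeries.constantCoeff (T _) = 0
    rw [hTc]; exact hevn a ha
end curveDvr
end

section
open CategoryTheory AlgebraicGeometry Limits
open scoped TensorProduct
noncomputable section
set_option linter.unusedSectionVars false

theorem height_one_aux {A : Type} [CommRing A] [IsDomain A] [IsNoetherianRing A] (n : Ideal A)
    [n.IsPrime] (t : A) (ht : t ≠ 0)
    (h : ∀ q : Ideal A, q.IsPrime → q ≠ ⊥ → q ≤ n → t ∈ q)
    (q : Ideal A) (hq : q.IsPrime) (hq0 : q ≠ ⊥) (hqn : q ≤ n) : q = n := by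
  by_contra hne
  have hlt : q < n := lt_of_le_of_ne hqn hne
  have hfin := Ideal.finite_minimalPrimes_of_isNoetherianRing A (Ideal.span {t})
  have h1 : ¬ ((n : Set A) ⊆ ⋃ P ∈ (Ideal.span {t}).minimalPrimes, (P : Set A)) := by
    intro hsub
    obtain ⟨P, hP, hnP⟩ := (n.subset_union_prime_finite hfin (f := id) 0 0
      fun _ h _ _ ↦ h.isPrime).1 hsub
    have : q < P := lt_of_lt_of_le hlt hnP
    exact absurd (hP.2 ⟨hq, by rw [Ideal.span_singleton_le_iff_mem]; exact h q hq hq0 hqn⟩ this.le)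
      (not_le_of_gt this)
  rw [Set.not_subset] at h1
  obtain ⟨y, hyn, hy⟩ := h1
  simp only [Set.mem_iUnion, not_exists] at hy
  obtain ⟨q', hq', hq'n⟩ := Ideal.exists_minimalPrimes_le (I := Ideal.span {y}) (J := n)
    (by rw [Ideal.span_singleton_le_iff_mem]; exact hyn)
  have htn : t ∈ n := hqn (h q hq hq0 hqn)
  have hy0 : y ≠ 0 := by
    rintro rfl
    obtain ⟨P, hP, -⟩ := Ideal.exists_minimalPrimes_le (I := Ideal.span {t}) (J := n)
      (by rw [Ideal.span_singleton_le_iff_mem]; exact htn)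
    exact hy P hP P.zero_mem
  have hpr : q'.IsPrime := hq'.isPrime
  have hyq' : y ∈ q' := hq'.1.2 (Ideal.mem_span_singleton_self y)
  have hq'0 : q' ≠ ⊥ := by
    rintro rfl; exact hy0 hyq'
  have htq' := h q' hpr hq'0 hq'n
  obtain ⟨P, hP, hPq⟩ := Ideal.exists_minimalPrimes_le (I := Ideal.span {t}) (J := q')
    (by rw [Ideal.span_singleton_le_iff_mem]; exact htq')
  have hPpr : P.IsPrime := hP.isPrime
  have hPlt : P < q' := lt_of_le_of_ne hPq (by rintro rfl; exact hy P hP hyq')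
  have hP0 : ⊥ < P := bot_lt_iff_ne_bot.mpr (by
    rintro rfl; exact ht (hP.1.2 (Ideal.mem_span_singleton_self t)))
  have hht := Ideal.height_le_one_of_isPrincipal_of_mem_minimalPrimes (Ideal.span {y}) q' hq'
  have hb : (⊥ : Ideal A).IsPrime := Ideal.isPrime_bot
  have e1 := Ideal.height_add_one_le_of_lt_of_isPrime hP0
  have e2 := Ideal.height_add_one_le_of_lt_of_isPrime hPlt
  have e3 : (0 + 1 + 1 : ℕ∞) ≤ 1 := by
    refine le_trans ?_ (e2.trans hht)
    gcongr
    refine le_trans ?_ e1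
    gcongr
    exact zero_le
  norm_num at e3

section
variable {k A : Type} [Field k] [CharZero k] [IsAlgClosed k] [CommRing A] [IsDomain A] [Algebra k A]
  [Algebra.FiniteType k A]
theorem exists_curve (t c : A) (ht : t ≠ 0) (hct : c ∣ t) (hc : ¬ IsUnit c) :
    ∃ T : A →ₐ[k] PowerSeries k, T t ≠ 0 ∧ PowerSeries.constantCoeff (T c) = 0 := by
  have : IsNoetherianRing A := Algebra.FiniteType.isNoetherianRing k A
  obtain ⟨p, ⟨hp1, hp2, hp3⟩, hmax⟩ := set_has_maximal_iff_noetherian.mpr (inferInstance :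
      IsNoetherian A A) {p : Ideal A | p.IsPrime ∧ t ∉ p ∧ p ⊔ Ideal.span {c} ≠ ⊤}
    ⟨⊥, Ideal.isPrime_bot, ht, by rwa [bot_sup_eq, Ne, Ideal.span_singleton_eq_top]⟩
  obtain ⟨n', hn', hle⟩ := Ideal.exists_le_maximal _ hp3
  let π := Ideal.Quotient.mkₐ k p
  have hπ : Function.Surjective π := Ideal.Quotient.mkₐ_surjective k p
  have hpn : p ≤ n' := le_sup_left.trans hle
  have hcn : c ∈ n' := hle (Ideal.mem_sup_right (Ideal.mem_span_singleton_self c))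
  have hker : RingHom.ker π = p := Ideal.Quotient.mkₐ_ker k p
  have hcm : (n'.map π).comap π = n' := by
    rw [Ideal.comap_map_of_surjective _ hπ]
    refine sup_eq_left.mpr ?_
    change RingHom.ker π ≤ n'
    rw [hker]; exact hpn
  have hnm : (n'.map π).IsMaximal := by
    refine (Ideal.map_eq_top_or_isMaximal_of_surjective π hπ hn').resolve_left ?_
    intro h
    rw [h, Ideal.comap_top] at hcm
    exact hn'.ne_top hcm.symm
  have ht0 : π t ≠ 0 := by
    intro h; apply hp2; rw [← hker]; exact h
  have hc0 : π c ≠ 0 := by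
    intro h; obtain ⟨d, rfl⟩ := hct; exact ht0 (by rw [map_mul, h, zero_mul])
  have : Algebra.FiniteType k (A ⧸ p) := Algebra.FiniteType.of_surjective π hπ
  have : IsNoetherianRing (A ⧸ p) := inferInstance
  have key := height_one_aux (n'.map π) (π t) ht0 (by
    intro q hq hq0 hqn
    by_contra htq
    refine hmax (q.comap π) ⟨inferInstance, htq, ?_⟩ ?_
    · intro htop
      apply hn'.ne_top
      rw [eq_top_iff, ← htop]
      refine sup_le ?_ ((Ideal.span_singleton_le_iff_mem _).mpr hcn)
      rw [← hcm]; exact Ideal.comap_mono hqn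
    · refine lt_of_le_of_ne ?_ ?_
      · intro x hx; change π x ∈ q
        rw [show π x = 0 from (SetLike.ext_iff.mp hker x).mpr hx]; exact q.zero_mem
      · intro h
        apply hq0
        rw [← Ideal.map_comap_of_surjective π hπ q, ← h]
        exact Ideal.map_eq_bot_iff_le_ker _ |>.mpr hker.ge)
  obtain ⟨T, hT, hTc⟩ := curve_dvr (k := k) (n'.map π) (by
    intro h
    have : π c ∈ n'.map π := Ideal.mem_map_of_mem _ hcn
    rw [h] at this; exact hc0 this) key
  refine ⟨T.comp π, ?_, hTc _ (Ideal.mem_map_of_mem _ hcn)⟩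
  change T (π t) ≠ 0
  rwa [Ne, map_eq_zero_iff T hT]
end
end

section
open CategoryTheory AlgebraicGeometry Limits
open scoped TensorProduct
noncomputable section
set_option linter.unusedSectionVars false

section arcs
variable {k : Type} [Field k]

lemma spO_ext {A F : Type} [CommRing A] [IsDomain A] [Algebra k A] [Field F] [Algebra k F]
    (ι : A →ₐ[k] F) (hι : Function.Injective ι) {X : OverR k} [IsSeparated X.hom]
    (f g : SpO k A ⟶ X) (h : SpO.map ι ≫ f = SpO.map ι ≫ g) : f = g := by
  ext1
  have : IsDominant (SpO.map ι).left := by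
    apply dominant_of_openImm (SpO.map ι).left (𝟙 _) (⊥ : PrimeSpectrum F)
    intro y
    rw [Category.comp_id, SpO.map_apply]
    refine (PrimeSpectrum.le_iff_specializes _ (y : PrimeSpectrum A)).mp ?_
    intro r hr
    have : ι r = 0 := hr
    rw [hι (this.trans (map_zero _).symm)]
    exact zero_mem _
  have : IsReduced (SpO k A).left := inferInstanceAs (IsReduced (Spec (.of A)))
  refine ext_of_isDominant_of_isSeparated X.hom ?_ (SpO.map ι).left congr(($h).left)
  rw [Over.w f, Over.w g]

lemma exists_dvd_all {O J : Type} [CommRing O] [IsDomain O] [ValuationRing O] [Finite J] [Nonempty J]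
    (c : J → O) : ∃ x, ∀ y, c x ∣ c y := by
  classical
  have := Fintype.ofFinite J
  have key : ∀ s : Finset J, s.Nonempty → ∃ x ∈ s, ∀ y ∈ s, c x ∣ c y := by
    intro s hs
    induction hs using Finset.Nonempty.cons_induction with
    | singleton a => exact ⟨a, by simp, by simp⟩
    | cons a s ha hs ih =>
      obtain ⟨x, hx, h⟩ := ih
      rcases ValuationRing.dvd_total (c x) (c a) with h1 | h1
      · refine ⟨x, by simp [hx], fun y hy => ?_⟩
        rcases Finset.mem_cons.mp hy with rfl | hy
        · exact h1
        · exact h y hy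
      · refine ⟨a, by simp, fun y hy => ?_⟩
        rcases Finset.mem_cons.mp hy with rfl | hy
        · exact dvd_rfl
        · exact h1.trans (h y hy)
  obtain ⟨x, -, h⟩ := key Finset.univ Finset.univ_nonempty
  exact ⟨x, fun y => h y (Finset.mem_univ y)⟩

variable [CharZero k] [IsAlgClosed k]
variable (K : Type) [Field K] [Algebra k K] [Algebra (PowerSeries k) K]
  [IsScalarTower k (PowerSeries k) K] [IsFractionRing (PowerSeries k) K]

lemma arc_alg {O F J : Type} [CommRing O] [IsDomain O] [ValuationRing O] [Algebra k O]
    [Field F] [Algebra k F] [Algebra O F] [IsScalarTower k O F] [IsFractionRing O F]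
    [Finite J] [Nonempty J] (B : J → Type) [∀ x, CommRing (B x)] [∀ x, Algebra k (B x)]
    [∀ x, Algebra.FiniteType k (B x)] (χ : ∀ x, B x →ₐ[k] F) (b : ∀ x, B x)
    (hb : ∀ x, ¬ ∃ o, algebraMap O F o = χ x (b x)) :
    ∃ (A : Type) (_ : CommRing A) (_ : IsDomain A) (_ : Algebra k A) (ι : A →ₐ[k] F)
      (χ' : ∀ x, B x →ₐ[k] A) (T : A →ₐ[k] K), Function.Injective ι ∧
      (∀ x, ι.comp (χ' x) = χ x) ∧ ∀ x, ¬ ∃ u, iK k K u = T (χ' x (b x)) := by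
  classical
  have hOF := IsFractionRing.injective O F
  have h1 : ∀ x, ∃ c : O, algebraMap O F c * χ x (b x) = 1 := by
    intro x
    have hne : χ x (b x) ≠ 0 := fun h => hb x ⟨0, by rw [h, map_zero]⟩
    rcases ValuationRing.isInteger_or_isInteger O (χ x (b x)) with h | h
    · exact absurd h (hb x)
    · obtain ⟨c, hc⟩ := h
      exact ⟨c, by rw [hc, inv_mul_cancel₀ hne]⟩
  choose c hc using h1
  have hcu : ∀ x, ¬ IsUnit (c x) := by
    intro x hx
    obtain ⟨d, hd⟩ := hx.exists_right_inv
    refine hb x ⟨d, ?_⟩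
    have h2 := congr(algebraMap O F $hd)
    rw [map_mul, map_one] at h2
    have h3 : algebraMap O F (c x) ≠ 0 := left_ne_zero_of_mul_eq_one h2
    exact mul_left_cancel₀ h3 (h2.trans (hc x).symm)
  obtain ⟨x1, hx1⟩ := exists_dvd_all c
  choose d hd using hx1
  have hgen := fun x => (inferInstance : Algebra.FiniteType k (B x)).out
  choose G hG using hgen
  have := Fintype.ofFinite J
  let E : Finset F := Finset.univ.biUnion fun x => (G x).image (χ x)
  obtain ⟨s, hs⟩ := IsLocalization.exist_integer_multiples_of_finset (nonZeroDivisors O) E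
  have hs0 : (s : O) ≠ 0 := nonZeroDivisors.coe_ne_zero s
  let N : Set O := {o | ∃ x, ∃ g ∈ G x, algebraMap O F o = algebraMap O F s * χ x g}
  have hNf : N.Finite := by
    have : N ⊆ (algebraMap O F) ⁻¹' ((E.image (fun e => algebraMap O F s * e) : Finset F) : Set F) := by
      rintro o ⟨x, g, hg, ho⟩
      simp only [Set.mem_preimage, Finset.coe_image, Set.mem_image]
      exact ⟨χ x g, by simpa [E] using ⟨x, g, hg, rfl⟩, ho.symm⟩
    exact Set.Finite.subset (Set.Finite.preimage hOF.injOn (Finset.finite_toSet _)) this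
  let S : Set O := {(s : O), c x1} ∪ Set.range d ∪ N
  have hSf : S.Finite := (((Set.finite_singleton _).insert _).union (Set.finite_range d)).union hNf
  let A1 := Algebra.adjoin k S
  have hA1 : Algebra.FiniteType k A1 :=
    (Subalgebra.fg_iff_finiteType _).mp ⟨hSf.toFinset, by rw [hSf.coe_toFinset]⟩
  have hSA : ∀ o ∈ S, o ∈ A1 := fun o ho => Algebra.subset_adjoin ho
  let s' : A1 := ⟨s, hSA _ (by simp [S])⟩
  let c' : A1 := ⟨c x1, hSA _ (by simp [S])⟩
  let d' : J → A1 := fun x => ⟨d x, hSA _ (by simp [S])⟩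
  have hcx0 : c x1 ≠ 0 := by
    intro h; have := hc x1; rw [h, map_zero, zero_mul] at this; exact zero_ne_one this
  have hs'0 : s' ≠ 0 := fun h => hs0 congr(($h : O))
  have hc'0 : c' ≠ 0 := fun h => hcx0 congr(($h : O))
  obtain ⟨T, hT1, hT2⟩ := exists_curve (k := k) (s' * c') c' (mul_ne_zero hs'0 hc'0)
    (Dvd.intro_left _ rfl) (fun h => hcu x1 (h.map A1.val))
  rw [map_mul] at hT1
  let A := Localization.Away s'
  have : IsDomain A := IsLocalization.isDomain_localization
    (powers_le_nonZeroDivisors_of_noZeroDivisors hs'0)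
  let oF : A1 →ₐ[k] F := (IsScalarTower.toAlgHom k O F).comp A1.val
  have hoF : Function.Injective oF := hOF.comp Subtype.val_injective
  have hoFa : ∀ a, oF a = algebraMap O F a := fun _ => rfl
  let ι : A →ₐ[k] F := IsLocalization.liftAlgHom (M := Submonoid.powers s') (f := oF) (by
    rintro ⟨_, n, rfl⟩
    simp only [map_pow]
    exact (isUnit_iff_ne_zero.mpr ((map_ne_zero_iff oF hoF).mpr hs'0)).pow n)
  have hιa : ∀ a, ι (algebraMap A1 A a) = oF a := fun a => IsLocalization.lift_eq _ _
  let T1 : A1 →ₐ[k] K := (iK k K).comp T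
  let T' : A →ₐ[k] K := IsLocalization.liftAlgHom (M := Submonoid.powers s') (f := T1) (by
    rintro ⟨_, n, rfl⟩
    simp only [map_pow]
    exact (isUnit_iff_ne_zero.mpr ((map_ne_zero_iff (iK k K) (iK_inj k K)).mpr
      (left_ne_zero_of_mul hT1))).pow n)
  have hT'a : ∀ a, T' (algebraMap A1 A a) = iK k K (T a) := fun a => IsLocalization.lift_eq _ _
  clear_value ι T' A1
  have hι : Function.Injective ι := by
    rw [injective_iff_map_eq_zero]
    intro z hz
    obtain ⟨⟨a, m⟩, hm⟩ := IsLocalization.surj (Submonoid.powers s') z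
    have h2 := congr(ι $hm)
    simp only [map_mul, hz, zero_mul, hιa] at h2
    have h3 : a = 0 := hoF (h2.symm.trans (map_zero _).symm)
    rw [h3, map_zero] at hm
    have hmu := IsLocalization.map_units A m
    exact hmu.mul_left_eq_zero.mp hm
  have hfac : ∀ x, ∃ φ' : B x →ₐ[k] A, ι.comp φ' = χ x := by
    intro x
    apply algHom_factor ι hι
    have : (⊤ : Subalgebra k (B x)) ≤ (ι.range).comap (χ x) := by
      rw [← hG x, Algebra.adjoin_le_iff]
      intro g hg
      change χ x g ∈ ι.range
      obtain ⟨o, ho⟩ := hs (χ x g) (by simpa [E] using ⟨x, g, hg, rfl⟩)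
      rw [Algebra.smul_def] at ho
      let o' : A1 := ⟨o, hSA _ (Or.inr ⟨x, g, hg, ho⟩)⟩
      refine ⟨IsLocalization.mk' A o' (⟨s', Submonoid.mem_powers s'⟩ : Submonoid.powers s'), ?_⟩
      have h0 : oF s' ≠ 0 := (map_ne_zero_iff oF hoF).mpr hs'0
      apply mul_left_cancel₀ h0
      change oF s' * ι _ = _
      have hsp : algebraMap A1 A s' * IsLocalization.mk' A o'
        (⟨s', Submonoid.mem_powers s'⟩ : Submonoid.powers s') = algebraMap A1 A o' :=
          IsLocalization.mk'_spec' A o' (⟨s', Submonoid.mem_powers s'⟩ : Submonoid.powers s')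
      rw [← hιa, ← map_mul, hsp, hιa, hιa, hoFa, hoFa]
      exact ho
    intro z
    exact this (Algebra.mem_top (x := z))
  choose χ' hχ' using hfac
  refine ⟨A, inferInstance, inferInstance, inferInstance, ι, χ', T', hι, hχ', ?_⟩
  rintro x ⟨u, hu⟩
  have h2 : algebraMap A1 A (c' * d' x) * χ' x (b x) = 1 := by
    apply hι
    rw [map_mul, hιa, map_one, hoFa]
    have h4 : ι (χ' x (b x)) = χ x (b x) := congr($(hχ' x) (b x))
    rw [h4, ← hc x, hd x]
    rfl
  have h3 := congr(T' $h2)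
  rw [map_mul, hT'a, ← hu, ← map_mul, map_one, ← map_one (iK k K)] at h3
  have h4 := congr(PowerSeries.constantCoeff $(iK_inj k K h3))
  simp [hT2] at h4
end arcs
end

section
open CategoryTheory AlgebraicGeometry Limits
open scoped TensorProduct
noncomputable section
set_option linter.unusedSectionVars false

section arcs2
variable {k : Type} [Field k] [CharZero k] [IsAlgClosed k]
variable (K : Type) [Field K] [Algebra k K] [Algebra (PowerSeries k) K]
  [IsScalarTower k (PowerSeries k) K] [IsFractionRing (PowerSeries k) K]

/-- A local ring point whose closed point is in a chart factors through the chart. -/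
lemma local_chart {A B : Type} [CommRing A] [IsLocalRing A] [Algebra k A] [CommRing B] [Algebra k B]
    {X : OverR k} (j : SpO k B ⟶ X) [IsOpenImmersion j.left] (g : SpO k A ⟶ X)
    (h : g.left (IsLocalRing.closedPoint A) ∈ Set.range j.left) :
    ∃ φ : B →ₐ[k] A, g = SpO.map φ ≫ j := by
  apply chart_factor
  rintro _ ⟨z, rfl⟩
  have h1 : z ⤳ IsLocalRing.closedPoint A := by
    refine (PrimeSpectrum.le_iff_specializes (z : PrimeSpectrum A) _).mp ?_
    exact IsLocalRing.le_maximalIdeal z.2.ne_top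
  exact (h1.map g.left.continuous).mem_open j.left.isOpenEmbedding.isOpen_range h

lemma exists_charts (Q : OverR k) [LocallyOfFiniteType Q.hom] [QuasiCompact Q.hom] :
    ∃ (J : Type) (_ : Finite J) (B : J → Type) (_ : ∀ x, CommRing (B x))
      (_ : ∀ x, Algebra k (B x)) (_ : ∀ x, Algebra.FiniteType k (B x))
      (j : ∀ x, SpO k (B x) ⟶ Q), (∀ x, IsOpenImmersion (j x).left) ∧
      ∀ q, ∃ x, q ∈ Set.range (j x).left := by
  have : CompactSpace Q.left := by
    have : CompactSpace (SR k) := inferInstance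
    exact QuasiCompact.compactSpace_of_compactSpace Q.hom
  choose B i1 i2 j hj hx hft using exists_chart Q
  obtain ⟨t, ht⟩ := isCompact_univ.elim_finite_subcover (fun x : Q.left => Set.range (j x).left)
    (fun x => (j x).left.isOpenEmbedding.isOpen_range)
    (fun x _ => Set.mem_iUnion.mpr ⟨x, hx x⟩)
  refine ⟨t, inferInstance, fun x => B x, fun x => i1 x, fun x => i2 x,
    fun x => hft x inferInstance, fun x => j x, fun x => hj x, fun q => ?_⟩
  have := ht (Set.mem_univ q)
  simp only [Set.mem_iUnion] at this
  obtain ⟨x, hxt, h⟩ := this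
  exact ⟨⟨x, hxt⟩, h⟩

lemma lift_of_arcs (Q : OverR k) [LocallyOfFiniteType Q.hom] [QuasiCompact Q.hom]
    [IsSeparated Q.hom]
    (hext : ∀ g : SpO k K ⟶ Q, ∃ g0, g = SpO.map (iK k K) ≫ g0)
    {O F : Type} [CommRing O] [IsDomain O] [ValuationRing O] [Algebra k O]
    [Field F] [Algebra k F] [Algebra O F] [IsScalarTower k O F] [IsFractionRing O F]
    (p : SpO k F ⟶ Q) : ∃ l : SpO k O ⟶ Q, p = SpO.map (IsScalarTower.toAlgHom k O F) ≫ l := by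
  by_contra hno
  obtain ⟨J, _, B, _, _, _, j, hj, hcov⟩ := exists_charts Q
  let pt : Q.left := p.left (⊥ : PrimeSpectrum F)
  let J' := {x : J // pt ∈ Set.range (j x).left}
  have hfac : ∀ x : J', ∃ χ : B x →ₐ[k] F, p = SpO.map χ ≫ j x := by
    intro x
    have := hj x
    apply chart_factor
    rintro _ ⟨z, rfl⟩
    rw [show z = (⊥ : PrimeSpectrum F) from Subsingleton.elim (α := PrimeSpectrum F) _ _]
    exact x.2
  choose χ hχ using hfac
  have hb : ∀ x : J', ∃ b : B x, ¬ ∃ o, algebraMap O F o = χ x b := by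
    intro x
    by_contra hall
    push Not at hall
    obtain ⟨φ', hφ'⟩ := algHom_factor (IsScalarTower.toAlgHom k O F) (IsFractionRing.injective O F)
      (χ x) hall
    exact hno ⟨SpO.map φ' ≫ j x, by rw [← Category.assoc, ← SpO.map_comp, hφ', hχ x]⟩
  choose b hb using hb
  have : Nonempty J' := by
    obtain ⟨x, hx⟩ := hcov pt
    exact ⟨⟨x, hx⟩⟩
  obtain ⟨A, _, _, _, ι, χ', T, hι, hχ', hT⟩ := arc_alg K (O := O) (fun x : J' => B x) χ b hb
  have hsame : ∀ x y : J', SpO.map (χ' x) ≫ j x = SpO.map (χ' y) ≫ j y := by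
    intro x y
    apply spO_ext ι hι
    rw [← Category.assoc, ← Category.assoc, ← SpO.map_comp, ← SpO.map_comp, hχ', hχ', ← hχ, ← hχ]
  obtain ⟨x0⟩ := ‹Nonempty J'›
  obtain ⟨g0, hg0⟩ := hext (SpO.map T ≫ SpO.map (χ' x0) ≫ j x0)
  obtain ⟨y, hy⟩ := hcov (g0.left (IsLocalRing.closedPoint (PowerSeries k)))
  have := hj y
  obtain ⟨φ, hφ⟩ := local_chart (j y) g0 hy
  have hpy : pt ∈ Set.range (j y).left := by
    let z : PrimeSpectrum A := (SpO.map T).left (⊥ : PrimeSpectrum K)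
    have h1 : (SpO.map (χ' x0) ≫ j x0).left z ∈ Set.range (j y).left := by
      change (SpO.map T ≫ SpO.map (χ' x0) ≫ j x0).left (⊥ : PrimeSpectrum K) ∈ _
      rw [hg0, hφ]
      exact ⟨_, rfl⟩
    let e : PrimeSpectrum A := (SpO.map ι).left (⊥ : PrimeSpectrum F)
    have h2 : e ⤳ z := by
      refine (PrimeSpectrum.le_iff_specializes _ _).mp ?_
      intro r hr
      have : ι r = 0 := hr
      rw [hι (this.trans (map_zero _).symm)]
      exact zero_mem _
    have h3 := (h2.map (SpO.map (χ' x0) ≫ j x0).left.continuous).mem_open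
      (j y).left.isOpenEmbedding.isOpen_range h1
    have h4 : (SpO.map (χ' x0) ≫ j x0).left e = pt := by
      change (SpO.map ι ≫ SpO.map (χ' x0) ≫ j x0).left (⊥ : PrimeSpectrum F) = pt
      rw [← Category.assoc, ← SpO.map_comp, hχ', ← hχ]
    rwa [h4] at h3
  have h5 := hsame x0 ⟨y, hpy⟩
  rw [h5, hφ, ← Category.assoc, ← Category.assoc, ← SpO.map_comp, ← SpO.map_comp] at hg0
  have h6 := chart_cancel (j y) hg0
  exact hT ⟨y, hpy⟩ ⟨φ (b ⟨y, hpy⟩), congr($h6.symm (b ⟨y, hpy⟩))⟩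

theorem proper_of_arcs (Q : OverR k) [LocallyOfFiniteType Q.hom] [QuasiCompact Q.hom]
    [IsSeparated Q.hom]
    (hext : ∀ g : SpO k K ⟶ Q, ∃ g0, g = SpO.map (iK k K) ≫ g0) : IsProper Q.hom := by
  have : UniversallyClosed Q.hom := by
    apply UniversallyClosed.of_valuativeCriterion
    intro S
    obtain ⟨α, hα⟩ := Spec.map_surjective S.i₂
    let _ : Algebra k S.R := α.hom.toAlgebra
    let _ : Algebra k S.K := ((algebraMap S.R S.K).comp α.hom).toAlgebra
    have : IsScalarTower k S.R S.K := IsScalarTower.of_algebraMap_eq fun _ => rfl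
    let p : SpO k S.K ⟶ Q := Over.homMk S.i₁ (by
      rw [S.commSq.w, ← hα, ← Spec.map_comp]; rfl)
    obtain ⟨l, hl⟩ := lift_of_arcs K Q hext (O := S.R) p
    refine ⟨⟨⟨l.left, ?_, ?_⟩⟩⟩
    · exact congr(($hl).left).symm
    · rw [Over.w l, ← hα]; rfl
  exact {}
end arcs2
end

section
open CategoryTheory AlgebraicGeometry Limits
open scoped TensorProduct

noncomputable section
set_option linter.unusedSectionVars false

section Cartier
variable {k : Type} [Field k] [CharZero k]

lemma der_nilpotent {B : Type} [CommRing B] [Algebra k B] (D : Derivation k B B) {x : B}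
    (hx : IsNilpotent x) : IsNilpotent (D x) := by
  obtain ⟨n, hn⟩ := hx
  have key : ∀ n : ℕ, ∀ r : ℕ, x ^ n * (D x) ^ r = 0 → IsNilpotent (D x) := by
    intro n
    induction n with
    | zero => intro r h; exact ⟨r, by simpa using h⟩
    | succ n ih =>
      intro r h
      apply ih (r + 2)
      have h1 : D (x ^ (n + 1) * (D x) ^ r) * D x = 0 := by rw [h, map_zero, zero_mul]
      rw [D.leibniz, D.leibniz_pow, D.leibniz_pow] at h1
      simp only [smul_eq_mul, nsmul_eq_mul, Nat.add_sub_cancel] at h1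
      have h2 : x ^ (n + 1) * (r * (D x ^ (r - 1) * D (D x))) * D x = 0 := by
        rcases r with _ | r
        · simp
        · simp only [Nat.add_sub_cancel]
          linear_combination (((r + 1 : ℕ) : B) * D (D x)) * h
      have h3 : ((n + 1 : ℕ) : B) * (x ^ n * D x ^ (r + 2)) = 0 := by
        linear_combination h1 - h2
      have hu : IsUnit ((n + 1 : ℕ) : B) := by
        have : ((n + 1 : ℕ) : B) = algebraMap k B ((n + 1 : ℕ) : k) := by simp
        rw [this]
        exact (IsUnit.mk0 _ (Nat.cast_ne_zero.2 n.succ_ne_zero)).map _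
      exact (hu.mul_right_eq_zero).1 h3
  exact key n 0 (by simpa using hn)

lemma finite_quot_sq {B : Type} [CommRing B] [Algebra k B] [Algebra.FiniteType k B]
    (e : B →ₐ[k] k) : Module.Finite k (B ⧸ (RingHom.ker e) ^ 2) := by
  rw [Module.finite_iff_krullDimLE_zero, Ring.krullDimLE_zero_iff]
  intro I hI
  have hs : Function.Surjective (Ideal.Quotient.mk (RingHom.ker e ^ 2)) :=
    Ideal.Quotient.mk_surjective
  have hq : (I.comap (Ideal.Quotient.mk (RingHom.ker e ^ 2))).IsPrime := inferInstance
  have h1 : RingHom.ker e ≤ I.comap (Ideal.Quotient.mk (RingHom.ker e ^ 2)) := by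
    intro x hx
    apply hq.mem_of_pow_mem 2
    rw [Ideal.mem_comap, Ideal.Quotient.eq_zero_iff_mem.2 (Ideal.pow_mem_pow hx 2)]
    exact zero_mem _
  have h2 : (RingHom.ker e).IsMaximal := RingHom.ker_isMaximal_of_surjective e
    (fun a => ⟨algebraMap k _ a, by simp⟩)
  have h3 := h2.eq_of_le hq.ne_top h1
  rw [h3] at h2
  rcases Ideal.map_eq_top_or_isMaximal_of_surjective _ hs h2 with h | h
  · rw [Ideal.map_comap_of_surjective _ hs] at h
    exact absurd h hI.ne_top
  · rwa [Ideal.map_comap_of_surjective _ hs] at h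

theorem cartier_aux {B : Type} [CommRing B] [Algebra k B] [Algebra.FiniteType k B]
    (e : B →ₐ[k] k)
    (H : ∀ l : B →ₗ[k] k, (∀ a b, l (a * b) = e a * l b + e b * l a) →
      ∃ D : Derivation k B B, ∀ b, e (D b) = l b) :
    ∃ s : B, e s ≠ 0 ∧ ∀ b, IsNilpotent b → s * b = 0 := by
  have hnoe : IsNoetherianRing B := Algebra.FiniteType.isNoetherianRing k B
  set m : Ideal B := RingHom.ker e with hm
  have hfin := finite_quot_sq e
  -- coordinates
  let V : Submodule k (B ⧸ m ^ 2) := Submodule.map (Ideal.Quotient.mkₐ k (m ^ 2)).toLinearMap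
    (m.restrictScalars k)
  have hVf : Module.Finite k V := inferInstance
  let bs := Module.finBasis k V
  have hlift : ∀ i, ∃ x : B, x ∈ m ∧ Ideal.Quotient.mk (m ^ 2) x = (bs i : B ⧸ m ^ 2) := by
    intro i
    obtain ⟨x, hx, hx'⟩ := (bs i).2
    exact ⟨x, hx, hx'⟩
  choose x hxm hx using hlift
  have hsub : ∀ b, b - algebraMap k B (e b) ∈ m := by
    intro b
    rw [hm, RingHom.mem_ker]; simp
  let π : B →ₗ[k] V := LinearMap.codRestrict V
    ((Ideal.Quotient.mkₐ k (m ^ 2)).toLinearMap.comp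
      (LinearMap.id - (Algebra.linearMap k B).comp e.toLinearMap)) (by
      intro b
      exact ⟨_, hsub b, rfl⟩)
  have hπ : ∀ b, (π b : B ⧸ m ^ 2) = Ideal.Quotient.mk (m ^ 2) (b - algebraMap k B (e b)) :=
    fun b => rfl
  clear_value π
  have hleib : ∀ a b, π (a * b) = e a • π b + e b • π a := by
    intro a b
    apply Subtype.ext
    rw [Submodule.coe_add, Submodule.coe_smul, Submodule.coe_smul, hπ, hπ, hπ]
    rw [← sub_eq_zero]
    have : (a - algebraMap k B (e a)) * (b - algebraMap k B (e b)) ∈ m ^ 2 := by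
      rw [pow_two]; exact Ideal.mul_mem_mul (hsub a) (hsub b)
    rw [← Ideal.Quotient.eq_zero_iff_mem] at this
    rw [← this]
    rw [Algebra.smul_def, Algebra.smul_def, IsScalarTower.algebraMap_apply k B (B ⧸ m ^ 2),
      IsScalarTower.algebraMap_apply k B (B ⧸ m ^ 2), Ideal.Quotient.algebraMap_eq]
    simp only [map_mul, map_sub]
    ring
  have hD : ∀ i, ∃ D : Derivation k B B, ∀ b, e (D b) = bs.coord i (π b) := by
    intro i
    apply H ((bs.coord i).comp π)
    intro a b
    simp [hleib]
  choose D hD using hD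
  let E : Derivation k B B := ∑ i, x i • D i
  have hE : ∀ b, E b = ∑ i, x i * D i b := by
    intro b
    change Derivation.coeFnAddMonoidHom (∑ i, x i • D i) b = _
    rw [map_sum, Finset.sum_apply]
    rfl
  clear_value E
  have hE1 : ∀ b ∈ m, E b - b ∈ m ^ 2 := by
    intro b hb
    have h1 : ∀ i, x i * D i b - x i * algebraMap k B (bs.coord i (π b)) ∈ m ^ 2 := by
      intro i
      have := Ideal.mul_mem_mul (hxm i) (hsub (D i b))
      rw [← mul_sub, ← hD]
      exact (pow_two m).symm ▸ this
    have h2 : (∑ i, x i * algebraMap k B (bs.coord i (π b))) - b ∈ m ^ 2 := by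
      rw [← Ideal.Quotient.eq_zero_iff_mem, map_sub, map_sum]
      have h3 : Ideal.Quotient.mk (m ^ 2) b = π b := by
        rw [hπ, show e b = 0 from hb, map_zero, sub_zero]
      rw [h3, sub_eq_zero]
      conv_rhs => rw [← bs.sum_repr (π b)]
      rw [Submodule.coe_sum]
      refine Finset.sum_congr rfl fun i _ => ?_
      rw [Submodule.coe_smul, ← hx, Algebra.smul_def, IsScalarTower.algebraMap_apply k B (B ⧸ m ^ 2),
        Ideal.Quotient.algebraMap_eq, map_mul, mul_comm]
      rfl
    rw [hE]
    have h4 := (m ^ 2).sum_mem (fun i (_ : i ∈ Finset.univ) => h1 i)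
    rw [Finset.sum_sub_distrib] at h4
    have := add_mem h4 h2
    rwa [sub_add_sub_cancel] at this
  have hEn : ∀ n : ℕ, ∀ b ∈ m ^ (n + 1), E b - ((n + 1 : ℕ) : B) * b ∈ m ^ (n + 2) := by
    intro n
    induction n with
    | zero => intro b hb; simpa using hE1 b (by simpa using hb)
    | succ n ih =>
      intro b hb
      rw [pow_succ] at hb
      refine Submodule.mul_induction_on hb ?_ ?_
      · intro p hp q hq
        rw [E.leibniz]
        have h1 : (E p - ((n + 1 : ℕ) : B) * p) * q ∈ m ^ (n + 3) := by
          rw [pow_succ _ (n + 2)]; exact Ideal.mul_mem_mul (ih p hp) hq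
        have h2 : p * (E q - q) ∈ m ^ (n + 3) := by
          rw [show n + 3 = (n + 1) + 2 from rfl, pow_add]; exact Ideal.mul_mem_mul hp (hE1 q hq)
        have := add_mem h1 h2
        convert this using 1
        simp only [smul_eq_mul]; push_cast; ring
      · intro p q hp hq
        have := add_mem hp hq
        convert this using 1
        rw [map_add]; ring
  have hJ : ∀ n : ℕ, nilradical B ≤ m ^ (n + 1) := by
    intro n
    induction n with
    | zero =>
      intro b hb
      rw [zero_add, pow_one, hm, RingHom.mem_ker]
      exact ((mem_nilradical.1 hb).map e).eq_zero
    | succ n ih =>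
      intro b hb
      have h1 : E b ∈ m ^ (n + 2) := by
        rw [hE]
        refine Ideal.sum_mem _ fun i _ => ?_
        rw [pow_succ']
        exact Ideal.mul_mem_mul (hxm i) (ih (mem_nilradical.2 (der_nilpotent _ (mem_nilradical.1 hb))))
      have h2 := sub_mem h1 (hEn n b (ih hb))
      rw [sub_sub_cancel] at h2
      have hu : IsUnit ((n + 1 : ℕ) : B) := by
        have : ((n + 1 : ℕ) : B) = algebraMap k B ((n + 1 : ℕ) : k) := by simp
        rw [this]
        exact (IsUnit.mk0 _ (Nat.cast_ne_zero.2 n.succ_ne_zero)).map _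
      exact ((m ^ (n + 2)).unit_mul_mem_iff_mem hu).1 h2
  have hK : ∀ b ∈ nilradical B, ∃ s : B, e s ≠ 0 ∧ s * b = 0 := by
    intro b hb
    have : b ∈ (⨅ i : ℕ, m ^ i • ⊤ : Submodule B B) := by
      rw [Submodule.mem_iInf]
      intro i
      rw [smul_eq_mul, Ideal.mul_top]
      rcases i with _ | i
      · simp
      · exact hJ i hb
    rw [Ideal.mem_iInf_smul_pow_eq_bot_iff] at this
    obtain ⟨⟨r, hr⟩, hrb⟩ := this
    refine ⟨1 - r, ?_, ?_⟩
    · rw [map_sub, map_one, show e r = 0 from hr, sub_zero]; exact one_ne_zero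
    · change r * b = b at hrb
      rw [sub_mul, one_mul, hrb, sub_self]
  obtain ⟨S, hS⟩ := (isNoetherianRing_iff_ideal_fg B).1 hnoe (nilradical B)
  have hK' : ∀ b : S, ∃ s : B, e s ≠ 0 ∧ s * b = 0 := fun b => hK b (by
    rw [← hS]; exact Ideal.subset_span b.2)
  choose s hs hsb using hK'
  refine ⟨∏ b, s b, ?_, ?_⟩
  · rw [map_prod]; exact Finset.prod_ne_zero_iff.2 fun b _ => hs b
  · intro b hb
    change b ∈ nilradical B at hb
    have : b ∈ Ideal.span (S : Set B) := by rw [hS]; exact hb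
    clear hb
    induction this using Submodule.span_induction with
    | mem y hy =>
      classical
      rw [← Finset.mul_prod_erase _ _ (Finset.mem_univ (⟨y, hy⟩ : S)), mul_right_comm, hsb ⟨y, hy⟩,
        zero_mul]
    | zero => simp
    | add p q _ _ hp hq => rw [mul_add, hp, hq, add_zero]
    | smul a p _ hp => rw [smul_eq_mul, mul_left_comm, hp, mul_zero]

end Cartier
end
end

section
open CategoryTheory AlgebraicGeometry Limits
open scoped TensorProduct

noncomputable section
set_option linter.unusedSectionVars false

section Cartier
variable {k : Type} [Field k] [CharZero k]
namespace IdChart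
variable {Γ : GroupScheme k} (c : IdChart Γ)

lemma exists_lN (l : c.B →ₗ[k] k)
    (hl : ∀ a b, l (a * b) = c.e a * l b + c.e b * l a) :
    ∃ lN : c.N →ₗ[k] k, ∀ b, lN (c.mkN b) = l b := by
  have hl2 : ∀ a ∈ c.m ^ 2, l a = 0 := by
    intro a ha
    rw [pow_two] at ha
    refine Submodule.mul_induction_on ha ?_ ?_
    · intro p hp q hq
      rw [hl, show c.e p = 0 from hp, show c.e q = 0 from hq, zero_mul, zero_mul, add_zero]
    · intro p q hp hq
      rw [map_add, hp, hq, add_zero]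
  obtain ⟨t, ht⟩ := c.mkN.toLinearMap.exists_rightInverse_of_surjective
    (LinearMap.range_eq_top.2 Ideal.Quotient.mk_surjective)
  refine ⟨l.comp t, fun b => ?_⟩
  rw [LinearMap.comp_apply, ← sub_eq_zero, ← map_sub]
  apply hl2
  rw [← Ideal.Quotient.eq_zero_iff_mem, map_sub, sub_eq_zero]
  exact congr($ht (c.mkN b))

lemma lN_mul {l : c.B →ₗ[k] k}
    (hl : ∀ a b, l (a * b) = c.e a * l b + c.e b * l a)
    {lN : c.N →ₗ[k] k} (hlN : ∀ b, lN (c.mkN b) = l b) (a b : c.N) :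
    lN (a * b) = c.eN a * lN b + c.eN b * lN a := by
  obtain ⟨a, rfl⟩ := Ideal.Quotient.mk_surjective a
  obtain ⟨b, rfl⟩ := Ideal.Quotient.mk_surjective b
  change lN (c.mkN a * c.mkN b) = c.e a * lN (c.mkN b) + c.e b * lN (c.mkN a)
  rw [← map_mul, hlN, hlN, hlN, hl]

lemma prB_sum {ι : Type} {s : Finset ι} {x : ι → c.B} {y : ι → c.N} {a : c.B}
    (h : c.rho a = ∑ i ∈ s, x i ⊗ₜ y i) : ∑ i ∈ s, x i * algebraMap k c.B (c.eN (y i)) = a := by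
  have := congr($(c.right_counit) a)
  rw [AlgHom.comp_apply, h, map_sum] at this
  rw [AlgHom.id_apply] at this
  rw [← this]
  refine Finset.sum_congr rfl fun i _ => ?_
  rw [prB, Algebra.TensorProduct.productMap_apply_tmul]
  rfl

lemma act_mul {lN : c.N →ₗ[k] k} (hN : ∀ a b : c.N, lN (a * b) = c.eN a * lN b + c.eN b * lN a)
    (a b : c.B) : c.act (AlgHom.id k c.B) ((Algebra.linearMap k c.B).comp lN) (a * b) =
      a * c.act (AlgHom.id k c.B) ((Algebra.linearMap k c.B).comp lN) b +
      b * c.act (AlgHom.id k c.B) ((Algebra.linearMap k c.B).comp lN) a := by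
  obtain ⟨ι, s, x, y, h⟩ := c.exists_rho_sum a
  obtain ⟨ι', s', x', y', h'⟩ := c.exists_rho_sum b
  have ha := c.prB_sum h
  have hb := c.prB_sum h'
  have hab : c.rho (a * b) = ∑ p ∈ s ×ˢ s', (x p.1 * x' p.2) ⊗ₜ (y p.1 * y' p.2) := by
    rw [map_mul, h, h', Finset.sum_mul_sum, Finset.sum_product]
    refine Finset.sum_congr rfl fun i _ => Finset.sum_congr rfl fun j _ => ?_
    rw [Algebra.TensorProduct.tmul_mul_tmul]
  rw [c.act_sum hab, c.act_sum h, c.act_sum h']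
  conv_rhs => enter [1, 1]; rw [← ha]
  conv_rhs => enter [2, 1]; rw [← hb]
  rw [Finset.sum_mul_sum, Finset.sum_mul_sum, Finset.sum_comm (s := s'), Finset.sum_product,
    ← Finset.sum_add_distrib]
  refine Finset.sum_congr rfl fun i _ => ?_
  rw [← Finset.sum_add_distrib]
  refine Finset.sum_congr rfl fun j _ => ?_
  rw [AlgHom.id_apply, AlgHom.id_apply, AlgHom.id_apply, LinearMap.comp_apply, LinearMap.comp_apply,
    LinearMap.comp_apply, hN, map_add, Algebra.linearMap_apply, Algebra.linearMap_apply,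
    Algebra.linearMap_apply, Algebra.linearMap_apply, map_mul, map_mul]
  ring

lemma e_act (lN : c.N →ₗ[k] k) (b : c.B) :
    c.e (c.act (AlgHom.id k c.B) ((Algebra.linearMap k c.B).comp lN) b) = lN (c.mkN b) := by
  rw [c.map_act]
  have h1 : c.e.comp (AlgHom.id k c.B) = (Algebra.ofId k k).comp c.e := by ext; rfl
  have h2 : c.e.toLinearMap.comp ((Algebra.linearMap k c.B).comp lN) = lN := by
    refine LinearMap.ext fun n => ?_
    exact c.e.commutes _
  rw [h1, h2, c.act_e]

lemma exists_der (l : c.B →ₗ[k] k)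
    (hl : ∀ a b, l (a * b) = c.e a * l b + c.e b * l a) :
    ∃ D : Derivation k c.B c.B, ∀ b, c.e (D b) = l b := by
  obtain ⟨lN, hlN⟩ := c.exists_lN l hl
  have h1 := c.act_mul (c.lN_mul hl hlN)
  have h2 := c.e_act lN
  refine ⟨Derivation.mk' (c.act (AlgHom.id k c.B) ((Algebra.linearMap k c.B).comp lN)) h1, ?_⟩
  intro b
  rw [← hlN]
  exact h2 b
end IdChart
end Cartier
end
end

section
open CategoryTheory AlgebraicGeometry Limits
open scoped TensorProduct

noncomputable section
set_option linter.unusedSectionVars false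

lemma isReduced_of_cover (X : Scheme.{0}) (h : ∀ x : X, ∃ (Y : Scheme.{0}) (i : Y ⟶ X),
    IsOpenImmersion i ∧ IsReduced Y ∧ x ∈ Set.range i) : IsReduced X := by
  have : ∀ x : X, _root_.IsReduced (X.presheaf.stalk x) := by
    intro x
    obtain ⟨Y, i, hi, hY, y, rfl⟩ := h x
    exact isReduced_of_injective (i.stalkMap y).hom
      (ConcreteCategory.bijective_of_isIso (i.stalkMap y)).1
  exact isReduced_of_isReduced_stalk X

section Red
variable {k : Type} [Field k]

lemma smooth_exists_der {B : Type} [CommRing B] [Algebra k B] [Algebra.Smooth k B]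
    (e : B →ₐ[k] k) (l : B →ₗ[k] k) (hl : ∀ a b, l (a * b) = e a * l b + e b * l a) :
    ∃ D : Derivation k B B, ∀ b, e (D b) = l b := by
  let _ : Module B k := Module.compHom k e.toRingHom
  have hsm : ∀ (b : B) (c : k), b • c = e b * c := fun b c => rfl
  have : IsScalarTower k B k := ⟨fun a b c => by simp [hsm, mul_assoc]⟩
  let d : Derivation k B k := Derivation.mk' l (by intro a b; rw [hsm, hsm, hl])
  let E : B →ₗ[B] k :=
    { toFun := e, map_add' := map_add e, map_smul' := fun a b => by simp [hsm] }
  have hE : Function.Surjective E := fun a => ⟨algebraMap k _ a, e.commutes a⟩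
  obtain ⟨g, hg⟩ := Module.projective_lifting_property E d.liftKaehlerDifferential hE
  refine ⟨g.compDer (KaehlerDifferential.D k B), fun b => ?_⟩
  change (E.comp g) _ = _
  rw [hg]
  exact d.liftKaehlerDifferential_comp_D b

variable [CharZero k] [IsAlgClosed k]

lemma reduced_of_local {B : Type} [CommRing B] [Algebra k B] [Algebra.FiniteType k B]
    (h : ∀ e : B →ₐ[k] k, ∃ s, e s ≠ 0 ∧ ∀ b, IsNilpotent b → s * b = 0) :
    _root_.IsReduced B := by
  refine ⟨fun b hb => ?_⟩
  by_contra hne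
  have hI : Ideal.span {b} ≠ ⊥ := by simpa using hne
  let I : Ideal B := Module.annihilator B (Ideal.span {b})
  have hI : I ≠ ⊤ := by
    intro h
    apply hne
    have : (1 : B) ∈ I := h ▸ Submodule.mem_top
    have := Module.mem_annihilator.1 this ⟨b, Ideal.mem_span_singleton_self b⟩
    simpa using this
  obtain ⟨m, hm, hIm⟩ := I.exists_le_maximal hI
  obtain ⟨ev, hev⟩ := exists_ev (k := k) m
  obtain ⟨s, hs, hsb⟩ := h ev
  apply hs
  have : s ∈ I := by
    rw [Module.mem_annihilator]
    rintro ⟨x, hx⟩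
    obtain ⟨y, rfl⟩ := Ideal.mem_span_singleton'.1 hx
    apply Subtype.ext
    change s * (y * b) = 0
    rw [mul_left_comm, hsb b hb, mul_zero]
  have := hIm this
  rw [← hev] at this
  exact this

theorem isReduced_of_smooth {X : Scheme.{0}} (f : X ⟶ SR k) [Smooth f] : IsReduced X := by
  apply isReduced_of_cover
  intro x
  obtain ⟨B, _, _, j, hj, hx, hft⟩ := exists_chart (Over.mk f : OverR k) x
  refine ⟨_, j.left, hj, ?_, hx⟩
  have hs : Smooth (Spec.map (CommRingCat.ofHom (algebraMap k B))) := by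
    have : j.left ≫ f = Spec.map (CommRingCat.ofHom (algebraMap k B)) := Over.w j
    rw [← this]; infer_instance
  have := hft (inferInstanceAs (LocallyOfFiniteType f))
  rw [HasRingHomProperty.Spec_iff (P := @Smooth)] at hs
  have : Algebra.Smooth k B := by
    rw [CommRingCat.hom_ofHom, RingHom.smooth_algebraMap] at hs; exact hs
  have : _root_.IsReduced B := reduced_of_local (k := k)
    (fun e => cartier_aux e (fun l hl => smooth_exists_der e l hl))
  exact inferInstanceAs (IsReduced (Spec (.of B)))
end Red
end
end

section
open CategoryTheory AlgebraicGeometry Limits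
open scoped TensorProduct

noncomputable section
set_option linter.unusedSectionVars false

lemma smoothLocus_congr {X Y : Scheme.{0}} {f g : X ⟶ Y} (h : f = g)
    [LocallyOfFinitePresentation f] [LocallyOfFinitePresentation g] :
    f.smoothLocus = g.smoothLocus := by
  subst h; rfl

section Trans
variable {k : Type} [Field k]

lemma SpO_self_hom : (SpO k k).hom = 𝟙 _ := by
  change Spec.map (CommRingCat.ofHom (RingHom.id k)) = _
  exact Spec.map_id _

/-- the map to the point. -/
def toPt (T : OverR k) : T ⟶ SpO k k := Over.homMk T.hom (by
  change T.hom ≫ (SpO k k).hom = T.hom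
  rw [SpO_self_hom]; exact Category.comp_id _)

lemma toPt_uniq {T : OverR k} (f g : T ⟶ SpO k k) : f = g := by
  ext1
  have h1 := Over.w f
  have h2 := Over.w g
  rw [SpO_self_hom] at h1 h2
  exact ((Category.comp_id _).symm.trans h1).trans (h2.symm.trans (Category.comp_id _))

lemma comp_toPt {T T' : OverR k} (f : T ⟶ T') : f ≫ toPt T' = toPt T := toPt_uniq _ _

lemma toPt_self : toPt (SpO k k) = 𝟙 _ := toPt_uniq _ _

lemma isConstant_iff {X Y : OverR k} (p : SpO k k ⟶ X) (f : X ⟶ Y) :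
    IsConstant f ↔ f = toPt X ≫ p ≫ f := by
  constructor
  · rintro ⟨y, hy⟩
    have hp : p.left ≫ X.hom = 𝟙 _ := (Over.w p).trans SpO_self_hom
    ext1
    change f.left = X.hom ≫ p.left ≫ f.left
    rw [hy, reassoc_of% hp]
  · intro h
    exact ⟨p.left ≫ f.left, congr($h |>.left)⟩

/-- the underlying topological point of a rational point -/
def ptx {X : OverR k} (p : SpO k k ⟶ X) : X.left := p.left (⊥ : PrimeSpectrum k)

lemma ptx_comp {X Y : OverR k} (p : SpO k k ⟶ X) (f : X ⟶ Y) : ptx (p ≫ f) = f.left (ptx p) := rfl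

lemma range_pt {X : OverR k} (p : SpO k k ⟶ X) : Set.range p.left = {ptx p} := by
  apply Set.eq_singleton_iff_unique_mem.2
  refine ⟨⟨_, rfl⟩, ?_⟩
  rintro _ ⟨x, rfl⟩
  have : x = (⊥ : PrimeSpectrum k) := Subsingleton.elim (α := PrimeSpectrum k) _ _
  rw [this]; rfl

lemma exists_pt [IsAlgClosed k] (X : OverR k) [LocallyOfFiniteType X.hom] (x : X.left)
    (hx : IsClosed {x}) : ∃ p : SpO k k ⟶ X, ptx p = x := by
  refine ⟨Over.homMk (pointOfClosedPoint X.hom x hx) ?_, ?_⟩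
  · rw [pointOfClosedPoint_comp]; exact SpO_self_hom.symm
  · exact pointOfClosedPoint_apply _ _ _ _

lemma pt_ext [IsAlgClosed k] (X : OverR k) [LocallyOfFiniteType X.hom] (p q : SpO k k ⟶ X)
    (h : ptx p = ptx q) : p = q := by
  ext1
  refine ext_of_apply_closedPoint_eq X.hom ?_ ?_ ?_
  · exact (Over.w p).trans SpO_self_hom
  · exact (Over.w q).trans SpO_self_hom
  · have : IsLocalRing.closedPoint k = (⊥ : PrimeSpectrum k) :=
      Subsingleton.elim (α := PrimeSpectrum k) _ _
    rw [this]; exact h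

lemma exists_pt_mem [IsAlgClosed k] (X : OverR k) [LocallyOfFiniteType X.hom] {Z : Set X.left}
    (hZ : Z.Nonempty) (hZ' : IsLocallyClosed Z) : ∃ p : SpO k k ⟶ X, ptx p ∈ Z := by
  have := LocallyOfFiniteType.jacobsonSpace X.hom
  obtain ⟨x, hx, hxc⟩ := nonempty_inter_closedPoints hZ hZ'
  obtain ⟨p, rfl⟩ := exists_pt X x hxc
  exact ⟨p, hx⟩

lemma closure_eq_of_pts [IsAlgClosed k] (X : OverR k) [LocallyOfFiniteType X.hom] {U : Set X.left}
    (hU : IsOpen U) (h : ∀ p : SpO k k ⟶ X, ptx p ∈ U) : U = Set.univ := by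
  by_contra hne
  have : Uᶜ.Nonempty := Set.nonempty_compl.2 hne
  obtain ⟨p, hp⟩ := exists_pt_mem X this hU.isClosed_compl.isLocallyClosed
  exact hp (h p)

namespace GroupScheme
variable (Γ : GroupScheme k)

/-- right translation -/
def tr (p : SpO k k ⟶ Γ.G) : Γ.G ⟶ Γ.G := 𝟙 Γ.G * (toPt Γ.G ≫ p)

lemma comp_tr {T : OverR k} (a : T ⟶ Γ.G) (p : SpO k k ⟶ Γ.G) :
    a ≫ Γ.tr p = a * (toPt T ≫ p) := by
  rw [tr, Γ.comp_mul, Category.comp_id, ← Category.assoc, comp_toPt]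

lemma pt_tr (q p : SpO k k ⟶ Γ.G) : q ≫ Γ.tr p = q * p := by
  rw [comp_tr, toPt_self, Category.id_comp]

lemma tr_comp (p q : SpO k k ⟶ Γ.G) : Γ.tr p ≫ Γ.tr q = Γ.tr (p * q) := by
  rw [comp_tr, tr, tr, Γ.comp_mul, _root_.mul_assoc]

lemma tr_one : Γ.tr 1 = 𝟙 _ := by
  rw [tr, Γ.comp_one, mul_one]

instance (p : SpO k k ⟶ Γ.G) : IsIso (Γ.tr p) :=
  ⟨Γ.tr p⁻¹, by rw [tr_comp, mul_inv_cancel, tr_one], by rw [tr_comp, inv_mul_cancel, tr_one]⟩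

instance (p : SpO k k ⟶ Γ.G) : IsIso (Γ.tr p).left :=
  inferInstanceAs (IsIso ((Over.forget _).map (Γ.tr p)))

lemma exists_tr (p q : SpO k k ⟶ Γ.G) : ∃ t, p ≫ Γ.tr t = q :=
  ⟨p⁻¹ * q, by rw [pt_tr, mul_inv_cancel_left]⟩

variable [CharZero k] [IsAlgClosed k] [LocallyOfFiniteType Γ.G.hom]

theorem isReduced : IsReduced Γ.G.left := by
  obtain ⟨c, hc⟩ := exists_idChart Γ inferInstance
  obtain ⟨s, hs, hsb⟩ := cartier_aux c.e c.exists_der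
  apply isReduced_of_cover
  intro x
  obtain ⟨p, hp⟩ := exists_pt_mem Γ.G (closure_nonempty_iff.2 (Set.singleton_nonempty x))
    isClosed_closure.isLocallyClosed
  let i : SpO k (Localization.Away s) ⟶ Γ.G :=
    SpO.map (IsScalarTower.toAlgHom k c.B (Localization.Away s)) ≫ c.j ≫ Γ.tr p
  have h1 : IsOpenImmersion (SpO.map (IsScalarTower.toAlgHom k c.B (Localization.Away s))).left := by
    rw [SpO.map_left]
    exact IsOpenImmersion.of_isLocalization s
  have h2 : IsOpenImmersion i.left := by
    change IsOpenImmersion (_ ≫ _ ≫ _)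
    infer_instance
  refine ⟨_, i.left, h2, ?_, ?_⟩
  · have : _root_.IsReduced (Localization.Away s) := by
      refine ⟨fun z hz => ?_⟩
      obtain ⟨⟨b, t⟩, hb⟩ := IsLocalization.surj (Submonoid.powers s) z
      have hu : IsUnit (algebraMap c.B (Localization.Away s) s) :=
        IsLocalization.Away.algebraMap_isUnit s
      have h3 : IsNilpotent (algebraMap c.B (Localization.Away s) b) := by
        rw [← hb]; exact (Commute.all _ _).isNilpotent_mul_right hz
      obtain ⟨n, hn⟩ := h3
      rw [← map_pow, ← map_zero (algebraMap c.B (Localization.Away s))] at hn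
      obtain ⟨⟨_, r, rfl⟩, hr⟩ := IsLocalization.exists_of_eq (M := Submonoid.powers s) hn
      simp only [mul_zero] at hr
      have h4 : IsNilpotent (s * b) := by
        refine ⟨r + n, ?_⟩
        rw [mul_pow, pow_add s, pow_add b]
        linear_combination (s ^ n * b ^ r) * hr
      have h5 := congr(algebraMap c.B (Localization.Away s) $(hsb _ h4))
      rw [map_mul, map_mul, map_zero, hu.mul_right_eq_zero, hu.mul_right_eq_zero] at h5
      rw [h5] at hb
      exact (IsLocalization.map_units _ t).mul_left_eq_zero.1 hb
    exact inferInstanceAs (IsReduced (Spec (.of (Localization.Away s))))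
  · let e' : Localization.Away s →ₐ[k] k := IsLocalization.liftAlgHom (M := Submonoid.powers s)
      (f := c.e) (by
        rintro ⟨_, n, rfl⟩
        exact IsUnit.mk0 _ (by simpa using fun h => absurd h hs))
    have he' : e'.comp (IsScalarTower.toAlgHom k c.B (Localization.Away s)) = c.e := by
      ext b
      simp [e']
    have h3 : SpO.map e' ≫ i = p := by
      rw [← Category.assoc, ← SpO.map_comp, he', ← Category.assoc, c.he, pt_tr, _root_.one_mul]
    have h4 : ptx p ∈ Set.range i.left := by
      rw [← h3]
      exact ⟨_, rfl⟩
    have h5 : x ⤳ ptx p := specializes_iff_mem_closure.2 hp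
    exact h5.mem_open i.left.opensRange.2 h4

theorem smooth : Smooth Γ.G.hom := by
  have := Γ.isReduced
  have : Nonempty Γ.G.left := ⟨ptx 1⟩
  obtain ⟨q, hq⟩ := exists_pt_mem Γ.G Γ.G.hom.dense_smoothLocus_of_perfectField.nonempty
    Γ.G.hom.smoothLocus.2.isLocallyClosed
  rw [← Scheme.Hom.smoothLocus_eq_top_iff, ← TopologicalSpace.Opens.coe_eq_univ]
  refine closure_eq_of_pts Γ.G Γ.G.hom.smoothLocus.2 fun p => ?_
  obtain ⟨t, ht⟩ := Γ.exists_tr p q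
  have h1 : ptx p ∈ (Γ.tr t).left ⁻¹ᵁ Γ.G.hom.smoothLocus := by
    rw [← ht, ptx_comp] at hq
    exact hq
  rw [Scheme.Hom.preimage_smoothLocus_eq] at h1
  have h2 : (Γ.tr t).left ≫ Γ.G.hom = Γ.G.hom := Over.w _
  rwa [smoothLocus_congr h2] at h1
end GroupScheme
end Trans
end
end

section
open CategoryTheory AlgebraicGeometry Limits
open scoped TensorProduct

noncomputable section
set_option linter.unusedSectionVars false

section Descent
variable {k : Type} [Field k] [CharZero k] [IsAlgClosed k]

lemma hom_ext_pts {A Y : OverR k} [IsReduced A.left] [LocallyOfFiniteType A.hom]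
    [LocallyOfFiniteType Y.hom] [IsSeparated Y.hom] (f g : A ⟶ Y)
    (h : ∀ p : SpO k k ⟶ A, p ≫ f = p ≫ g) : f = g := by
  ext1
  have : LocallyOfFiniteType (f.left ≫ Y.hom) := by rw [Over.w f]; infer_instance
  refine ext_of_apply_eq Y.hom Set.univ isClosed_univ.isLocallyClosed dense_univ ?_
    ((Over.w f).trans (Over.w g).symm)
  intro x _ hx
  obtain ⟨p, rfl⟩ := exists_pt A x hx
  rw [← ptx_comp, ← ptx_comp, h]

lemma descend {A B Y : OverR k} (h : A ⟶ B) [Smooth h.left] [Surjective h.left] [Smooth A.hom]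
    [LocallyOfFiniteType Y.hom] [IsSeparated Y.hom] (φ : A ⟶ Y)
    (H : ∀ a a' : SpO k k ⟶ A, a ≫ h = a' ≫ h → a ≫ φ = a' ≫ φ) :
    ∃ ψ : B ⟶ Y, h ≫ ψ = φ := by
  let R : OverR k := Over.mk (pullback.fst h.left h.left ≫ A.hom)
  have hRs : Smooth R.hom := inferInstanceAs (Smooth (pullback.fst h.left h.left ≫ A.hom))
  have hRr : IsReduced R.left := isReduced_of_smooth R.hom
  let r1 : R ⟶ A := Over.homMk (pullback.fst h.left h.left) rfl
  let r2 : R ⟶ A := Over.homMk (pullback.snd h.left h.left) (by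
    change pullback.snd h.left h.left ≫ A.hom = pullback.fst h.left h.left ≫ A.hom
    rw [← Over.w h, pullback.condition_assoc])
  have hr : r1 ≫ h = r2 ≫ h := by
    ext1; exact pullback.condition
  have key : r1 ≫ φ = r2 ≫ φ := by
    apply hom_ext_pts
    intro p
    rw [← Category.assoc, ← Category.assoc]
    apply H
    rw [Category.assoc, Category.assoc, hr]
  have hW : ∀ {Z : Scheme.{0}} (g₁ g₂ : Z ⟶ A.left), g₁ ≫ h.left = g₂ ≫ h.left →
      g₁ ≫ φ.left = g₂ ≫ φ.left := by
    intro Z g₁ g₂ hg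
    have h1 : pullback.lift g₁ g₂ hg ≫ r1.left = g₁ := pullback.lift_fst _ _ _
    have h2 : pullback.lift g₁ g₂ hg ≫ r2.left = g₂ := pullback.lift_snd _ _ _
    have h3 : r1.left ≫ φ.left = r2.left ≫ φ.left := congr($key |>.left)
    generalize pullback.lift g₁ g₂ hg = z at h1 h2
    subst h1 h2
    have := congr(z ≫ $h3)
    exact (Category.assoc _ _ _).trans (this.trans (Category.assoc _ _ _).symm)
  have hfac : h.left ≫ EffectiveEpi.desc h.left φ.left (fun g₁ g₂ => hW g₁ g₂) = φ.left :=
    EffectiveEpi.fac _ _ _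
  refine ⟨Over.homMk (EffectiveEpi.desc h.left φ.left (fun g₁ g₂ => hW g₁ g₂)) ?_, ?_⟩
  · rw [← cancel_epi h.left, ← Category.assoc, hfac]
    exact (Over.w φ).trans (Over.w h).symm
  · ext1; exact hfac

end Descent

section Prod
variable {k : Type} [Field k]

/-- product of schemes over a field -/
def prO (X Y : OverR k) : OverR k := Over.mk (pullback.fst X.hom Y.hom ≫ X.hom)

variable {X Y X' Y' T : OverR k}
def prO.fst (X Y : OverR k) : prO X Y ⟶ X := Over.homMk (pullback.fst X.hom Y.hom) rfl
/-- second projection -/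
def prO.snd (X Y : OverR k) : prO X Y ⟶ Y :=
  Over.homMk (pullback.snd X.hom Y.hom) pullback.condition.symm
/-- lift -/
def prO.lift (a : T ⟶ X) (b : T ⟶ Y) : T ⟶ prO X Y :=
  Over.homMk (pullback.lift a.left b.left ((Over.w a).trans (Over.w b).symm)) (by
    change pullback.lift _ _ _ ≫ pullback.fst _ _ ≫ _ = _
    rw [pullback.lift_fst_assoc]; exact Over.w a)
lemma prO.lift_fst (a : T ⟶ X) (b : T ⟶ Y) : prO.lift a b ≫ prO.fst X Y = a := by
  ext1; exact pullback.lift_fst _ _ _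
lemma prO.lift_snd (a : T ⟶ X) (b : T ⟶ Y) : prO.lift a b ≫ prO.snd X Y = b := by
  ext1; exact pullback.lift_snd _ _ _
lemma prO.ext {a b : T ⟶ prO X Y} (h : a ≫ prO.fst X Y = b ≫ prO.fst X Y)
    (h' : a ≫ prO.snd X Y = b ≫ prO.snd X Y) : a = b := by
  ext1
  apply pullback.hom_ext
  · exact congr($h |>.left)
  · exact congr($h' |>.left)
lemma prO.comp_lift {T' : OverR k} (t : T' ⟶ T) (a : T ⟶ X) (b : T ⟶ Y) :
    t ≫ prO.lift a b = prO.lift (t ≫ a) (t ≫ b) := by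
  apply prO.ext
  · rw [Category.assoc, prO.lift_fst, prO.lift_fst]
  · rw [Category.assoc, prO.lift_snd, prO.lift_snd]

/-- product of two maps -/
def prO.map (f : X ⟶ X') (g : Y ⟶ Y') : prO X Y ⟶ prO X' Y' :=
  prO.lift (prO.fst X Y ≫ f) (prO.snd X Y ≫ g)

lemma prO.map_left (f : X ⟶ X') (g : Y ⟶ Y') : (prO.map f g).left =
    pullback.map X.hom Y.hom X'.hom Y'.hom f.left g.left (𝟙 _)
      (by rw [Over.w, Category.comp_id]) (by rw [Over.w, Category.comp_id]) := by
  apply pullback.hom_ext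
  · exact Eq.trans congr($(prO.lift_fst (prO.fst X Y ≫ f) (prO.snd X Y ≫ g)) |>.left)
      (pullback.lift_fst _ _ _).symm
  · exact Eq.trans congr($(prO.lift_snd (prO.fst X Y ≫ f) (prO.snd X Y ≫ g)) |>.left)
      (pullback.lift_snd _ _ _).symm

lemma prO.map_prop (P : MorphismProperty Scheme.{0}) [P.IsStableUnderBaseChange]
    [P.IsStableUnderComposition]
    (f : X ⟶ X') (g : Y ⟶ Y') (hf : P f.left) (hg : P g.left) : P (prO.map f g).left := by
  rw [prO.map_left]
  exact MorphismProperty.pullbackMap (P := P) hf hg (Over.w f).symm (Over.w g).symm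

lemma variety_prO (hX : IsVarietyOver X) (hY : IsVarietyOver Y) : IsVarietyOver (prO X Y) := by
  obtain ⟨_, _, _⟩ := hX
  obtain ⟨_, _, _⟩ := hY
  refine ⟨?_, ?_, ?_⟩
  · exact inferInstanceAs (LocallyOfFiniteType (pullback.fst X.hom Y.hom ≫ X.hom))
  · exact inferInstanceAs (QuasiCompact (pullback.fst X.hom Y.hom ≫ X.hom))
  · exact inferInstanceAs (IsSeparated (pullback.fst X.hom Y.hom ≫ X.hom))

lemma const_of_mono {f : T ⟶ X} (p : SpO k k ⟶ T) (i : X ⟶ Y) [Mono i] (h : IsConstant (f ≫ i)) :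
    IsConstant f := by
  rw [isConstant_iff p] at h ⊢
  rw [← cancel_mono i]
  simpa using h

lemma const_prO {f : T ⟶ prO X Y} (p : SpO k k ⟶ T) (h : IsConstant (f ≫ prO.fst X Y))
    (h' : IsConstant (f ≫ prO.snd X Y)) : IsConstant f := by
  rw [isConstant_iff p] at h h' ⊢
  apply prO.ext
  · simpa using h
  · simpa using h'

def ptGm [IsAlgClosed k] : SpO k k ⟶ GmO k :=
  SpO.map (Classical.choice (by
    obtain ⟨m, hm⟩ := Ideal.exists_maximal (LaurentPolynomial k)
    obtain ⟨ev, -⟩ := exists_ev (k := k) m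
    exact ⟨ev⟩ : Nonempty (LaurentPolynomial k →ₐ[k] k)))

end Prod
end
end

section
open CategoryTheory AlgebraicGeometry Limits
open scoped TensorProduct

noncomputable section
set_option linter.unusedSectionVars false

section GenSm
variable {k : Type} [Field k] [CharZero k] [IsAlgClosed k]

lemma formallySmooth_of_fields {R S : Type} [CommRing R] [CommRing S] (φ : R →+* S) (hR : IsField R)
    (hS : IsField S) (i : k →+* R) (hφ : φ.EssFiniteType) : φ.FormallySmooth := by
  let := hR.toField
  let := hS.toField
  have : CharZero R := charZero_of_injective_ringHom i.injective
  algebraize [φ]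
  exact Algebra.FormallySmooth.of_perfectField

lemma isField_stalk_generic {X : Scheme.{0}} [IsIntegral X] (x : X) (h : IsGenericPoint x ⊤) :
    IsField (X.presheaf.stalk x) := by
  have : x = genericPoint X := h.eq (genericPoint_spec X)
  subst this
  exact Field.toIsField X.functionField

lemma generic_mem_smoothLocus {X Y : OverR k} [IsIntegral X.left] [IsIntegral Y.left]
    (f : X ⟶ Y) [IsDominant f.left] [LocallyOfFinitePresentation f.left] :
    genericPoint X.left ∈ f.left.smoothLocus := by
  rw [Scheme.Hom.mem_smoothLocus]
  have hg : IsGenericPoint (f.left (genericPoint X.left)) ⊤ := by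
    have := (genericPoint_spec X.left).image f.left.continuous
    rwa [Set.image_univ, f.left.denseRange.closure_range] at this
  refine formallySmooth_of_fields (k := k) _ (isField_stalk_generic _ hg)
    (isField_stalk_generic _ (genericPoint_spec _)) ?_ (LocallyOfFiniteType.stalkMap _ _)
  exact ((Y.left.presheaf.germ ⊤ _ trivial).hom.comp (Y.hom.appTop).hom).comp
    (Scheme.ΓSpecIso (CommRingCat.of k)).inv.hom

end GenSm

lemma irreducible_of_locally {X : Type} [TopologicalSpace X] [ConnectedSpace X]
    (h : ∀ x : X, ∃ U : Set X, IsOpen U ∧ IsIrreducible U ∧ x ∈ U) : IrreducibleSpace X := by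
  obtain ⟨x0⟩ : Nonempty X := inferInstance
  let Z := irreducibleComponent x0
  have hZ : IsIrreducible Z := isIrreducible_irreducibleComponent
  have hZo : IsOpen Z := by
    rw [isOpen_iff_forall_mem_open]
    intro x hx
    obtain ⟨U, hUo, hUi, hxU⟩ := h x
    refine ⟨U, ?_, hUo, hxU⟩
    have h1 : Z ⊆ closure U := by
      refine (subset_closure_inter_of_isPreirreducible_of_isOpen hZ.2 hUo ⟨x, hx, hxU⟩).trans ?_
      exact closure_mono Set.inter_subset_right
    have h2 : closure U = Z := eq_irreducibleComponent hUi.closure.2 (h1)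
    exact h2 ▸ subset_closure
  have hZc : IsClosed Z := isClosed_irreducibleComponent
  have : Z = Set.univ := IsClopen.eq_univ ⟨hZc, hZo⟩ ⟨x0, mem_irreducibleComponent⟩
  exact (irreducibleSpace_def X).2 (by rw [Set.top_eq_univ, ← this]; exact hZ)

lemma exists_irreducible_open {X : Type} [TopologicalSpace X] [TopologicalSpace.NoetherianSpace X]
    [Nonempty X] : ∃ U : Set X, IsOpen U ∧ IsIrreducible U := by
  obtain ⟨x⟩ : Nonempty X := inferInstance
  refine ⟨(⋃₀ (irreducibleComponents X \ {irreducibleComponent x}))ᶜ, ?_, ?_⟩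
  · rw [Set.sUnion_eq_biUnion, isOpen_compl_iff]
    exact TopologicalSpace.NoetherianSpace.finite_irreducibleComponents.sdiff.isClosed_biUnion
        fun W hW ↦ isClosed_of_mem_irreducibleComponents W hW.1
  · rw [← isIrreducible_iff_closure, closure_sUnion_irreducibleComponents_sdiff_singleton
      TopologicalSpace.NoetherianSpace.finite_irreducibleComponents
      _ (irreducibleComponent_mem_irreducibleComponents x)]
    exact isIrreducible_irreducibleComponent

section Irr
variable {k : Type} [Field k] [IsAlgClosed k]

lemma noeth_of (X : OverR k) [LocallyOfFiniteType X.hom] [QuasiCompact X.hom] :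
    IsNoetherian X.left :=
  have : CompactSpace X.left := QuasiCompact.compactSpace_of_compactSpace X.hom
  { __ := LocallyOfFiniteType.isLocallyNoetherian X.hom }

lemma GroupScheme.irreducible (Γ : GroupScheme k) [LocallyOfFiniteType Γ.G.hom]
    [QuasiCompact Γ.G.hom] [ConnectedSpace Γ.G.left] : IrreducibleSpace Γ.G.left := by
  have := noeth_of Γ.G
  obtain ⟨U, hUo, hUi⟩ := exists_irreducible_open (X := Γ.G.left)
  obtain ⟨p, hp⟩ := exists_pt_mem Γ.G hUi.1 hUo.isLocallyClosed
  apply irreducible_of_locally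
  intro x
  obtain ⟨q, hq⟩ := exists_pt_mem Γ.G (closure_nonempty_iff.2 (Set.singleton_nonempty x))
    isClosed_closure.isLocallyClosed
  obtain ⟨t, ht⟩ := Γ.exists_tr p q
  have ho : IsOpen ((Γ.tr t).left '' U) := (Γ.tr t).left.isOpenEmbedding.isOpenMap _ hUo
  refine ⟨(Γ.tr t).left '' U, ho,
    hUi.image _ (Γ.tr t).left.continuous.continuousOn, ?_⟩
  have : ptx q ∈ (Γ.tr t).left '' U := by rw [← ht, ptx_comp]; exact ⟨_, hp, rfl⟩
  exact (specializes_iff_mem_closure.2 hq).mem_open ho this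

lemma GroupScheme.integral [CharZero k] (Γ : GroupScheme k) [LocallyOfFiniteType Γ.G.hom]
    [QuasiCompact Γ.G.hom] [ConnectedSpace Γ.G.left] : IsIntegral Γ.G.left :=
  have := Γ.irreducible
  have := Γ.isReduced
  isIntegral_of_irreducibleSpace_of_isReduced _
end Irr
end
end

section
open CategoryTheory AlgebraicGeometry Limits
open scoped TensorProduct

noncomputable section
set_option linter.unusedSectionVars false

section Rel
variable {k : Type} [Field k] [IsAlgClosed k]

lemma groupless_of_mono {X Y : OverR k} (i : X ⟶ Y) [Mono i] (h : IsGroupless k Y) :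
    IsGroupless k X :=
  ⟨fun _ => const_of_mono ptGm i (h.1 _),
    fun Δ hΔ _ => const_of_mono (Δ.one _) i (h.2 Δ hΔ _)⟩

lemma groupless_prO {X Y : OverR k} (h : IsGroupless k X) (h' : IsGroupless k Y) :
    IsGroupless k (prO X Y) :=
  ⟨fun _ => const_prO ptGm (h.1 _) (h'.1 _),
    fun Δ hΔ _ => const_prO (Δ.one _) (h.2 Δ hΔ _) (h'.2 Δ hΔ _)⟩

lemma mono_of_left {X Y : OverR k} (i : X ⟶ Y) [Mono i.left] : Mono i :=
  Over.mono_of_mono_left i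

/-- the diagonal -/
def dg (P : OverR k) : P ⟶ prO P P := prO.lift (𝟙 P) (𝟙 P)

lemma dg_map {P P' : OverR k} (u : P ⟶ P') : dg P ≫ prO.map u u = u ≫ dg P' := by
  rw [dg, dg, prO.map, prO.comp_lift, prO.comp_lift, ← Category.assoc, ← Category.assoc,
    prO.lift_fst, prO.lift_snd, Category.id_comp, Category.comp_id]

lemma lift_map {T A B A' B' : OverR k} (a : T ⟶ A) (b : T ⟶ B) (f : A ⟶ A') (g : B ⟶ B') :
    prO.lift a b ≫ prO.map f g = prO.lift (a ≫ f) (b ≫ g) := by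
  rw [prO.map, prO.comp_lift, ← Category.assoc, ← Category.assoc, prO.lift_fst, prO.lift_snd]

lemma map_map {A B A' B' A'' B'' : OverR k} (f : A ⟶ A') (g : B ⟶ B') (f' : A' ⟶ A'')
    (g' : B' ⟶ B'') : prO.map f g ≫ prO.map f' g' = prO.map (f ≫ f') (g ≫ g') := by
  rw [prO.map, lift_map, prO.map, Category.assoc, Category.assoc]

/-- set of pairs identified by `F`. -/
def rel {G P : OverR k} (F : G ⟶ P) : Set (prO G G).left :=
  (prO.map F F).left ⁻¹' Set.range (dg P).left

lemma isClosedImmersion_dg (P : OverR k) [IsSeparated P.hom] : IsClosedImmersion (dg P).left :=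
  inferInstanceAs (IsClosedImmersion (pullback.diagonal P.hom))

lemma isClosed_rel {G P : OverR k} (F : G ⟶ P) [IsSeparated P.hom] : IsClosed (rel F) := by
  have := isClosedImmersion_dg P
  exact ((dg P).left.isClosedEmbedding.isClosed_range).preimage (prO.map F F).left.continuous

lemma rel_comp {G P P' : OverR k} (F : G ⟶ P) (u : P ⟶ P') : rel F ⊆ rel (F ≫ u) := by
  rintro z ⟨y, hy⟩
  refine ⟨u.left y, ?_⟩
  rw [← map_map]
  change (u ≫ dg P').left y = (prO.map u u).left ((prO.map F F).left z)
  rw [← hy, ← dg_map]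
  rfl

lemma isClosed_pt (X : OverR k) [LocallyOfFiniteType X.hom] (p : SpO k k ⟶ X) :
    IsClosed {ptx p} := by
  have := (pointEquivClosedPoint X.hom ⟨p.left, (Over.w p).trans SpO_self_hom⟩).2
  have h : IsLocalRing.closedPoint k = (⊥ : PrimeSpectrum k) :=
    Subsingleton.elim (α := PrimeSpectrum k) _ _
  change IsClosed {p.left (IsLocalRing.closedPoint k)} at this
  rwa [h] at this

lemma isReduced_image {X Y : Scheme.{0}} (f : X ⟶ Y) [QuasiCompact f] [IsReduced X] :
    IsReduced f.image := by
  apply isReduced_of_cover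
  intro x
  obtain ⟨_, ⟨U, hU, rfl⟩, hxU, -⟩ :=
    Y.isBasis_affineOpens.exists_subset_of_mem_open (Set.mem_univ (f.imageι x)) isOpen_univ
  have hV : IsAffineOpen (f.imageι ⁻¹ᵁ U) := IsAffineOpen.preimage hU _
  have : _root_.IsReduced Γ(f.image, f.imageι ⁻¹ᵁ U) :=
    isReduced_of_injective (f.toImage.app (f.imageι ⁻¹ᵁ U)).hom (f.toImage_app_injective ⟨U, hU⟩)
  refine ⟨_, hV.fromSpec, inferInstance, inferInstance, ?_⟩
  rw [hV.range_fromSpec]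
  exact hxU

lemma mem_rel {G P : OverR k} (F : G ⟶ P) [LocallyOfFiniteType P.hom] [IsSeparated P.hom]
    (a b : SpO k k ⟶ G) : ptx (prO.lift a b) ∈ rel F ↔ a ≫ F = b ≫ F := by
  have := isClosedImmersion_dg P
  have hl : LocallyOfFiniteType (prO P P).hom :=
    inferInstanceAs (LocallyOfFiniteType (pullback.fst P.hom P.hom ≫ P.hom))
  have h0 : (prO.map F F).left (ptx (prO.lift a b)) = ptx (prO.lift (a ≫ F) (b ≫ F)) := by
    rw [← ptx_comp, lift_map]
  rw [rel, Set.mem_preimage, h0]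
  constructor
  · rintro ⟨y, hy⟩
    have hc : IsClosed ({y} : Set P.left) := by
      have hx : IsClosed {ptx (prO.lift (a ≫ F) (b ≫ F))} := isClosed_pt _ _
      rw [← hy] at hx
      have := hx.preimage (dg P).left.continuous
      rwa [← Set.image_singleton, (dg P).left.injective.preimage_image] at this
    obtain ⟨q, rfl⟩ := exists_pt P y hc
    rw [← ptx_comp] at hy
    have h1 := pt_ext _ _ _ hy
    have h2 := congr($h1 ≫ prO.fst _ _)
    have h3 := congr($h1 ≫ prO.snd _ _)
    rw [dg, prO.comp_lift, prO.lift_fst, prO.lift_fst] at h2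
    rw [dg, prO.comp_lift, prO.lift_snd, prO.lift_snd] at h3
    exact h2.symm.trans h3
  · intro h
    refine ⟨ptx (a ≫ F), ?_⟩
    rw [← ptx_comp, dg, prO.comp_lift, Category.comp_id, h]

/-- minimality property -/
def IsMinQ {G P : OverR k} (F : G ⟶ P) : Prop :=
  ∀ {P' : OverR k} (F' : G ⟶ P'), IsVarietyOver P' → IsGroupless k P' →
    ∀ a b : SpO k k ⟶ G, a ≫ F = b ≫ F → a ≫ F' = b ≫ F'

lemma exists_min {G X : OverR k} (f : G ⟶ X) [LocallyOfFiniteType G.hom] [QuasiCompact G.hom]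
    (hX : IsVarietyOver X) (hX' : IsGroupless k X) :
    ∃ (P : OverR k) (F : G ⟶ P), IsVarietyOver P ∧ IsGroupless k P ∧ IsMinQ F := by
  have : LocallyOfFiniteType (prO G G).hom :=
    inferInstanceAs (LocallyOfFiniteType (pullback.fst G.hom G.hom ≫ G.hom))
  have : QuasiCompact (prO G G).hom :=
    inferInstanceAs (QuasiCompact (pullback.fst G.hom G.hom ≫ G.hom))
  have := noeth_of (prO G G)
  let S : Set (TopologicalSpace.Closeds (prO G G).left) :=
    {Z | ∃ (P : OverR k) (F : G ⟶ P), IsVarietyOver P ∧ IsGroupless k P ∧ (Z : Set _) = rel F}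
  have hne : S.Nonempty := by
    have := hX.2.2
    exact ⟨⟨rel f, isClosed_rel f⟩, X, f, hX, hX', rfl⟩
  obtain ⟨Z, ⟨P, F, hP, hP', hZ⟩, hmin⟩ := wellFounded_lt.has_min S hne
  refine ⟨P, F, hP, hP', ?_⟩
  intro P' F' hQ hQ' a b hab
  have hl := variety_prO hP hQ
  have := hl.2.2
  have h1 : rel (prO.lift F F') ⊆ rel F := by
    have := rel_comp (prO.lift F F') (prO.fst P P')
    rwa [prO.lift_fst] at this
  have h2 : rel (prO.lift F F') ⊆ rel F' := by
    have := rel_comp (prO.lift F F') (prO.snd P P')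
    rwa [prO.lift_snd] at this
  have h3 : rel F ⊆ rel (prO.lift F F') := by
    have := hmin ⟨rel (prO.lift F F'), isClosed_rel _⟩ ⟨_, _, hl, groupless_prO hP' hQ', rfl⟩
    by_contra hc
    apply this
    refine lt_of_le_not_ge ?_ ?_
    · intro z hz; change z ∈ (Z : Set _); rw [hZ]; exact h1 hz
    · intro hle; apply hc; rw [← hZ]; exact hle
  obtain ⟨_, _, _⟩ := hP
  obtain ⟨_, _, _⟩ := hQ
  rw [← mem_rel] at hab ⊢
  exact h2 (h3 hab)

lemma exists_image {G P : OverR k} (F : G ⟶ P) [LocallyOfFiniteType G.hom] [QuasiCompact G.hom]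
    [IsReduced G.left] (hP : IsVarietyOver P) (hP' : IsGroupless k P) :
    ∃ (P' : OverR k) (F' : G ⟶ P') (i : P' ⟶ P), F' ≫ i = F ∧ IsVarietyOver P' ∧
      IsGroupless k P' ∧ IsReduced P'.left ∧ IsDominant F'.left := by
  obtain ⟨_, _, _⟩ := hP
  have := noeth_of G
  let i : Over.mk (F.left.imageι ≫ P.hom) ⟶ P := Over.homMk F.left.imageι rfl
  have : Mono i.left := inferInstanceAs (Mono F.left.imageι)
  have := mono_of_left i
  refine ⟨Over.mk (F.left.imageι ≫ P.hom), Over.homMk F.left.toImage ?_, i, ?_, ⟨?_, ?_, ?_⟩,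
    groupless_of_mono i hP', ?_, ?_⟩
  · change F.left.toImage ≫ F.left.imageι ≫ P.hom = G.hom
    rw [Scheme.Hom.toImage_imageι_assoc]; exact Over.w F
  · ext1; exact F.left.toImage_imageι
  · exact inferInstanceAs (LocallyOfFiniteType (F.left.imageι ≫ P.hom))
  · exact inferInstanceAs (QuasiCompact (F.left.imageι ≫ P.hom))
  · exact inferInstanceAs (IsSeparated (F.left.imageι ≫ P.hom))
  · exact isReduced_image F.left
  · exact inferInstanceAs (IsDominant F.left.toImage)

end Rel
end
end

section
open CategoryTheory AlgebraicGeometry Limits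
open scoped TensorProduct

noncomputable section
set_option linter.unusedSectionVars false

lemma open_of_section {P1 P : Scheme.{0}} (V : P.Opens) (σ : V.toScheme ⟶ P1) (p : P1 ⟶ P)
    [IsSeparated p] [IsReduced P1] (h : σ ≫ p = V.ι)
    (hd : ∀ O : Set P1, IsOpen O → O.Nonempty → O ⊆ p ⁻¹' V → ∃ o ∈ O, o ∈ Set.range σ) :
    IsOpenImmersion σ := by
  let W := p ⁻¹ᵁ V
  have hr : Set.range σ ⊆ Set.range W.ι := by
    rw [Scheme.Opens.range_ι]
    rintro _ ⟨x, rfl⟩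
    change p (σ x) ∈ V
    have : (σ ≫ p) x = V.ι x := by rw [h]
    rw [← Scheme.Hom.comp_apply, this]
    exact x.2
  let σ' : V.toScheme ⟶ W.toScheme := IsOpenImmersion.lift W.ι σ hr
  have hσ' : σ' ≫ W.ι = σ := IsOpenImmersion.lift_fac _ _ _
  have hid : σ' ≫ (p ∣_ V) = 𝟙 _ := by
    rw [← cancel_mono V.ι, Category.assoc, morphismRestrict_ι, ← Category.assoc, hσ', h,
      Category.id_comp]
  have : IsClosedImmersion σ' := by
    have : IsClosedImmersion (σ' ≫ (p ∣_ V)) := by rw [hid]; infer_instance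
    exact IsClosedImmersion.of_comp σ' (p ∣_ V)
  have : Surjective σ' := by
    constructor
    rw [← Set.range_eq_univ]
    by_contra hne
    have hne' : (Set.range σ')ᶜ.Nonempty := Set.nonempty_compl.2 hne
    have ho : IsOpen (Set.range σ')ᶜ := σ'.isClosedEmbedding.isClosed_range.isOpen_compl
    obtain ⟨o, ⟨w, hw, rfl⟩, v, hv⟩ := hd (W.ι '' (Set.range σ')ᶜ)
      (W.ι.isOpenEmbedding.isOpenMap _ ho) (hne'.image _) (by
        rintro _ ⟨w, -, rfl⟩
        exact w.2)
    apply hw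
    refine ⟨v, W.ι.injective ?_⟩
    rw [← hv, ← hσ']; rfl
  have : IsIso σ' := isIso_of_isClosedImmersion_of_surjective σ'
  rw [← hσ']
  infer_instance

section L
variable {k : Type} [Field k] [CharZero k] [IsAlgClosed k]

lemma lift_pt {A B : OverR k} (h : A ⟶ B) [Surjective h.left] [LocallyOfFiniteType A.hom]
    [LocallyOfFiniteType B.hom] (b : SpO k k ⟶ B) : ∃ a : SpO k k ⟶ A, a ≫ h = b := by
  obtain ⟨x, hx⟩ := h.left.surjective (ptx b)
  obtain ⟨a, ha⟩ := exists_pt_mem A (Z := h.left ⁻¹' {ptx b}) ⟨x, hx⟩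
    ((isClosed_pt B b).preimage h.left.continuous).isLocallyClosed
  exact ⟨a, pt_ext _ _ _ ha⟩

/-- smooth points -/
def smL {G P : OverR k} (F : G ⟶ P) : Set G.left :=
  {x | (F.left.stalkMap x).hom.FormallySmooth}

lemma lft_left {G P : OverR k} (F : G ⟶ P) [LocallyOfFiniteType G.hom] :
    LocallyOfFiniteType F.left :=
  have : LocallyOfFiniteType (F.left ≫ P.hom) := by rw [Over.w F]; infer_instance
  locallyOfFiniteType_of_comp F.left P.hom

lemma lfp_left {G P : OverR k} (F : G ⟶ P) [LocallyOfFiniteType G.hom]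
    [LocallyOfFiniteType P.hom] :
    LocallyOfFinitePresentation F.left :=
  have := lft_left F
  have : IsLocallyNoetherian P.left := LocallyOfFiniteType.isLocallyNoetherian P.hom
  inferInstance

lemma sep_left {G P : OverR k} (F : G ⟶ P) [IsSeparated G.hom] :
    IsSeparated F.left :=
  have : IsSeparated (F.left ≫ P.hom) := by rw [Over.w F]; infer_instance
  IsSeparated.of_comp F.left P.hom

lemma smooth_of_comp_mono {X Y Z : Scheme.{0}} (f : X ⟶ Y) (g : Y ⟶ Z) [Mono g] [Smooth (f ≫ g)] :
    Smooth f :=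
  have : MorphismProperty.HasOfPostcompProperty @Smooth (MorphismProperty.monomorphisms Scheme.{0}) :=
    MorphismProperty.IsStableUnderBaseChange.hasOfPostcompProperty_monomorphisms
  MorphismProperty.of_postcomp (W := @Smooth) (W' := MorphismProperty.monomorphisms _) f g
    (inferInstanceAs (Mono g)) inferInstance

/-- open subscheme as an over-object -/
def opO (X : OverR k) (U : X.left.Opens) : OverR k := Over.mk (U.ι ≫ X.hom)
/-- inclusion -/
def opO.ι (X : OverR k) (U : X.left.Opens) : opO X U ⟶ X := Over.homMk U.ι rfl

instance (X : OverR k) (U : X.left.Opens) : IsOpenImmersion (opO.ι X U).left :=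
  inferInstanceAs (IsOpenImmersion U.ι)
instance (X : OverR k) (U : X.left.Opens) : Mono (opO.ι X U) := mono_of_left _

/-- lift to an open subscheme -/
def opO.lift {T X : OverR k} (U : X.left.Opens) (f : T ⟶ X) (h : Set.range f.left ⊆ U) :
    T ⟶ opO X U :=
  Over.homMk (V := opO X U) ((IsOpenImmersion.lift U.ι f.left (by rwa [U.range_ι]) :
      T.left ⟶ U.toScheme)) (by
    change IsOpenImmersion.lift U.ι f.left _ ≫ U.ι ≫ X.hom = _
    rw [IsOpenImmersion.lift_fac_assoc]; exact Over.w f)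

lemma opO.lift_ι {T X : OverR k} (U : X.left.Opens) (f : T ⟶ X) (h : Set.range f.left ⊆ U) :
    opO.lift U f h ≫ opO.ι X U = f := by
  ext1; exact IsOpenImmersion.lift_fac U.ι f.left _

/-- image of a smooth map -/
def imO {A P : OverR k} (F : A ⟶ P) [Smooth F.left] : P.left.Opens :=
  ⟨Set.range F.left, F.left.isOpenMap.isOpen_range⟩

/-- corestriction to the image -/
def toIm {A P : OverR k} (F : A ⟶ P) [Smooth F.left] : A ⟶ opO P (imO F) :=
  opO.lift _ F subset_rfl

lemma toIm_ι {A P : OverR k} (F : A ⟶ P) [Smooth F.left] : toIm F ≫ opO.ι _ _ = F :=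
  opO.lift_ι _ _ _

instance {A P : OverR k} (F : A ⟶ P) [Smooth F.left] : Smooth (toIm F).left := by
  have : Smooth ((toIm F).left ≫ (opO.ι P (imO F)).left) := by
    change Smooth (toIm F ≫ opO.ι P (imO F)).left
    rw [toIm_ι]; infer_instance
  exact smooth_of_comp_mono _ (opO.ι P (imO F)).left

instance {A P : OverR k} (F : A ⟶ P) [Smooth F.left] : Surjective (toIm F).left := by
  constructor
  intro v
  obtain ⟨x, hx⟩ := v.2
  refine ⟨x, (imO F).ι.injective ?_⟩
  change (toIm F ≫ opO.ι P (imO F)).left x = _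
  rw [toIm_ι]; exact hx

lemma epi_of_smooth {A B : OverR k} (h : A ⟶ B) [Smooth h.left] [Surjective h.left] : Epi h :=
  have : Epi h.left := inferInstance
  Over.epi_of_epi_left h

theorem lemmaL {G P P1 : OverR k} [Smooth G.hom] (F : G ⟶ P) (F1 : G ⟶ P1) (p : P1 ⟶ P)
    (hp : F1 ≫ p = F) (hP : IsVarietyOver P) (hP1 : IsVarietyOver P1) (hP1' : IsGroupless k P1)
    [IsReduced P1.left] [IsDominant F1.left] (hm : IsMinQ F) : smL F ⊆ smL F1 := by
  obtain ⟨_, _, _⟩ := hP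
  obtain ⟨_, _, _⟩ := id hP1
  have := lfp_left F
  have := lfp_left F1
  have := sep_left p
  let S := F.left.smoothLocus
  let sι := opO.ι G S
  have hs1 : Smooth (sι ≫ F).left := by
    change Smooth (S.ι ≫ F.left)
    rw [← Scheme.Hom.smoothLocus_eq_top_iff, ← Scheme.Hom.preimage_smoothLocus_eq]
    exact S.ι_preimage_self
  let V := imO (sι ≫ F)
  let h := toIm (sι ≫ F)
  have hh : h ≫ opO.ι P V = sι ≫ F := toIm_ι _
  have : Smooth (opO G S).hom := inferInstanceAs (Smooth (S.ι ≫ G.hom))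
  have hmin : ∀ a a' : SpO k k ⟶ G, a ≫ F = a' ≫ F → a ≫ F1 = a' ≫ F1 :=
    fun a a' => hm F1 hP1 hP1' a a'
  obtain ⟨σ, hσ⟩ := descend h (sι ≫ F1) (by
    intro a a' haa
    rw [← Category.assoc, ← Category.assoc]
    apply hmin
    rw [Category.assoc, Category.assoc, ← hh, ← Category.assoc, haa, Category.assoc])
  have := epi_of_smooth h
  have hsec : σ ≫ p = opO.ι P V := by
    rw [← cancel_epi h, ← Category.assoc, hσ, hh, Category.assoc, hp]
  have : IsOpenImmersion σ.left := by
    refine open_of_section V σ.left p.left congr($hsec |>.left) ?_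
    intro O hO hne hOV
    obtain ⟨x, hx⟩ := F1.left.denseRange.exists_mem_open hO hne
    obtain ⟨a, ha⟩ := exists_pt_mem G (Z := F1.left ⁻¹' O) ⟨x, hx⟩
      (hO.preimage F1.left.continuous).isLocallyClosed
    refine ⟨F1.left (ptx a), ha, ?_⟩
    obtain ⟨y, hy⟩ : p.left (F1.left (ptx a)) ∈ V := hOV ha
    have hFa : ptx (a ≫ F) = p.left (F1.left (ptx a)) := by rw [← hp]; rfl
    have : LocallyOfFiniteType (opO P V).hom :=
      inferInstanceAs (LocallyOfFiniteType (V.ι ≫ P.hom))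
    have hrange : Set.range (a ≫ F).left ⊆ V := by
      rw [range_pt, Set.singleton_subset_iff, hFa]; exact hOV ha
    obtain ⟨s, hs⟩ := lift_pt h (opO.lift V (a ≫ F) hrange)
    have h1 : (s ≫ sι) ≫ F = a ≫ F := by
      rw [Category.assoc, ← hh, ← Category.assoc, hs, opO.lift_ι]
    have h2 := hmin _ _ h1
    rw [← ptx_comp, ← h2, Category.assoc, ← hσ]
    exact ⟨h.left (ptx s), rfl⟩
  have hs2 : Smooth (S.ι ≫ F1.left) := by
    have : Smooth (h ≫ σ).left := inferInstanceAs (Smooth (h.left ≫ σ.left))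
    rw [hσ] at this
    exact this
  have := (S.ι ≫ F1.left).smoothLocus_eq_top
  rw [← Scheme.Hom.preimage_smoothLocus_eq] at this
  intro x hx
  have h3 : (⟨x, hx⟩ : S) ∈ S.ι ⁻¹ᵁ F1.left.smoothLocus := by rw [this]; trivial
  exact h3

end L
end
end

section
open CategoryTheory AlgebraicGeometry Limits
open scoped TensorProduct

noncomputable section
set_option linter.unusedSectionVars false

section Sm
variable {k : Type} [Field k] [CharZero k] [IsAlgClosed k]

lemma IsMinQ.of_comp {G P P' : OverR k} {F : G ⟶ P} {i : P ⟶ P'} (h : IsMinQ (F ≫ i)) :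
    IsMinQ F := by
  intro Y F' hY hY' a b hab
  apply h F' hY hY'
  rw [← Category.assoc, hab, Category.assoc]

lemma IsMinQ.tr {P : OverR k} (Γ : GroupScheme k) {F : Γ.G ⟶ P} (h : IsMinQ F)
    (t : SpO k k ⟶ Γ.G) : IsMinQ (Γ.tr t ≫ F) := by
  intro Y F' hY hY' a b hab
  have := h (inv (Γ.tr t) ≫ F') hY hY' (a ≫ Γ.tr t) (b ≫ Γ.tr t) (by
    rw [Category.assoc, hab, Category.assoc])
  simpa using this

lemma isOpen_smL {G P : OverR k} (F : G ⟶ P) [LocallyOfFiniteType G.hom]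
    [LocallyOfFiniteType P.hom] : IsOpen (smL F) :=
  have := lfp_left F
  F.left.smoothLocus.2

theorem exists_smooth_min (Γ : GroupScheme k) [LocallyOfFiniteType Γ.G.hom]
    [QuasiCompact Γ.G.hom] [ConnectedSpace Γ.G.left] {X : OverR k} (f : Γ.G ⟶ X)
    (hX : IsVarietyOver X) (hX' : IsGroupless k X) :
    ∃ (P : OverR k) (F : Γ.G ⟶ P), IsVarietyOver P ∧ IsGroupless k P ∧ IsMinQ F ∧
      Smooth F.left := by
  have := Γ.integral
  have := Γ.smooth
  have := noeth_of Γ.G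
  let S : Set (TopologicalSpace.Opens Γ.G.left) :=
    {Z | ∃ (P : OverR k) (F : Γ.G ⟶ P), IsVarietyOver P ∧ IsGroupless k P ∧ IsReduced P.left ∧
      IsDominant F.left ∧ IsMinQ F ∧ (Z : Set _) = smL F}
  have hne : S.Nonempty := by
    obtain ⟨P, F, hP, hP', hm⟩ := exists_min f hX hX'
    obtain ⟨P', F', i, hi, hv, hg, hr, hd⟩ := exists_image F hP hP'
    have := hv.1
    rw [← hi] at hm
    exact ⟨⟨smL F', isOpen_smL F'⟩, P', F', hv, hg, hr, hd, hm.of_comp, rfl⟩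
  obtain ⟨Z, ⟨P, F, hP, hP', _, _, hm, hZ⟩, hmax⟩ := wellFounded_gt.has_min S hne
  refine ⟨P, F, hP, hP', hm, ?_⟩
  have := hP.1
  have := lfp_left F
  have : IrreducibleSpace P.left := by
    rw [irreducibleSpace_def, Set.top_eq_univ, ← F.left.denseRange.closure_range,
      isIrreducible_iff_closure, ← Set.image_univ]
    exact ((irreducibleSpace_def _).1 inferInstance).image _ F.left.continuous.continuousOn
  have : IsIntegral P.left := isIntegral_of_irreducibleSpace_of_isReduced _
  obtain ⟨x0, hx0⟩ := exists_pt_mem Γ.G (Z := smL F) ⟨_, generic_mem_smoothLocus F⟩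
    (isOpen_smL F).isLocallyClosed
  have huniv : smL F = Set.univ := by
    refine closure_eq_of_pts Γ.G (isOpen_smL F) fun q => ?_
    obtain ⟨t, ht⟩ := Γ.exists_tr q x0
    have h2 : ptx q ∈ smL (Γ.tr t ≫ F) := by
      have : LocallyOfFinitePresentation ((Γ.tr t).left ≫ F.left) := inferInstance
      have : ptx q ∈ (Γ.tr t).left ⁻¹ᵁ F.left.smoothLocus := by
        change ptx (q ≫ Γ.tr t) ∈ smL F
        rw [ht]; exact hx0
      rw [Scheme.Hom.preimage_smoothLocus_eq] at this
      exact this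
    obtain ⟨P1, F1, i, hi, hv, hg, hr, hd⟩ := exists_image (prO.lift F (Γ.tr t ≫ F))
      (variety_prO hP hP) (groupless_prO hP' hP')
    have e1 : F1 ≫ i ≫ prO.fst _ _ = F := by rw [← Category.assoc, hi, prO.lift_fst]
    have e2 : F1 ≫ i ≫ prO.snd _ _ = Γ.tr t ≫ F := by rw [← Category.assoc, hi, prO.lift_snd]
    have l1 := lemmaL F F1 _ e1 hP hv hg hm
    have l2 := lemmaL _ F1 _ e2 hP hv hg (hm.tr Γ t)
    have hm1 : IsMinQ F1 := by
      rw [← e1] at hm; exact hm.of_comp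
    have := hv.1
    have hle : smL F1 ⊆ smL F := by
      by_contra hc
      refine hmax ⟨smL F1, isOpen_smL F1⟩ ⟨P1, F1, hv, hg, hr, hd, hm1, rfl⟩ ?_
      refine lt_of_le_not_ge ?_ ?_
      · intro z hz; change z ∈ (Z : Set _) at hz; rw [hZ] at hz; exact l1 hz
      · intro hle; apply hc; rw [← hZ]; exact hle
    exact hle (l2 h2)
  rw [← Scheme.Hom.smoothLocus_eq_top_iff, ← TopologicalSpace.Opens.coe_eq_univ]
  exact huniv
end Sm
end
end

section
open CategoryTheory AlgebraicGeometry Limits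
open scoped TensorProduct

noncomputable section
set_option linter.unusedSectionVars false

section Quo
variable {k : Type} [Field k] [CharZero k] [IsAlgClosed k]

lemma exists_cover {G Q T : OverR k} (h : G ⟶ Q) [Smooth h.left] [Surjective h.left] (a : T ⟶ Q) :
    ∃ (T' : OverR k) (u : T' ⟶ T) (x : T' ⟶ G), Epi u ∧ u ≫ a = x ≫ h := by
  let T' : OverR k := Over.mk (pullback.fst a.left h.left ≫ T.hom)
  let u : T' ⟶ T := Over.homMk (pullback.fst a.left h.left) rfl
  let x : T' ⟶ G := Over.homMk (pullback.snd a.left h.left) (by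
    change pullback.snd a.left h.left ≫ G.hom = pullback.fst a.left h.left ≫ T.hom
    rw [← Over.w h, ← Over.w a, pullback.condition_assoc])
  have : Smooth u.left := inferInstanceAs (Smooth (pullback.fst a.left h.left))
  have : Surjective u.left := inferInstanceAs (Surjective (pullback.fst a.left h.left))
  refine ⟨T', u, x, epi_of_smooth u, ?_⟩
  ext1
  exact pullback.condition

lemma exists_cover3 {G Q T : OverR k} (h : G ⟶ Q) [Smooth h.left] [Surjective h.left]
    (a b c : T ⟶ Q) :
    ∃ (T' : OverR k) (u : T' ⟶ T) (x y z : T' ⟶ G), Epi u ∧ u ≫ a = x ≫ h ∧ u ≫ b = y ≫ h ∧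
      u ≫ c = z ≫ h := by
  obtain ⟨T1, u1, x1, _, h1⟩ := exists_cover h a
  obtain ⟨T2, u2, x2, _, h2⟩ := exists_cover h (u1 ≫ b)
  obtain ⟨T3, u3, x3, _, h3⟩ := exists_cover h (u2 ≫ u1 ≫ c)
  refine ⟨T3, u3 ≫ u2 ≫ u1, u3 ≫ u2 ≫ x1, u3 ≫ x2, x3, inferInstance, ?_, ?_, ?_⟩
  · simp [h1]
  · simp [h2]
  · simpa using h3

theorem exists_quot (Γ : GroupScheme k) [LocallyOfFiniteType Γ.G.hom] {Q : OverR k}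
    (h : Γ.G ⟶ Q) [Smooth h.left] [Surjective h.left] (hQ : IsVarietyOver Q)
    (hQ' : IsGroupless k Q) (hm : IsMinQ h) : ∃ Γ' : GroupScheme k, Γ'.G = Q := by
  obtain ⟨_, _, _⟩ := id hQ
  have := Γ.smooth
  have hmr : ∀ a b c : SpO k k ⟶ Γ.G, a ≫ h = b ≫ h → (a * c) ≫ h = (b * c) ≫ h := by
    intro a b c hab
    have := hm (Γ.tr c ≫ h) hQ hQ' a b hab
    rwa [← Category.assoc, ← Category.assoc, Γ.pt_tr, Γ.pt_tr] at this
  have hml : ∀ a b c : SpO k k ⟶ Γ.G, a ≫ h = b ≫ h → (c * a) ≫ h = (c * b) ≫ h := by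
    intro a b c hab
    have key : ∀ a : SpO k k ⟶ Γ.G, a ≫ ((toPt Γ.G ≫ c) * 𝟙 Γ.G) = c * a := by
      intro a
      rw [Γ.comp_mul, Category.comp_id, ← Category.assoc, comp_toPt, toPt_self, Category.id_comp]
    have := hm (((toPt Γ.G ≫ c) * 𝟙 Γ.G) ≫ h) hQ hQ' a b hab
    rwa [← Category.assoc, ← Category.assoc, key, key] at this
  have s1 : Smooth (prO.map h h).left := prO.map_prop @Smooth h h inferInstance inferInstance
  have : MorphismProperty.IsStableUnderComposition @Surjective.{0} :=
    ⟨fun f g (_ : Surjective f) (_ : Surjective g) => inferInstanceAs (Surjective (f ≫ g))⟩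
  have s2 : Surjective (prO.map h h).left :=
    prO.map_prop @Surjective h h inferInstance inferInstance
  have s3 : Smooth (prO Γ.G Γ.G).hom :=
    inferInstanceAs (Smooth (pullback.fst Γ.G.hom Γ.G.hom ≫ Γ.G.hom))
  obtain ⟨μ, hμ⟩ := descend (prO.map h h) ((prO.fst Γ.G Γ.G * prO.snd Γ.G Γ.G) ≫ h) (by
    intro a a' haa
    have e1 := congr($haa ≫ prO.fst _ _)
    have e2 := congr($haa ≫ prO.snd _ _)
    rw [Category.assoc, Category.assoc, prO.map, prO.lift_fst, ← Category.assoc,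
      ← Category.assoc] at e1
    rw [Category.assoc, Category.assoc, prO.map, prO.lift_snd, ← Category.assoc,
      ← Category.assoc] at e2
    rw [← Category.assoc, ← Category.assoc, Γ.comp_mul, Γ.comp_mul]
    exact (hmr _ _ _ e1).trans (hml _ _ _ e2))
  obtain ⟨ν, hν⟩ := descend h ((𝟙 Γ.G)⁻¹ ≫ h) (by
    intro a a' haa
    rw [← Category.assoc, ← Category.assoc, Γ.comp_inv, Γ.comp_inv, Category.comp_id,
      Category.comp_id]
    have := hml _ _ a'⁻¹ (hmr _ _ a⁻¹ haa)
    rw [mul_inv_cancel, mul_one, inv_mul_cancel_left] at this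
    exact this.symm)
  have hμ' : ∀ {T : OverR k} (x y : T ⟶ Γ.G), prO.lift (x ≫ h) (y ≫ h) ≫ μ = (x * y) ≫ h := by
    intro T x y
    rw [← lift_map, Category.assoc, hμ, ← Category.assoc, Γ.comp_mul, prO.lift_fst, prO.lift_snd]
  have hν' : ∀ {T : OverR k} (x : T ⟶ Γ.G), (x ≫ h) ≫ ν = x⁻¹ ≫ h := by
    intro T x
    rw [Category.assoc, hν, ← Category.assoc, Γ.comp_inv, Category.comp_id]
  refine ⟨{ G := Q
            mul := fun a b => prO.lift a b ≫ μ
            one := fun T => (1 : T ⟶ Γ.G) ≫ h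
            inv := fun a => a ≫ ν
            mul_assoc := ?_, one_mul := ?_, inv_mul := ?_, mul_natural := ?_,
            one_natural := ?_ }, rfl⟩
  · intro T a b c
    obtain ⟨T', u, x, y, z, _, ha, hb, hc⟩ := exists_cover3 h a b c
    rw [← cancel_epi u]
    simp only [← Category.assoc, prO.comp_lift, ha, hb, hc, hμ', _root_.mul_assoc]
  · intro T a
    obtain ⟨T', u, x, _, ha⟩ := exists_cover h a
    rw [← cancel_epi u]
    simp only [← Category.assoc, prO.comp_lift, ha, hμ', Γ.comp_one, _root_.one_mul]
  · intro T a
    obtain ⟨T', u, x, _, ha⟩ := exists_cover h a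
    rw [← cancel_epi u]
    simp only [← Category.assoc, prO.comp_lift, ha, hμ', hν', Γ.comp_one, _root_.inv_mul_cancel]
  · intro T T' f a b
    simp only [← Category.assoc, prO.comp_lift]
  · intro T T' f
    simp only [← Category.assoc, Γ.comp_one]

end Quo
end
end

section
open CategoryTheory AlgebraicGeometry Limits
open scoped TensorProduct

noncomputable section
set_option linter.unusedSectionVars false

variable {k : Type} [Field k] [IsAlgClosed k] [CharZero k]

lemma id_const_of_group (Γ' : GroupScheme k) (hQ : IsVarietyOver Γ'.G) (hQ' : IsGroupless k Γ'.G)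
    [ConnectedSpace Γ'.G.left] : IsConstant (𝟙 Γ'.G) := by
  obtain ⟨h1, h2, h3⟩ := hQ
  have hp : IsProper Γ'.G.hom := by
    refine proper_of_arcs (FractionRing (PowerSeries k)) Γ'.G fun g => ?_
    by_contra hg
    obtain ⟨f, hf⟩ := exists_Gm Γ' h1 g hg
    exact hf (hQ'.1 f)
  exact hQ'.2 Γ' ⟨⟨h1, h2, inferInstance⟩, hp⟩ (𝟙 _)

lemma id_const_of_quot (Γ : GroupScheme k) [LocallyOfFiniteType Γ.G.hom] [ConnectedSpace Γ.G.left]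
    {Q : OverR k} (h : Γ.G ⟶ Q) [Smooth h.left] [Surjective h.left]
    (hQ : IsVarietyOver Q) (hQ' : IsGroupless k Q) (hm : IsMinQ h) : IsConstant (𝟙 Q) := by
  have : ConnectedSpace Q.left :=
    h.left.surjective.connectedSpace h.left.continuous
  obtain ⟨Γ', rfl⟩ := exists_quot Γ h hQ hQ' hm
  exact id_const_of_group Γ' hQ hQ'

theorem forward (X : OverR k) (hX : IsVarietyOver X) (hX' : IsGroupless k X)
    (Γ : GroupScheme k) (hΓ : Γ.IsFiniteTypeConnected) (f : Γ.G ⟶ X) : IsConstant f := by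
  obtain ⟨h1, h2, h3⟩ := hΓ
  obtain ⟨P, F, hP, hP', hF, hs⟩ := exists_smooth_min Γ f hX hX'
  have hQ : IsVarietyOver (opO P (imO F)) := by
    obtain ⟨a1, a2, a3⟩ := hP
    have := noeth_of P
    refine ⟨inferInstanceAs (LocallyOfFiniteType ((imO F).ι ≫ P.hom)),
      inferInstanceAs (QuasiCompact ((imO F).ι ≫ P.hom)),
      inferInstanceAs (IsSeparated ((imO F).ι ≫ P.hom))⟩
  have hm : IsMinQ (toIm F) := IsMinQ.of_comp (i := opO.ι _ _) (by rwa [toIm_ι])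
  have hc := id_const_of_quot Γ (toIm F) hQ (groupless_of_mono (opO.ι _ _) hP') hm
  have hred := Γ.isReduced
  obtain ⟨x1, x2, x3⟩ := hX
  rw [isConstant_iff ((1 : SpO k k ⟶ Γ.G) ≫ toIm F)] at hc
  rw [isConstant_iff (1 : SpO k k ⟶ Γ.G)]
  refine hom_ext_pts _ _ fun p => ?_
  have e : p ≫ toIm F = (1 : SpO k k ⟶ Γ.G) ≫ toIm F := by
    have := congrArg (fun t => (p ≫ toIm F) ≫ t) hc
    simp only [Category.comp_id] at this
    rw [this, ← Category.assoc, comp_toPt, toPt_self, Category.id_comp]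
  have := hm f ⟨x1, x2, x3⟩ hX' _ _ e
  rw [this, ← Category.assoc p, comp_toPt, toPt_self, Category.id_comp]

end
end

section
open CategoryTheory AlgebraicGeometry Limits
open scoped TensorProduct

noncomputable section
set_option linter.unusedSectionVars false

section Gm
open scoped LaurentPolynomial

/-- The ring map on global sections attached to a morphism to an affine scheme. -/
def rhm {Y : Scheme.{0}} {A : Type} [CommRing A] (g : Y ⟶ Spec (CommRingCat.of A)) :
    A →+* Γ(Y, ⊤) := ((Scheme.ΓSpecIso (CommRingCat.of A)).inv ≫ g.appTop).hom

lemma rhm_comp {Y Z : Scheme.{0}} {A : Type} [CommRing A] (f : Z ⟶ Y)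
    (g : Y ⟶ Spec (CommRingCat.of A)) : rhm (f ≫ g) = f.appTop.hom.comp (rhm g) := by
  simp only [rhm, Scheme.Hom.comp_appTop]
  rfl

lemma rhm_map {Y : Scheme.{0}} {A B : Type} [CommRing A] [CommRing B]
    (g : Y ⟶ Spec (CommRingCat.of A)) (φ : B →+* A) :
    rhm (g ≫ Spec.map (CommRingCat.ofHom φ)) = (rhm g).comp φ := by
  have h := Scheme.ΓSpecIso_inv_naturality (CommRingCat.ofHom φ)
  simp only [rhm, Scheme.Hom.comp_appTop]
  rw [← Category.assoc, ← h]
  rfl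

lemma rhm_inj {Y : Scheme.{0}} {A : Type} [CommRing A] {f g : Y ⟶ Spec (CommRingCat.of A)}
    (h : rhm f = rhm g) : f = g :=
  AlgebraicGeometry.ext_to_Spec (CommRingCat.hom_ext h)

lemma rhm_surj {Y : Scheme.{0}} {A : Type} [CommRing A] (φ : A →+* Γ(Y, ⊤)) :
    ∃ f : Y ⟶ Spec (CommRingCat.of A), rhm f = φ := by
  refine ⟨(ΓSpec.adjunction.homEquiv Y (Opposite.op (CommRingCat.of A)))
    (CommRingCat.ofHom φ).op, ?_⟩
  have := ΓSpecIso_inv_ΓSpec_adjunction_homEquiv (X := Y) (CommRingCat.ofHom φ)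
  exact congrArg CommRingCat.Hom.hom this

variable {k : Type} [Field k]

/-- The coordinate unit. -/
def tU : k[T;T⁻¹]ˣ := (LaurentPolynomial.isUnit_T (R := k) 1).unit

/-- The underlying morphism of a point of `𝔾ₘ`. -/
def gmL {T : OverR k} (a : T ⟶ GmO k) : T.left ⟶ Spec (CommRingCat.of k[T;T⁻¹]) := a.left

/-- The unit attached to a point of `𝔾ₘ`. -/
def gmE {T : OverR k} (a : T ⟶ GmO k) : Γ(T.left, ⊤)ˣ :=
  Units.map (rhm (gmL a)).toMonoidHom tU

lemma gmE_val {T : OverR k} (a : T ⟶ GmO k) :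
    (gmE a : Γ(T.left, ⊤)) = rhm (gmL a) (LaurentPolynomial.T 1) := rfl

lemma gmE_comp {T T' : OverR k} (f : T' ⟶ T) (a : T ⟶ GmO k) :
    gmE (f ≫ a) = Units.map f.left.appTop.hom.toMonoidHom (gmE a) := by
  ext
  rw [gmE_val]
  have : gmL (f ≫ a) = f.left ≫ gmL a := rfl
  rw [this, rhm_comp]
  rfl

lemma gm_w {T : OverR k} (a : T ⟶ GmO k) :
    (rhm (gmL a)).comp (algebraMap k k[T;T⁻¹]) = rhm T.hom := by
  rw [← rhm_map]
  congr 1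
  exact Over.w a

lemma gmE_inj {T : OverR k} : Function.Injective (gmE (T := T)) := by
  intro a b h
  apply Over.OverMorphism.ext
  apply rhm_inj (A := k[T;T⁻¹])
  have h1 : rhm (gmL a) (LaurentPolynomial.T 1)
    = rhm (gmL b) (LaurentPolynomial.T 1) := congrArg Units.val h
  have h2 := (gm_w a).trans (gm_w b).symm
  change rhm (gmL a) = rhm (gmL b)
  apply IsLocalization.ringHom_ext (Submonoid.powers (Polynomial.X : Polynomial k))
  apply Polynomial.ringHom_ext
  · intro r
    have := RingHom.congr_fun h2 r
    simpa [LaurentPolynomial.algebraMap_eq_toLaurent] using this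
  · simpa [LaurentPolynomial.algebraMap_eq_toLaurent] using h1

lemma gmE_surj {T : OverR k} : Function.Surjective (gmE (T := T)) := by
  intro u
  obtain ⟨f, hf⟩ := rhm_surj (Y := T.left) (LaurentPolynomial.eval₂ (rhm T.hom) u)
  have hw : f ≫ (GmO k).hom = T.hom := by
    apply rhm_inj (A := k)
    change rhm (f ≫ Spec.map (CommRingCat.ofHom (algebraMap k k[T;T⁻¹]))) = _
    rw [rhm_map, hf]
    ext r
    simp
  refine ⟨Over.homMk f hw, ?_⟩
  ext
  rw [gmE_val]
  change rhm f _ = _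
  rw [hf, LaurentPolynomial.eval₂_T]
  simp

/-- Points of `𝔾ₘ` are units. -/
def gmEq (T : OverR k) : (T ⟶ GmO k) ≃ Γ(T.left, ⊤)ˣ :=
  Equiv.ofBijective gmE ⟨gmE_inj, gmE_surj⟩

lemma gmEq_comp {T T' : OverR k} (f : T' ⟶ T) (a : T ⟶ GmO k) :
    gmEq T' (f ≫ a) = Units.map f.left.appTop.hom.toMonoidHom (gmEq T a) := gmE_comp f a

variable (k) in
/-- `𝔾ₘ` as a group scheme. -/
def GmGroup : GroupScheme k where
  G := GmO k
  mul {T} a b := (gmEq T).symm (gmEq T a * gmEq T b)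
  one T := (gmEq T).symm 1
  inv {T} a := (gmEq T).symm (gmEq T a)⁻¹
  mul_assoc a b c := by simp [_root_.mul_assoc]
  one_mul a := by simp
  inv_mul a := by simp
  mul_natural {T T'} f a b := by
    apply (gmEq T).injective
    simp only [gmEq_comp, Equiv.apply_symm_apply, map_mul]
  one_natural {T T'} f := by
    apply (gmEq T).injective
    simp only [gmEq_comp, Equiv.apply_symm_apply, map_one]

lemma GmGroup_ftc : (GmGroup k).IsFiniteTypeConnected := by
  refine ⟨?_, ?_, ?_⟩
  · change LocallyOfFiniteType (Spec.map (CommRingCat.ofHom (algebraMap k k[T;T⁻¹])))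
    rw [HasRingHomProperty.Spec_iff (P := @LocallyOfFiniteType)]
    have : Algebra.FiniteType k k[T;T⁻¹] := AddMonoidAlgebra.finiteType_of_fg k ℤ
    exact RingHom.finiteType_algebraMap.mpr this
  · change QuasiCompact (Spec.map (CommRingCat.ofHom (algebraMap k k[T;T⁻¹])))
    infer_instance
  · change ConnectedSpace (PrimeSpectrum k[T;T⁻¹])
    infer_instance

end Gm

end
end

/-- Over an algebraically closed field `k` of characteristic zero, a
variety `X` over `k` is groupless if and only if every morphism from every finite type
connected group scheme over `k` to `X` is constant. -/
theorem stmt_3 (k : Type) [Field k] [IsAlgClosed k] [CharZero k]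
    (X : OverR k) (hX : IsVarietyOver X) :
    IsGroupless k X ↔
      ∀ Γ : GroupScheme k, Γ.IsFiniteTypeConnected → ∀ f : Γ.G ⟶ X, IsConstant f := by
  exact ⟨fun h Γ hΓ f => forward X hX h Γ hΓ f, fun h => ⟨fun f => h (GmGroup k) GmGroup_ftc f,
    fun Γ hΓ f => h Γ hΓ.1 f⟩⟩

end
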